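/- arXiv:1211.1477 — 3 statements merged into one kernel-verified Lean document; each statement's English description precedes it below -/
import Mathlib

section
/- Let R be a Noetherian local ring with maximal ideal m, I an ideal, 𝔑 = ⊕_{n≥0} N_n a finitely generated graded module over a finitely generated standard graded R-algebra with degree-0 part R, and let r_1 be the eventual value of the generalized depth gdepth(I, N_n) = depth_1(I, N_n). Then for each integer l ≤ r_1, the set ⋃_{j≤l} Ass_R(H^j_I(N_n)) ∪ {m} is finite and independent of n for all sufficiently large n. -/
open CategoryTheory Opposite IsLocalRing

/-- Interpretation of an integer `k ≥ -1` in `WithBot ℕ∞`, for comparison with Krull dimensions. -/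
noncomputable def zdim (k : ℤ) : WithBot (WithTop ℕ) :=
  if k < 0 then ⊥ else ((k.toNat : WithTop ℕ) : WithBot (WithTop ℕ))

/-- The ideal generated by the first `j` entries of the sequence `x`. -/
def prefIdeal {R : Type} [CommRing R] {r : ℕ} (x : Fin r → R) (j : ℕ) : Ideal R :=
  Ideal.span (x '' {i | (i : ℕ) < j})

/-- `x` is an `N`-sequence in dimension `> k`: for each `i`, `x i` avoids every associated
prime `p` of `N/(x_0,…,x_{i-1})N` with `dim(R/p) > k`. -/
def IsSeqInDimGT (R : Type) [CommRing R] (N : Type) [AddCommGroup N] [Module R N]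
    (k : ℤ) {r : ℕ} (x : Fin r → R) : Prop :=
  ∀ i : Fin r, ∀ p ∈ associatedPrimes R (N ⧸ (prefIdeal x (i : ℕ) • ⊤ : Submodule R N)),
    zdim k < ringKrullDim (R ⧸ p) → x i ∉ p

/-- `depth_k(I,N)`: the common length of maximal `N`-sequences in dimension `> k`
contained in `I` (realized as the supremum of lengths of such sequences). -/
noncomputable def depthK (R : Type) [CommRing R] (k : ℤ) (I : Ideal R)
    (N : Type) [AddCommGroup N] [Module R N] : ℕ∞ :=
  sSup {n : ℕ∞ | ∃ (r : ℕ) (x : Fin r → R),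
    (∀ i, x i ∈ I) ∧ IsSeqInDimGT R N k x ∧ n = (r : ℕ∞)}

/-- The set of prime (or arbitrary) ideals `p` with `dim(R/p) ≥ k`. -/
def dimGE (R : Type) [CommRing R] (k : ℤ) : Set (Ideal R) :=
  {p | zdim k ≤ ringKrullDim (R ⧸ p)}

namespace CategoryTheory.ProjectiveResolution
section
universe v u
variable {R : Type*} [Ring R] {C : Type u} [Category.{v} C] [Abelian C] [Linear R C]
  [EnoughProjectives C]

/-- The cochain map induced on `Hom(-, Y)` by a map of chain complexes. -/
noncomputable def linearYonedaMap {K L : ChainComplex C ℕ} (φ : K ⟶ L) (Y : C) :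
    L.linearYonedaObj R Y ⟶ K.linearYonedaObj R Y :=
  (HomologicalComplex.unopFunctor _ _).map
    ((((linearYoneda R C).obj Y).rightOp.mapHomologicalComplex _).map φ).op

lemma isoExt_inv_naturality {X X' : C} (f : X ⟶ X') (P : ProjectiveResolution X)
    (P' : ProjectiveResolution X') (φ : Hom P P' f) (n : ℕ) (Y : C) :
    (P'.isoExt (R := R) n Y).inv ≫ ((_root_.Ext R C n).map f.op).app Y =
      HomologicalComplex.homologyMap (linearYonedaMap φ.hom Y) n ≫
        (P.isoExt (R := R) n Y).inv := by
  have h := P.isoLeftDerivedObj_hom_naturality f P' φ.hom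
    (by rw [φ.hom_f_zero_comp_π_f_zero, ChainComplex.single₀_map_f_zero]; rfl)
    ((linearYoneda R C).obj Y).rightOp n
  have h2 := HomologicalComplex.homologyOp_hom_naturality (linearYonedaMap (R := R) φ.hom Y) n
  have h3 := congrArg Quiver.Hom.unop h2
  exact (Category.assoc _ _ _).trans ((congrArg (fun t ↦
    (HomologicalComplex.homologyUnop _ _).hom ≫ Quiver.Hom.unop t) h).trans
    ((Category.assoc _ _ _).symm.trans ((congrArg (fun t ↦ t ≫
      (P.isoLeftDerivedObj ((linearYoneda R C).obj Y).rightOp n).hom.unop) h3).trans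
      (Category.assoc _ _ _))))

end
end CategoryTheory.ProjectiveResolution

namespace CochainComplex
section
universe v
variable {R : Type*} [Ring R]

/-- The map sending a cocycle to its cohomology class. -/
noncomputable def cocycleClass (K : CochainComplex (ModuleCat.{v} R) ℕ) (n : ℕ) :
    LinearMap.ker (K.d n (n + 1)).hom →ₗ[R] K.homology n :=
  (K.liftCycles (ModuleCat.ofHom (LinearMap.ker (K.d n (n + 1)).hom).subtype) (n + 1) (by simp)
    (by ext x; exact x.2) ≫ K.homologyπ n).hom

lemma cocycleClass_eq (K : CochainComplex (ModuleCat.{v} R) ℕ) (n : ℕ) (z : K.cycles n)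
    (x : LinearMap.ker (K.d n (n + 1)).hom) (hx : K.iCycles n z = x) :
    K.cocycleClass n x = K.homologyπ n z := by
  have : K.liftCycles (ModuleCat.ofHom (LinearMap.ker (K.d n (n + 1)).hom).subtype) (n + 1)
      (by simp) (by ext x; exact x.2) x = z := by
    apply (ModuleCat.mono_iff_injective (K.iCycles n)).1 inferInstance
    rw [hx, ← ModuleCat.comp_apply, HomologicalComplex.liftCycles_i]
    rfl
  rw [← this]
  rfl

lemma cocycleClass_surjective (K : CochainComplex (ModuleCat.{v} R) ℕ) (n : ℕ) :
    Function.Surjective (K.cocycleClass n) := by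
  intro y
  obtain ⟨z, rfl⟩ := (ModuleCat.epi_iff_surjective (K.homologyπ n)).1 inferInstance y
  have hz : K.iCycles n z ∈ LinearMap.ker (K.d n (n + 1)).hom := by
    rw [LinearMap.mem_ker]
    have := congrArg (fun f ↦ f.hom z) (K.iCycles_d n (n + 1))
    exact this
  exact ⟨⟨_, hz⟩, K.cocycleClass_eq n z _ rfl⟩

lemma cocycleClass_eq_zero_iff (K : CochainComplex (ModuleCat.{v} R) ℕ) (n p : ℕ)
    (hp : (ComplexShape.up ℕ).prev n = p) (x : LinearMap.ker (K.d n (n + 1)).hom) :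
    K.cocycleClass n x = 0 ↔ ∃ y : K.X p, K.d p n y = x := by
  have hS : (ShortComplex.mk (K.toCycles p n) (K.homologyπ n) (by simp)).Exact :=
    ShortComplex.exact_of_g_is_cokernel _ (K.homologyIsCokernel p n hp)
  rw [ShortComplex.moduleCat_exact_iff] at hS
  constructor
  · intro h
    obtain ⟨y, hy⟩ := hS (K.liftCycles (ModuleCat.ofHom
      (LinearMap.ker (K.d n (n + 1)).hom).subtype) (n + 1) (by simp) (by ext x; exact x.2) x) h
    refine ⟨y, ?_⟩
    have := congrArg (K.iCycles n) hy
    dsimp at this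
    rw [← ModuleCat.comp_apply, ← ModuleCat.comp_apply, HomologicalComplex.toCycles_i,
      HomologicalComplex.liftCycles_i] at this
    exact this
  · rintro ⟨y, hy⟩
    rw [K.cocycleClass_eq n (K.toCycles p n y) x
      (by rw [← hy, ← ModuleCat.comp_apply, HomologicalComplex.toCycles_i]),
      ← ModuleCat.comp_apply]
    simp

lemma homologyMap_cocycleClass {K L : CochainComplex (ModuleCat.{v} R) ℕ} (φ : K ⟶ L) (n : ℕ)
    (x : LinearMap.ker (K.d n (n + 1)).hom) (y : LinearMap.ker (L.d n (n + 1)).hom)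
    (h : φ.f n x = y) :
    HomologicalComplex.homologyMap φ n (K.cocycleClass n x) = L.cocycleClass n y := by
  rw [L.cocycleClass_eq n (HomologicalComplex.cyclesMap φ n (K.liftCycles (ModuleCat.ofHom
      (LinearMap.ker (K.d n (n + 1)).hom).subtype) (n + 1) (by simp) (by ext x; exact x.2) x)) y]
  · rw [← ModuleCat.comp_apply, ← HomologicalComplex.homologyπ_naturality]
    rfl
  · rw [← ModuleCat.comp_apply, HomologicalComplex.cyclesMap_i, ModuleCat.comp_apply,
      ← ModuleCat.comp_apply (K.liftCycles _ _ _ _), HomologicalComplex.liftCycles_i, ← h]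
    rfl

end
end CochainComplex

namespace CategoryTheory.ProjectiveResolution
section
universe w v u
open Abelian
variable {R : Type*} [CommRing R] {C : Type u} [Category.{v} C] [Abelian C] [Linear R C]
  [HasExt.{w} C]

lemma extMk_zero_eq_zero_iff {X Y : C} (P : ProjectiveResolution X) (f : P.complex.X 0 ⟶ Y)
    (hf : P.complex.d 1 0 ≫ f = 0) : P.extMk f 1 rfl hf = 0 ↔ f = 0 := by
  refine ⟨fun h ↦ ?_, fun h ↦ by subst h; simp⟩
  simp only [← P.extEquivCohomologyClass.apply_eq_iff_eq,
    extEquivCohomologyClass_extMk, extEquivCohomologyClass_zero,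
    CochainComplex.HomComplex.CohomologyClass.mk_eq_zero_iff] at h
  rw [CochainComplex.HomComplex.Cocycle.toSingleMk_mem_coboundaries_iff _ _ _ _ _ 1 (by lia)] at h
  obtain ⟨g, hg⟩ := h
  rw [(CochainComplex.isZero_of_isStrictlyLE P.cochainComplex 0 1).eq_of_src g 0,
    Limits.comp_zero] at hg
  rw [← cancel_epi (P.cochainComplexXIso (-((0 : ℕ) : ℤ)) 0 rfl).hom, Limits.comp_zero]
  exact hg.symm

lemma extMk_smul {X Y : C} (P : ProjectiveResolution X) {n : ℕ} (r : R)
    (f : P.complex.X n ⟶ Y) (hf : P.complex.d (n + 1) n ≫ f = 0)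
    (hf' : P.complex.d (n + 1) n ≫ (r • f) = 0) :
    P.extMk (r • f) (n + 1) rfl hf' = r • P.extMk f (n + 1) rfl hf := by
  rw [Abelian.Ext.smul_eq_comp_mk₀, extMk_comp_mk₀]
  congr 1
  simp

/-- The map sending a cocycle in `Hom(P, Y)` to its class in `Ext X Y n`. -/
noncomputable def extClass {X : C} (P : ProjectiveResolution X) (Y : C) (n : ℕ) :
    LinearMap.ker ((P.complex.linearYonedaObj R Y).d n (n + 1)).hom →ₗ[R] Abelian.Ext X Y n where
  toFun x := P.extMk (x.1 : P.complex.X n ⟶ Y) (n + 1) rfl x.2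
  map_add' _ _ := (P.add_extMk _ _ _ _ _ _).symm
  map_smul' r x := P.extMk_smul r (x.1 : P.complex.X n ⟶ Y) x.2 _

lemma extClass_surjective {X : C} (P : ProjectiveResolution X) (Y : C) (n : ℕ) :
    Function.Surjective (P.extClass (R := R) Y n) := by
  intro y
  obtain ⟨f, hf, rfl⟩ := P.extMk_surjective y (n + 1) rfl
  exact ⟨⟨f, hf⟩, rfl⟩

lemma ker_extClass {X : C} (P : ProjectiveResolution X) (Y : C) (n : ℕ) :
    LinearMap.ker (P.extClass (R := R) Y n) =
      LinearMap.ker (CochainComplex.cocycleClass (P.complex.linearYonedaObj R Y) n) := by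
  ext x
  rw [LinearMap.mem_ker, LinearMap.mem_ker]
  cases n with
  | zero =>
    rw [CochainComplex.cocycleClass_eq_zero_iff _ 0 0 (by simp)]
    refine (P.extMk_zero_eq_zero_iff (x.1 : P.complex.X 0 ⟶ Y) x.2).trans ?_
    have h0 : (P.complex.linearYonedaObj R Y).d 0 0 = 0 :=
      HomologicalComplex.shape _ _ _ (by simp)
    rw [h0]
    exact ⟨fun h ↦ ⟨0, h.symm⟩, fun ⟨_, h⟩ ↦ h.symm⟩
  | succ p =>
    rw [CochainComplex.cocycleClass_eq_zero_iff _ (p + 1) p (by simp)]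
    exact P.extMk_eq_zero_iff (x.1 : P.complex.X (p + 1) ⟶ Y) _ rfl x.2 p rfl

end
end CategoryTheory.ProjectiveResolution

namespace CategoryTheory
section
universe w v u
open Abelian
variable (R : Type*) [CommRing R] {C : Type u} [Category.{v} C] [Abelian C] [Linear R C]
  [EnoughProjectives C] [HasExt.{w} C]

open ProjectiveResolution in
/-- The two definitions of `Ext` (by deriving `Hom`, and by localization) agree. -/
noncomputable def extLinearEquiv (X Y : C) (n : ℕ) :
    ((_root_.Ext R C n).obj (op X)).obj Y ≃ₗ[R] Abelian.Ext X Y n :=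
  ((projectiveResolution X).isoExt (R := R) n Y).toLinearEquiv ≪≫ₗ
    (LinearMap.quotKerEquivOfSurjective _ (CochainComplex.cocycleClass_surjective
      ((projectiveResolution X).complex.linearYonedaObj R Y) n)).symm ≪≫ₗ
    Submodule.quotEquivOfEq _ _ ((projectiveResolution X).ker_extClass Y n).symm ≪≫ₗ
    LinearMap.quotKerEquivOfSurjective _ ((projectiveResolution X).extClass_surjective Y n)

lemma extLinearEquiv_cocycleClass (X Y : C) (n : ℕ)
    (x : LinearMap.ker (((projectiveResolution X).complex.linearYonedaObj R Y).d n (n + 1)).hom) :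
    extLinearEquiv R X Y n (((projectiveResolution X).isoExt (R := R) n Y).inv
      (CochainComplex.cocycleClass _ n x)) = (projectiveResolution X).extClass Y n x := by
  have h : ((projectiveResolution X).isoExt (R := R) n Y).toLinearEquiv
      (((projectiveResolution X).isoExt (R := R) n Y).inv
      (CochainComplex.cocycleClass _ n x)) = CochainComplex.cocycleClass _ n x :=
    ((projectiveResolution X).isoExt (R := R) n Y).toLinearEquiv.apply_symm_apply _
  have h' : (LinearMap.quotKerEquivOfSurjective _ (CochainComplex.cocycleClass_surjective
      ((projectiveResolution X).complex.linearYonedaObj R Y) n)).symm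
      (CochainComplex.cocycleClass _ n x) = Submodule.Quotient.mk x := by
    rw [LinearEquiv.symm_apply_eq]
    rfl
  simp only [extLinearEquiv, LinearEquiv.trans_apply, h, h']
  rfl

lemma extLinearEquiv_naturality {X X' : C} (f : X ⟶ X') (Y : C) (n : ℕ)
    (x : ((_root_.Ext R C n).obj (op X')).obj Y) :
    extLinearEquiv R X Y n (((_root_.Ext R C n).map f.op).app Y x) =
      (Abelian.Ext.mk₀ f).comp (extLinearEquiv R X' Y n x) (zero_add n) := by
  let P := projectiveResolution X
  let P' := projectiveResolution X'
  let φ : ProjectiveResolution.Hom P P' f :=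
    { hom := ProjectiveResolution.lift f P P'
      hom_f_zero_comp_π_f_zero :=
        (ProjectiveResolution.lift_commutes_zero f P P').trans
          (by rw [ChainComplex.single₀_map_f_zero]; rfl) }
  obtain ⟨y, rfl⟩ : ∃ y, (P'.isoExt (R := R) n Y).inv y = x :=
    ⟨(P'.isoExt (R := R) n Y).hom x, by rw [← ModuleCat.comp_apply]; simp⟩
  obtain ⟨z, rfl⟩ := CochainComplex.cocycleClass_surjective _ n y
  have hz : P'.complex.d (n + 1) n ≫ (z.1 : P'.complex.X n ⟶ Y) = 0 := z.2
  have hm : P.complex.d (n + 1) n ≫ φ.hom.f n ≫ (z.1 : P'.complex.X n ⟶ Y) = 0 :=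
    (φ.hom.comm_assoc _ _ _).symm.trans
      ((congrArg (fun t ↦ φ.hom.f (n + 1) ≫ t) hz).trans Limits.comp_zero)
  let z' : LinearMap.ker ((P.complex.linearYonedaObj R Y).d n (n + 1)).hom :=
    ⟨(φ.hom.f n ≫ (z.1 : P'.complex.X n ⟶ Y) : P.complex.X n ⟶ Y), hm⟩
  rw [← ModuleCat.comp_apply, ProjectiveResolution.isoExt_inv_naturality f P P' φ,
    ModuleCat.comp_apply, CochainComplex.homologyMap_cocycleClass _ n z z' rfl]
  refine (extLinearEquiv_cocycleClass R X Y n z').trans ?_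
  refine Eq.trans ?_ (congrArg (fun t ↦ (Abelian.Ext.mk₀ f).comp t (zero_add n))
    (extLinearEquiv_cocycleClass R X' Y n z).symm)
  exact (ProjectiveResolution.mk₀_comp_extMk (z.1 : P'.complex.X n ⟶ Y) (n + 1) rfl hz φ).symm

end
end CategoryTheory

namespace localCohomology
section
open Limits
variable {R : Type} [CommRing R] (I : Ideal R)

/-- The `R`-module `R ⧸ I ^ s`. -/
noncomputable abbrev quotPow (s : ℕ) : ModuleCat.{0} R := ModuleCat.of R (R ⧸ I ^ s)

/-- The projection `R ⧸ I ^ t ⟶ R ⧸ I ^ s` for `s ≤ t`. -/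
noncomputable def quotPowMap {s t : ℕ} (h : s ≤ t) : quotPow I t ⟶ quotPow I s :=
  ModuleCat.ofHom (Submodule.mapQ _ _ LinearMap.id (Ideal.pow_le_pow_right h))

variable (j : ℕ) (N : ModuleCat.{0} R)

/-- The `R`-linear map from `Ext(R ⧸ I ^ s, N)` to local cohomology. -/
noncomputable def ofExt (s : ℕ) :
    Abelian.Ext (quotPow I s) N j →ₗ[R] (localCohomology I j).obj N :=
  ((colimit.ι (diagram (idealPowersDiagram I) j) (op (op s))).app N).hom ∘ₗ
    (extLinearEquiv R (quotPow I s) N j).symm.toLinearMap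

/-- Local cohomology of `N` as a colimit of `R`-modules. -/
noncomputable def isColimitEvaluation : IsColimit (((evaluation _ _).obj N).mapCocone
    (colimit.cocone (diagram (idealPowersDiagram I) j))) :=
  isColimitOfPreserves ((evaluation _ _).obj N) (colimit.isColimit _)

lemma exists_ofExt (y : (localCohomology I j).obj N) : ∃ s x, ofExt I j N s x = y := by
  obtain ⟨k, x, hx⟩ := Concrete.isColimit_exists_rep _ (isColimitEvaluation I j N) y
  exact ⟨k.unop.unop, extLinearEquiv R (quotPow I k.unop.unop) N j x,
    (congrArg ((colimit.ι (diagram (idealPowersDiagram I) j) k).app N).hom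
      (LinearEquiv.symm_apply_apply _ _)).trans hx⟩

lemma ofExt_symm_map {s t : ℕ} (h : s ≤ t) (x : Abelian.Ext (quotPow I s) N j) :
    (extLinearEquiv R (quotPow I t) N j).symm ((Abelian.Ext.mk₀ (quotPowMap I h)).comp x
      (zero_add j)) = ((diagram (idealPowersDiagram I) j).map (homOfLE h).op.op).app N
        ((extLinearEquiv R (quotPow I s) N j).symm x) := by
  refine (LinearEquiv.symm_apply_eq _).2
    (((extLinearEquiv_naturality R (quotPowMap I h) N j _).trans ?_).symm)
  rw [LinearEquiv.apply_symm_apply]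

lemma ofExt_map {s t : ℕ} (h : s ≤ t) (x : Abelian.Ext (quotPow I s) N j) :
    ofExt I j N t ((Abelian.Ext.mk₀ (quotPowMap I h)).comp x (zero_add j)) =
      ofExt I j N s x := by
  have hw := congrArg (fun t ↦ (t.app N).hom ((extLinearEquiv R (quotPow I s) N j).symm x))
    (colimit.w (diagram (idealPowersDiagram I) j) (homOfLE h).op.op)
  refine Eq.trans ?_ hw
  exact congrArg ((colimit.ι (diagram (idealPowersDiagram I) j) (op (op t))).app N).hom
    (ofExt_symm_map I j N h x)

lemma exists_map_eq_zero {s : ℕ} (x : Abelian.Ext (quotPow I s) N j) (hx : ofExt I j N s x = 0) :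
    ∃ (t : ℕ) (h : s ≤ t),
      (Abelian.Ext.mk₀ (quotPowMap I h)).comp x (zero_add j) = 0 := by
  obtain ⟨k, f, g, hk⟩ := Concrete.isColimit_exists_of_rep_eq _ (isColimitEvaluation I j N)
    (i := op (op s)) (j := op (op s))
    ((extLinearEquiv R (quotPow I s) N j).symm x) 0 (hx.trans (map_zero _).symm)
  have hst : s ≤ k.unop.unop := f.unop.unop.le
  exact ⟨k.unop.unop, hst, (extLinearEquiv R (quotPow I k.unop.unop) N j).symm.injective
    ((ofExt_symm_map I j N hst x).trans (hk.trans ((map_zero _).trans (map_zero _).symm)))⟩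

end
end localCohomology

/-- `Ext` groups of modules. -/
abbrev ModExt (R : Type) [CommRing R] (X N : Type) [AddCommGroup X] [Module R X]
    [AddCommGroup N] [Module R N] (n : ℕ) : Type :=
  Abelian.Ext.{0} (ModuleCat.of R X) (ModuleCat.of R N) n

namespace ModExt
section
variable {R : Type} [CommRing R]
variable {X Y Z N N' : Type} [AddCommGroup X] [Module R X] [AddCommGroup Y] [Module R Y]
  [AddCommGroup N] [Module R N] [AddCommGroup N'] [Module R N'] [AddCommGroup Z] [Module R Z]

/-- Contravariant functoriality of `Ext`. -/
noncomputable def pre (f : X →ₗ[R] Y) (N : Type) [AddCommGroup N] [Module R N] (n : ℕ) :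
    ModExt R Y N n →ₗ[R] ModExt R X N n :=
  Abelian.Ext.precompOfLinear (Abelian.Ext.mk₀ (ModuleCat.ofHom f)) R _ (zero_add n)

/-- Covariant functoriality of `Ext`. -/
noncomputable def post (X : Type) [AddCommGroup X] [Module R X] (g : N →ₗ[R] N') (n : ℕ) :
    ModExt R X N n →ₗ[R] ModExt R X N' n :=
  Abelian.Ext.postcompOfLinear (Abelian.Ext.mk₀ (ModuleCat.ofHom g)) R _ (add_zero n)

lemma pre_apply (f : X →ₗ[R] Y) (n : ℕ) (w : ModExt R Y N n) :
    pre f N n w = (Abelian.Ext.mk₀ (ModuleCat.ofHom f)).comp w (zero_add n) := rfl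

lemma post_apply (g : N →ₗ[R] N') (n : ℕ) (w : ModExt R X N n) :
    post X g n w = w.comp (Abelian.Ext.mk₀ (ModuleCat.ofHom g)) (add_zero n) := rfl

lemma pre_id (n : ℕ) (w : ModExt R X N n) : pre (LinearMap.id : X →ₗ[R] X) N n w = w := by
  rw [pre_apply, ModuleCat.ofHom_id, Abelian.Ext.mk₀_id_comp]

lemma post_id (n : ℕ) (w : ModExt R X N n) : post X (LinearMap.id : N →ₗ[R] N) n w = w := by
  rw [post_apply, ModuleCat.ofHom_id, Abelian.Ext.comp_mk₀_id]

lemma pre_pre (f : X →ₗ[R] Y) (g : Y →ₗ[R] Z) (n : ℕ) (w : ModExt R Z N n) :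
    pre f N n (pre g N n w) = pre (g ∘ₗ f) N n w := by
  rw [pre_apply, pre_apply, pre_apply, ModuleCat.ofHom_comp, Abelian.Ext.mk₀_comp_mk₀_assoc]

lemma post_post (f : N →ₗ[R] N') (g : N' →ₗ[R] Z) (n : ℕ) (w : ModExt R X N n) :
    post X g n (post X f n w) = post X (g ∘ₗ f) n w := by
  rw [post_apply, post_apply, post_apply, ModuleCat.ofHom_comp,
    Abelian.Ext.comp_assoc_of_second_deg_zero, Abelian.Ext.mk₀_comp_mk₀]

lemma pre_smul_id (r : R) (n : ℕ) (w : ModExt R X N n) :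
    pre (r • (LinearMap.id : X →ₗ[R] X)) N n w = r • w := by
  have : ModuleCat.ofHom (r • (LinearMap.id : X →ₗ[R] X)) = r • 𝟙 (ModuleCat.of R X) := rfl
  rw [pre_apply, this, Abelian.Ext.mk₀_smul, Abelian.Ext.smul_comp, Abelian.Ext.mk₀_id_comp]

lemma post_smul_id (r : R) (n : ℕ) (w : ModExt R X N n) :
    post X (r • (LinearMap.id : N →ₗ[R] N)) n w = r • w := by
  have : ModuleCat.ofHom (r • (LinearMap.id : N →ₗ[R] N)) = r • 𝟙 (ModuleCat.of R N) := rfl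
  rw [post_apply, this, Abelian.Ext.mk₀_smul, Abelian.Ext.comp_smul, Abelian.Ext.comp_mk₀_id]

/-- Functoriality of `Ext` in the first variable, as an additive map. -/
noncomputable def preHom (n : ℕ) (w : ModExt R Y N n) : (X →ₗ[R] Y) →+ ModExt R X N n where
  toFun f := pre f N n w
  map_zero' := by
    have : ModuleCat.ofHom (0 : X →ₗ[R] Y) = 0 := rfl
    rw [pre_apply, this, Abelian.Ext.mk₀_zero, Abelian.Ext.zero_comp]
  map_add' f g := by
    have : ModuleCat.ofHom (f + g) = ModuleCat.ofHom f + ModuleCat.ofHom g := rfl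
    rw [pre_apply, this, Abelian.Ext.mk₀_add, Abelian.Ext.add_comp]
    rfl

lemma preHom_apply (n : ℕ) (w : ModExt R Y N n) (f : X →ₗ[R] Y) :
    preHom n w f = pre f N n w := rfl

lemma smul_eq_zero_of_left {r : R} (hr : ∀ x : X, r • x = 0) {n : ℕ} (w : ModExt R X N n) :
    r • w = 0 := by
  have : r • (LinearMap.id : X →ₗ[R] X) = 0 := by ext x; exact hr x
  rw [← pre_smul_id, this]
  exact (preHom n w).map_zero

lemma smul_eq_zero_of_right {r : R} (hr : ∀ x : N, r • x = 0) {n : ℕ} (w : ModExt R X N n) :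
    r • w = 0 := by
  have h : r • (LinearMap.id : N →ₗ[R] N) = 0 := by ext x; exact hr x
  have h' : ModuleCat.ofHom (0 : N →ₗ[R] N) = 0 := rfl
  rw [← post_smul_id, h, post_apply, h', Abelian.Ext.mk₀_zero, Abelian.Ext.comp_zero]

lemma pre_injective_zero {f : X →ₗ[R] Y} (hf : Function.Surjective f) {w : ModExt R Y N 0}
    (hw : pre f N 0 w = 0) : w = 0 := by
  have : Epi (ModuleCat.ofHom f) := (ModuleCat.epi_iff_surjective _).2 hf
  exact Abelian.Ext.precomp_mk₀_injective_of_epi _ (ModuleCat.ofHom f) (hw.trans (map_zero _).symm)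

lemma exists_pre_eq {f : X →ₗ[R] Y} (hf : Function.Surjective f) {n : ℕ} (v : ModExt R X N n)
    (hv : pre (LinearMap.ker f).subtype N n v = 0) : ∃ w, pre f N n w = v :=
  Abelian.Ext.contravariant_sequence_exact₂ (LinearMap.shortExact_shortComplexKer hf) _ v hv

/-- The contravariant connecting homomorphism. -/
noncomputable def preConnecting {f : X →ₗ[R] Y} (hf : Function.Surjective f) (N : Type)
    [AddCommGroup N] [Module R N] (n : ℕ) :
    ModExt R (LinearMap.ker f) N n →ₗ[R] ModExt R Y N (n + 1) :=
  Abelian.Ext.precompOfLinear (LinearMap.shortExact_shortComplexKer hf).extClass R _ (add_comm 1 n)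

lemma exists_preConnecting_eq {f : X →ₗ[R] Y} (hf : Function.Surjective f) {n : ℕ}
    (w : ModExt R Y N (n + 1)) (hw : pre f N (n + 1) w = 0) :
    ∃ v, preConnecting hf N n v = w :=
  Abelian.Ext.contravariant_sequence_exact₃ (LinearMap.shortExact_shortComplexKer hf) _ w hw
    (add_comm 1 n)

lemma preConnecting_eq_zero_iff {f : X →ₗ[R] Y} (hf : Function.Surjective f) {n : ℕ}
    (w : ModExt R (LinearMap.ker f) N n) :
    preConnecting hf N n w = 0 ↔ ∃ v, pre (LinearMap.ker f).subtype N n v = w := by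
  refine ⟨fun h ↦ Abelian.Ext.contravariant_sequence_exact₁
    (LinearMap.shortExact_shortComplexKer hf) _ w (add_comm 1 n) h, ?_⟩
  rintro ⟨v, rfl⟩
  exact (LinearMap.shortExact_shortComplexKer hf).extClass_comp_assoc v (h := add_comm 1 n)

lemma exists_post_eq {g : N →ₗ[R] N'} (hg : Function.Surjective g) {n : ℕ} (v : ModExt R X N n)
    (hv : post X g n v = 0) : ∃ w, post X (LinearMap.ker g).subtype n w = v :=
  Abelian.Ext.covariant_sequence_exact₂ _ (LinearMap.shortExact_shortComplexKer hg) v hv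

lemma post_injective_zero {g : N →ₗ[R] N'} (hg : Function.Injective g) {w : ModExt R X N 0}
    (hw : post X g 0 w = 0) : w = 0 := by
  have : Mono (ModuleCat.ofHom g) := (ModuleCat.mono_iff_injective _).2 hg
  exact Abelian.Ext.postcomp_mk₀_injective_of_mono _ (ModuleCat.ofHom g)
    (hw.trans (map_zero _).symm)

/-- The covariant connecting homomorphism. -/
noncomputable def postConnecting (X : Type) [AddCommGroup X] [Module R X] {g : N →ₗ[R] N'}
    (hg : Function.Surjective g) (n : ℕ) :
    ModExt R X N' n →ₗ[R] ModExt R X (LinearMap.ker g) (n + 1) :=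
  Abelian.Ext.postcompOfLinear (LinearMap.shortExact_shortComplexKer hg).extClass R _ rfl

lemma exists_postConnecting_eq {g : N →ₗ[R] N'} (hg : Function.Surjective g) {n : ℕ}
    (w : ModExt R X (LinearMap.ker g) (n + 1))
    (hw : post X (LinearMap.ker g).subtype (n + 1) w = 0) :
    ∃ v, postConnecting X hg n v = w :=
  Abelian.Ext.covariant_sequence_exact₁ _ (LinearMap.shortExact_shortComplexKer hg) w hw rfl

lemma eq_sum_pre_proj {a n : ℕ} (w : ModExt R (Fin a → X) N n) :
    w = ∑ i, pre (LinearMap.proj i) N n (pre (LinearMap.single R (fun _ ↦ X) i) N n w) := by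
  have hid : (LinearMap.id : (Fin a → X) →ₗ[R] (Fin a → X)) =
      ∑ i, LinearMap.single R (fun _ ↦ X) i ∘ₗ LinearMap.proj i := by
    ext i x j
    simp [Finset.sum_apply, Pi.single_apply, Function.comp_def]
  conv_lhs => rw [← pre_id n w, hid, ← preHom_apply, map_sum]
  exact Finset.sum_congr rfl fun i _ ↦ (pre_pre _ _ n w).symm

end
end ModExt

/-- The localization of the module `A` at the prime `p` vanishes. -/
def VanishesAt {R : Type} [CommRing R] (p : Ideal R) (A : Type) [AddCommGroup A] [Module R A] :
    Prop :=
  ∀ a : A, ∃ r ∉ p, r • a = 0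

namespace VanishesAt
section
variable {R : Type} [CommRing R] {p : Ideal R}
variable {X Y N N' : Type} [AddCommGroup X] [Module R X] [AddCommGroup Y] [Module R Y]
  [AddCommGroup N] [Module R N] [AddCommGroup N'] [Module R N']

lemma exists_smul_eq_zero [hp : p.IsPrime] [Module.Finite R X] (h : VanishesAt p X) :
    ∃ r ∉ p, ∀ a : X, r • a = 0 := by
  obtain ⟨n, s, hs⟩ := Module.Finite.exists_fin (R := R) (M := X)
  choose r hr hr' using fun i ↦ h (s i)
  refine ⟨∏ i, r i, fun hmem ↦ ?_, fun a ↦ ?_⟩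
  · obtain ⟨i, _, hi⟩ := (Ideal.IsPrime.prod_mem_iff (p := p)).1 hmem
    exact hr i hi
  · have ha : a ∈ Submodule.span R (Set.range s) := hs ▸ Submodule.mem_top
    induction ha using Submodule.span_induction with
    | mem x hx =>
      obtain ⟨i, rfl⟩ := hx
      rw [← Finset.prod_erase_mul _ _ (Finset.mem_univ i), mul_smul, hr', smul_zero]
    | zero => simp
    | add x y _ _ hx hy => rw [smul_add, hx, hy, add_zero]
    | smul c x _ hx => rw [smul_comm, hx, smul_zero]

lemma of_smul [hp : p.IsPrime] {f : X →ₗ[R] Y} (hX : VanishesAt p X) {y : Y} {r : R} (hr : r ∉ p)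
    (hy : r • y ∈ Set.range f) : ∃ r ∉ p, r • y = 0 := by
  obtain ⟨x, hx⟩ := hy
  obtain ⟨s, hs, hs'⟩ := hX x
  refine ⟨s * r, fun h ↦ (hp.mem_or_mem h).elim hs hr, ?_⟩
  rw [mul_smul, ← hx, ← map_smul, hs', map_zero]

lemma ext_left [p.IsPrime] [Module.Finite R X] (h : VanishesAt p X) (n : ℕ) :
    VanishesAt p (ModExt R X N n) := by
  obtain ⟨r, hr, hr'⟩ := h.exists_smul_eq_zero
  exact fun w ↦ ⟨r, hr, ModExt.smul_eq_zero_of_left hr' w⟩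

lemma ext_right [p.IsPrime] [Module.Finite R N] (h : VanishesAt p N) (n : ℕ) :
    VanishesAt p (ModExt R X N n) := by
  obtain ⟨r, hr, hr'⟩ := h.exists_smul_eq_zero
  exact fun w ↦ ⟨r, hr, ModExt.smul_eq_zero_of_right hr' w⟩

lemma exists_smul_eq_zero_of_pre [p.IsPrime] {f : X →ₗ[R] Y} (hf : Function.Surjective f) {t : ℕ}
    (hK : ∀ j < t, VanishesAt p (ModExt R (LinearMap.ker f) N j)) (w : ModExt R Y N t) {r : R}
    (hr : r ∉ p) (hw : r • ModExt.pre f N t w = 0) : ∃ r ∉ p, r • w = 0 := by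
  rw [← map_smul] at hw
  cases t with
  | zero => exact ⟨r, hr, ModExt.pre_injective_zero hf hw⟩
  | succ n => exact of_smul (hK n n.lt_succ_self) hr (ModExt.exists_preConnecting_eq hf _ hw)

lemma pi_left [hp : p.IsPrime] {n : ℕ} (h : VanishesAt p (ModExt R X N n)) (a : ℕ) :
    VanishesAt p (ModExt R (Fin a → X) N n) := by
  intro w
  choose r hr hr' using fun i : Fin a ↦ h (ModExt.pre (LinearMap.single R (fun _ ↦ X) i) N n w)
  refine ⟨∏ i, r i, fun hmem ↦ ?_, ?_⟩
  · obtain ⟨i, _, hi⟩ := (Ideal.IsPrime.prod_mem_iff (p := p)).1 hmem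
    exact hr i hi
  · rw [ModExt.eq_sum_pre_proj w, Finset.smul_sum]
    refine Finset.sum_eq_zero fun i _ ↦ ?_
    rw [← map_smul, ← Finset.prod_erase_mul _ _ (Finset.mem_univ i), mul_smul, hr', smul_zero,
      map_zero]

lemma exists_surjective {J : Ideal R} [Module.Finite R X] (hX : ∀ r ∈ J, ∀ x : X, r • x = 0) :
    ∃ (a : ℕ) (f : (Fin a → R ⧸ J) →ₗ[R] X), Function.Surjective f := by
  obtain ⟨a, s, hs⟩ := Module.Finite.exists_fin (R := R) (M := X)
  let g (i : Fin a) : (R ⧸ J) →ₗ[R] X := Submodule.liftQ J (LinearMap.toSpanSingleton R X (s i))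
    fun r hr ↦ hX r hr _
  refine ⟨a, LinearMap.lsum R (fun _ ↦ R ⧸ J) ℕ g, ?_⟩
  rw [← LinearMap.range_eq_top, eq_top_iff, ← hs, Submodule.span_le]
  rintro _ ⟨i, rfl⟩
  refine ⟨Pi.single i (Submodule.Quotient.mk 1), ?_⟩
  rw [LinearMap.lsum_piSingle]
  exact (Submodule.liftQ_apply _ _ _).trans (one_smul _ _)

variable [IsNoetherianRing R]

lemma ext_of_annihilated [p.IsPrime] {J : Ideal R} {t : ℕ}
    (hJ : ∀ j < t, VanishesAt p (ModExt R (R ⧸ J) N j)) (j : ℕ) (hj : j < t)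
    (X : Type) [AddCommGroup X] [Module R X] [Module.Finite R X]
    (hX : ∀ r ∈ J, ∀ x : X, r • x = 0) : VanishesAt p (ModExt R X N j) := by
  induction j using Nat.strong_induction_on generalizing X with
  | _ j ih =>
    intro w
    obtain ⟨a, f, hf⟩ := exists_surjective hX
    obtain ⟨r, hr, hr'⟩ := (hJ j hj).pi_left a (ModExt.pre f N j w)
    refine exists_smul_eq_zero_of_pre hf (fun i hi ↦ ih i hi (hi.trans hj) _ ?_) w hr hr'
    intro r hr x
    ext i
    obtain ⟨c, hc⟩ := Submodule.Quotient.mk_surjective _ (x.1 i)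
    change r • x.1 i = 0
    rw [← hc, ← Submodule.Quotient.mk_smul, Submodule.Quotient.mk_eq_zero]
    exact J.mul_mem_right _ hr

lemma ext_of_pow_annihilated [p.IsPrime] {J : Ideal R} {t : ℕ}
    (hJ : ∀ j < t, VanishesAt p (ModExt R (R ⧸ J) N j)) (s j : ℕ) (hj : j < t)
    (X : Type) [AddCommGroup X] [Module R X] [Module.Finite R X]
    (hX : ∀ r ∈ J ^ s, ∀ x : X, r • x = 0) : VanishesAt p (ModExt R X N j) := by
  induction s generalizing X with
  | zero =>
    refine ext_left (fun x ↦ ⟨1, fun h ↦ ‹p.IsPrime›.ne_top ((Ideal.eq_top_iff_one p).2 h), ?_⟩) _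
    exact hX 1 (by simp) x
  | succ s ih =>
    intro w
    let f := (J • (⊤ : Submodule R X)).mkQ
    have hf : Function.Surjective f := Submodule.mkQ_surjective _
    have h1 : VanishesAt p (ModExt R (LinearMap.ker f) N j) := by
      refine ih _ fun r hr x ↦ ?_
      obtain ⟨x, hx⟩ := x
      rw [Submodule.ker_mkQ] at hx
      ext
      change r • x = 0
      refine Submodule.smul_induction_on hx (fun a ha y _ ↦ ?_) fun y z hy hz ↦ ?_
      · rw [smul_smul]
        exact hX _ (pow_succ J s ▸ Ideal.mul_mem_mul hr ha) y
      · rw [smul_add, hy, hz, add_zero]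
    have h2 : VanishesAt p (ModExt R (X ⧸ J • (⊤ : Submodule R X)) N j) := by
      refine ext_of_annihilated hJ j hj _ fun r hr x ↦ ?_
      obtain ⟨x, rfl⟩ := Submodule.Quotient.mk_surjective _ x
      rw [← Submodule.Quotient.mk_smul, Submodule.Quotient.mk_eq_zero]
      exact Submodule.smul_mem_smul hr trivial
    obtain ⟨r, hr, hr'⟩ := h1 (ModExt.pre (LinearMap.ker f).subtype N j w)
    rw [← map_smul] at hr'
    exact of_smul h2 hr (ModExt.exists_pre_eq hf _ hr')

end
end VanishesAt

lemma prefIdeal_succ {R : Type} [CommRing R] {r : ℕ} (x : Fin r → R) (i : Fin r) :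
    prefIdeal x (i + 1) = prefIdeal x i ⊔ Ideal.span {x i} := by
  rw [prefIdeal, prefIdeal, ← Ideal.span_union, ← Set.image_singleton, ← Set.image_union]
  congr 2
  ext j
  simp only [Set.mem_ofPred_eq, Set.mem_union, Set.mem_singleton_iff, Fin.ext_iff]
  omega

section
variable {R : Type} [CommRing R] [IsNoetherianRing R]

lemma mem_associatedPrimes_iff {A : Type*} [AddCommGroup A] [Module R A] {p : Ideal R} :
    p ∈ associatedPrimes R A ↔ p.IsPrime ∧ ∃ a : A, ∀ r, r ∈ p ↔ r • a = 0 := by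
  rw [AssociatedPrimes.mem_iff, isAssociatedPrime_iff]
  refine and_congr_right fun _ ↦ exists_congr fun a ↦ ?_
  rw [Ideal.ext_iff]
  simp [Submodule.mem_colon_singleton]

lemma exists_mem_associatedPrimes_le {A : Type*} [AddCommGroup A] [Module R A] {p : Ideal R}
    [p.IsPrime] (a : A) (ha : ∀ r, r • a = 0 → r ∈ p) :
    ∃ q ∈ associatedPrimes R A, q ≤ p ∧ ∀ r : R, r • a = 0 → r ∈ q := by
  obtain ⟨q, hq, hqp⟩ := Ideal.exists_minimalPrimes_le (I := (⊥ : Submodule R A).colon {a}) (J := p)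
    (fun r hr ↦ ha r (by simpa [Submodule.mem_colon_singleton] using hr))
  refine ⟨q, ?_, hqp, fun r hr ↦ hq.1.2 (by simpa [Submodule.mem_colon_singleton] using hr)⟩
  rw [AssociatedPrimes.mem_iff, isAssociatedPrime_iff]
  exact ⟨hq.1.1, Submodule.exists_eq_colon_of_mem_minimalPrimes hq⟩

variable {N C X : Type} [AddCommGroup N] [Module R N] [AddCommGroup C] [Module R C]
  [AddCommGroup X] [Module R X] {q : Ideal R} [q.IsPrime]

lemma VanishesAt.ext_of_lsmul [Module.Finite R N] {x : R} (hX : ∀ y : X, x • y = 0)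
    (hK : VanishesAt q (LinearMap.ker (LinearMap.lsmul R N x))) {g : N →ₗ[R] C}
    (hg : Function.Surjective g) (hg' : LinearMap.ker g = LinearMap.range (LinearMap.lsmul R N x))
    {t : ℕ} (hC : ∀ j < t, VanishesAt q (ModExt R X C j)) (j : ℕ) (hj : j < t + 1) :
    VanishesAt q (ModExt R X N j) := by
  intro w
  let m : N →ₗ[R] LinearMap.ker g := (LinearMap.lsmul R N x).codRestrict _
    fun y ↦ hg' ▸ LinearMap.mem_range_self _ y
  have hm : Function.Surjective m := by
    rintro ⟨y, hy⟩
    rw [hg'] at hy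
    obtain ⟨z, rfl⟩ := hy
    exact ⟨z, rfl⟩
  have hK' : VanishesAt q (LinearMap.ker m) := by
    rintro ⟨y, hy⟩
    obtain ⟨r, hr, hr'⟩ := hK ⟨y, congrArg Subtype.val hy⟩
    exact ⟨r, hr, Subtype.ext (congrArg (fun z ↦ z.1) hr')⟩
  have hv : ModExt.post X (LinearMap.ker g).subtype j (ModExt.post X m j w) = 0 := by
    have : (LinearMap.ker g).subtype ∘ₗ m = x • LinearMap.id := by ext y; rfl
    rw [ModExt.post_post, this, ModExt.post_smul_id, ModExt.smul_eq_zero_of_left hX]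
  obtain ⟨r, hr, hr'⟩ : ∃ r ∉ q, r • ModExt.post X m j w = 0 := by
    cases j with
    | zero =>
      refine ⟨1, fun h ↦ ‹q.IsPrime›.ne_top ((Ideal.eq_top_iff_one q).2 h), ?_⟩
      rw [ModExt.post_injective_zero Subtype.val_injective hv, smul_zero]
    | succ n =>
      obtain ⟨u, hu⟩ := ModExt.exists_postConnecting_eq hg _ hv
      obtain ⟨r, hr, hr'⟩ := hC n (by omega) u
      exact ⟨r, hr, by rw [← hu, ← map_smul, hr', map_zero]⟩
  rw [← map_smul] at hr'
  exact VanishesAt.of_smul (hK'.ext_right j) hr (ModExt.exists_post_eq hm _ hr')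

lemma IsSeqInDimGT.vanishesAt_ker [Module.Finite R N] {r : ℕ} {x : Fin r → R} {k : ℤ}
    (hx : IsSeqInDimGT R N k x) (hq : zdim k < ringKrullDim (R ⧸ q)) (i : Fin r) :
    VanishesAt q (LinearMap.ker
      (LinearMap.lsmul R (N ⧸ (prefIdeal x i • ⊤ : Submodule R N)) (x i))) := by
  rintro ⟨a, ha⟩
  by_contra! h
  obtain ⟨q', hq', hle, hann⟩ := exists_mem_associatedPrimes_le (p := q) a fun r hr ↦ by
    by_contra hr'
    exact h r hr' (Subtype.ext hr)
  refine hx i q' hq' (hq.trans_le ?_) (hann _ ha)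
  exact ringKrullDim_le_of_surjective (Ideal.Quotient.factor hle)
    (Ideal.Quotient.factor_surjective hle)

lemma IsSeqInDimGT.vanishesAt_ext [Module.Finite R N] {r : ℕ} {x : Fin r → R} {k : ℤ}
    (hx : IsSeqInDimGT R N k x) (hq : zdim k < ringKrullDim (R ⧸ q))
    (hX : ∀ i, ∀ y : X, x i • y = 0) (j : ℕ) (hj : j < r) :
    VanishesAt q (ModExt R X N j) := by
  have key (t : ℕ) (ht : t ≤ r) (j : ℕ) (hj : j < t) :
      VanishesAt q (ModExt R X (N ⧸ (prefIdeal x (r - t) • ⊤ : Submodule R N)) j) := by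
    induction t generalizing j with
    | zero => omega
    | succ t ih =>
      let i : Fin r := ⟨r - (t + 1), by omega⟩
      have hi : r - t = i + 1 := by simp only [i]; omega
      have h1 := hx.vanishesAt_ker hq i
      have h2 := ih (by omega)
      rw [hi] at h2
      have hle : (prefIdeal x i • ⊤ : Submodule R N) ≤ prefIdeal x (i + 1) • ⊤ := by
        rw [prefIdeal_succ]
        exact Submodule.smul_mono_left le_sup_left
      refine VanishesAt.ext_of_lsmul (hX i) h1 (Submodule.factor_surjective hle) ?_ h2 j hj
      ext y
      obtain ⟨n, rfl⟩ := Submodule.Quotient.mk_surjective _ y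
      rw [LinearMap.mem_ker, LinearMap.mem_range]
      change Submodule.Quotient.mk n = 0 ↔ _
      rw [Submodule.Quotient.mk_eq_zero, prefIdeal_succ, Submodule.sup_smul]
      rw [Submodule.ideal_span_singleton_smul]
      constructor
      · intro hn
        obtain ⟨a, ha, _, ⟨b, -, rfl⟩, rfl⟩ := Submodule.mem_sup.1 hn
        refine ⟨Submodule.Quotient.mk b, (Submodule.Quotient.eq _).2 ?_⟩
        change x i • b - (a + x i • b) ∈ _
        rw [sub_add_cancel_right]
        exact neg_mem ha
      · rintro ⟨z, hz⟩
        obtain ⟨z, rfl⟩ := Submodule.Quotient.mk_surjective _ z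
        replace hz := (Submodule.Quotient.eq _).1 hz
        rw [← sub_sub_self (x i • z) n]
        exact sub_mem (Submodule.mem_sup_right ⟨z, trivial, rfl⟩) (Submodule.mem_sup_left hz)
  intro w
  have h0 : (prefIdeal x 0 • ⊤ : Submodule R N) = ⊥ := by simp [prefIdeal]
  let e := Submodule.quotEquivOfEqBot _ h0
  have h := key r le_rfl j hj
  rw [Nat.sub_self] at h
  obtain ⟨s, hs, hs'⟩ := h (ModExt.post X e.symm.toLinearMap j w)
  refine ⟨s, hs, ?_⟩
  rw [← ModExt.post_id j w, ← e.comp_symm, ← ModExt.post_post, ← map_smul, hs', map_zero]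

end

namespace localCohomology
section
variable {R : Type} [CommRing R] (I : Ideal R) {N : Type} [AddCommGroup N] [Module R N]

/-- The projection `R ⧸ I ^ b → R ⧸ I ^ a` for `a ≤ b`, as a linear map. -/
noncomputable def powProj {a b : ℕ} (h : a ≤ b) : (R ⧸ I ^ b) →ₗ[R] (R ⧸ I ^ a) :=
  Submodule.mapQ _ _ LinearMap.id (Ideal.pow_le_pow_right h)

lemma powProj_surjective {a b : ℕ} (h : a ≤ b) : Function.Surjective (powProj I h) := by
  intro x
  obtain ⟨r, rfl⟩ := Submodule.Quotient.mk_surjective _ x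
  exact ⟨Submodule.Quotient.mk r, rfl⟩

lemma powProj_comp {a b c : ℕ} (h : a ≤ b) (h' : b ≤ c) :
    powProj I h ∘ₗ powProj I h' = powProj I (h.trans h') := by
  ext
  rfl

lemma pow_smul_quot (s : ℕ) (r : R) (hr : r ∈ I ^ s) (x : R ⧸ I ^ s) : r • x = 0 := by
  obtain ⟨c, rfl⟩ := Submodule.Quotient.mk_surjective _ x
  rw [← Submodule.Quotient.mk_smul, Submodule.Quotient.mk_eq_zero]
  exact Ideal.mul_mem_right _ _ hr

variable {I}

/-- The natural map `Ext(R ⧸ I ^ s, N) → H_I(N)`. -/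
noncomputable def ofModExt (I : Ideal R) (N : Type) [AddCommGroup N] [Module R N] (j s : ℕ) :
    ModExt R (R ⧸ I ^ s) N j →ₗ[R] (localCohomology I j).obj (ModuleCat.of R N) :=
  ofExt I j (ModuleCat.of R N) s

lemma ofModExt_pre {j a b : ℕ} (h : a ≤ b) (w : ModExt R (R ⧸ I ^ a) N j) :
    ofModExt I N j b (ModExt.pre (powProj I h) N j w) = ofModExt I N j a w :=
  ofExt_map I j (ModuleCat.of R N) h w

lemma exists_pre_eq_zero {j a : ℕ} (w : ModExt R (R ⧸ I ^ a) N j) (hw : ofModExt I N j a w = 0) :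
    ∃ (b : ℕ) (h : a ≤ b), ModExt.pre (powProj I h) N j w = 0 :=
  exists_map_eq_zero I j (ModuleCat.of R N) w hw

variable [IsNoetherianRing R] {p : Ideal R}

lemma _root_.VanishesAt.notMem_associatedPrimes {A : Type} [AddCommGroup A] [Module R A]
    (h : VanishesAt p A) : p ∉ associatedPrimes R A := by
  intro hmem
  obtain ⟨_, a, ha⟩ := mem_associatedPrimes_iff.1 hmem
  obtain ⟨r, hr, hr'⟩ := h a
  exact hr ((ha r).2 hr')

lemma exists_annihilator_eq {t : ℕ} (y : (localCohomology I t).obj (ModuleCat.of R N))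
    (hy : ∀ r, r ∈ p ↔ r • y = 0) :
    ∃ (s : ℕ) (_ : 1 ≤ s) (z : ModExt R (R ⧸ I ^ s) N t), ∀ r, r ∈ p ↔ r • z = 0 := by
  obtain ⟨s, x, hx⟩ := exists_ofExt I t (ModuleCat.of R N) y
  replace hx : ofModExt I N t s x = y := hx
  obtain ⟨G, hG⟩ := IsNoetherian.noetherian p
  have hr : ∀ r ∈ p, ofModExt I N t s (r • x) = 0 := fun r hr ↦ by
    rw [map_smul, hx, (hy r).1 hr]
  have hk : ∀ g : G, ∃ (b : ℕ) (hb : s ≤ b), ModExt.pre (powProj I hb) N t (g.1 • x) = 0 :=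
    fun g ↦ exists_pre_eq_zero _ (hr _ (hG ▸ Submodule.subset_span g.2))
  choose b hb hb' using hk
  let c := max (max s 1) (Finset.univ.sup b)
  have hsc : s ≤ c := (le_max_left _ _).trans (le_max_left _ _)
  refine ⟨c, (le_max_right _ _).trans (le_max_left _ _), ModExt.pre (powProj I hsc) N t x,
    fun r ↦ ⟨fun hr ↦ ?_, fun hr ↦ ?_⟩⟩
  · have : p ≤ LinearMap.ker
        (LinearMap.toSpanSingleton R _ (ModExt.pre (powProj I hsc) N t x)) := by
      rw [← hG, Submodule.span_le]
      intro g hg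
      have hbc : b ⟨g, hg⟩ ≤ c := (Finset.le_sup (Finset.mem_univ _)).trans (le_max_right _ _)
      change g • _ = (0 : ModExt R (R ⧸ I ^ c) N t)
      rw [← map_smul, ← powProj_comp I (hb ⟨g, hg⟩) hbc, ← ModExt.pre_pre, hb' ⟨g, hg⟩, map_zero]
    exact this hr
  · rw [hy, ← hx, ← ofModExt_pre hsc, ← map_smul, hr, map_zero]

variable [hp : p.IsPrime]

lemma vanishesAt {t j : ℕ} (h : ∀ j < t, VanishesAt p (ModExt R (R ⧸ I ^ 1) N j)) (hj : j < t) :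
    VanishesAt p ((localCohomology I j).obj (ModuleCat.of R N)) := by
  intro y
  obtain ⟨s, x, rfl⟩ := exists_ofExt I j (ModuleCat.of R N) y
  obtain ⟨r, hr, hr'⟩ := VanishesAt.ext_of_pow_annihilated h s j hj (R ⧸ I ^ s)
    (by rw [pow_one]; exact pow_smul_quot I s) x
  exact ⟨r, hr, by rw [← map_smul, hr', map_zero]⟩

lemma exists_smul_eq_zero_of_pre_powProj {t : ℕ}
    (h : ∀ j < t, VanishesAt p (ModExt R (R ⧸ I ^ 1) N j)) {s : ℕ} (hs : 1 ≤ s)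
    (w : ModExt R (R ⧸ I ^ 1) N t) (hw : ModExt.pre (powProj I hs) N t w = 0) :
    ∃ r ∉ p, r • w = 0 := by
  refine VanishesAt.exists_smul_eq_zero_of_pre (powProj_surjective I hs) (fun j hj ↦
    VanishesAt.ext_of_pow_annihilated h s j hj _ ?_) w
    (fun h ↦ hp.ne_top ((Ideal.eq_top_iff_one p).2 h)) ((one_smul R _).trans hw)
  exact fun r hr x ↦ Subtype.ext (pow_smul_quot I s r (by rwa [pow_one] at hr) x)

lemma mem_associatedPrimes_of_ext {t : ℕ}
    (h : ∀ j < t, VanishesAt p (ModExt R (R ⧸ I ^ 1) N j))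
    (hmem : p ∈ associatedPrimes R (ModExt R (R ⧸ I ^ 1) N t)) :
    p ∈ associatedPrimes R ((localCohomology I t).obj (ModuleCat.of R N)) := by
  obtain ⟨_, z, hz⟩ := mem_associatedPrimes_iff.1 hmem
  refine mem_associatedPrimes_iff.2 ⟨hp, ofModExt I N t 1 z, fun r ↦ ⟨fun hr ↦ ?_, fun hr ↦ ?_⟩⟩
  · rw [← map_smul, (hz r).1 hr, map_zero]
  · rw [← map_smul] at hr
    obtain ⟨b, hb, hb'⟩ := exists_pre_eq_zero _ hr
    obtain ⟨r', hr', hr''⟩ := exists_smul_eq_zero_of_pre_powProj h hb _ hb'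
    rw [smul_smul, ← hz] at hr''
    exact (hp.mem_or_mem hr'').resolve_left hr'

lemma mem_associatedPrimes_ext_of {t : ℕ}
    (h : ∀ j < t, VanishesAt p (ModExt R (R ⧸ I ^ 1) N j))
    (hmem : p ∈ associatedPrimes R ((localCohomology I t).obj (ModuleCat.of R N))) :
    p ∈ associatedPrimes R (ModExt R (R ⧸ I ^ 1) N t) := by
  obtain ⟨_, y, hy⟩ := mem_associatedPrimes_iff.1 hmem
  obtain ⟨s, hs, z, hz⟩ := exists_annihilator_eq y hy
  have hIp : I ≤ p := hp.le_of_pow_le fun r hr ↦ (hz r).2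
    (ModExt.smul_eq_zero_of_left (pow_smul_quot I s r hr) z)
  let K := LinearMap.ker (powProj I hs)
  have hK : ∀ r ∈ I ^ s, ∀ x : K, r • x = 0 := fun r hr x ↦ Subtype.ext (pow_smul_quot I s r hr x)
  obtain ⟨a, g, hg⟩ := VanishesAt.exists_surjective (R := R) (J := I ^ s) (X := K) hK
  have hgz : ModExt.pre g N t (ModExt.pre K.subtype N t z) = 0 := by
    rw [ModExt.eq_sum_pre_proj (ModExt.pre g N t _)]
    refine Finset.sum_eq_zero fun i _ ↦ ?_
    rw [ModExt.pre_pre _ g, ModExt.pre_pre _ K.subtype]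
    let k := g (LinearMap.single R (fun _ ↦ R ⧸ I ^ s) i (Submodule.Quotient.mk 1))
    obtain ⟨c, hc⟩ := Submodule.Quotient.mk_surjective _ k.1
    have hcI : c ∈ I := by
      have := k.2
      rw [LinearMap.mem_ker, ← hc] at this
      have := (Submodule.Quotient.mk_eq_zero _).1 this
      simpa using this
    have : K.subtype ∘ₗ g ∘ₗ LinearMap.single R (fun _ ↦ R ⧸ I ^ s) i = c • LinearMap.id := by
      refine Submodule.linearMap_qext _ (LinearMap.ext_ring ?_)
      refine hc.symm.trans ?_
      change _ = Submodule.Quotient.mk (c • 1)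
      rw [smul_eq_mul, mul_one]
    rw [this, ModExt.pre_smul_id, (hz c).1 (hIp hcI), map_zero]
  obtain ⟨r, hr, hr'⟩ := VanishesAt.exists_smul_eq_zero_of_pre hg (p := p) (N := N) (t := t)
    (fun j hj ↦ VanishesAt.ext_of_pow_annihilated h s j hj _
      fun r hr x ↦ Subtype.ext (funext fun i ↦ pow_smul_quot I s r (by rwa [pow_one] at hr) _))
    (ModExt.pre K.subtype N t z) (fun h ↦ hp.ne_top ((Ideal.eq_top_iff_one p).2 h))
    ((one_smul R _).trans hgz)
  rw [← map_smul] at hr'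
  obtain ⟨w, hw⟩ := ModExt.exists_pre_eq (powProj_surjective I hs) _ hr'
  have hpw : VanishesAt p (Submodule.map (LinearMap.toSpanSingleton R _ w) p) := by
    rintro ⟨_, g, hg, rfl⟩
    obtain ⟨r', hr', hr''⟩ := exists_smul_eq_zero_of_pre_powProj (p := p) h hs (g • w) (by
      rw [map_smul, hw, smul_comm, (hz g).1 hg, smul_zero])
    exact ⟨r', hr', Subtype.ext hr''⟩
  have : Module.Finite R (Submodule.map (LinearMap.toSpanSingleton R _ w) p) :=
    Module.Finite.iff_fg.2 ((IsNoetherian.noetherian p).map _)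
  obtain ⟨r', hr', hr''⟩ := hpw.exists_smul_eq_zero
  refine mem_associatedPrimes_iff.2 ⟨hp, r' • w, fun c ↦ ⟨fun hc ↦ ?_, fun hc ↦ ?_⟩⟩
  · rw [smul_comm]
    exact congrArg Subtype.val (hr'' ⟨_, c, hc, rfl⟩)
  · have h1 := congrArg (ModExt.pre (powProj I hs) N t) hc
    rw [map_smul, map_smul, hw, map_zero, smul_smul, smul_smul, ← hz] at h1
    exact (hp.mem_or_mem ((hp.mem_or_mem h1).resolve_right hr)).resolve_right hr'

end
end localCohomology

lemma zdim_one_lt_ringKrullDim {R : Type} [CommRing R] {q p m : Ideal R} (hq : q.IsPrime)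
    (hp : p.IsPrime) (hm : m.IsPrime) (hqp : q < p) (hpm : p < m) :
    zdim 1 < ringKrullDim (R ⧸ q) := by
  let s : LTSeries (PrimeSpectrum.zeroLocus (q : Set R)) :=
    { length := 2
      toFun := ![⟨⟨q, hq⟩, fun _ h ↦ h⟩, ⟨⟨p, hp⟩, fun _ h ↦ hqp.le h⟩,
        ⟨⟨m, hm⟩, fun _ h ↦ (hqp.trans hpm).le h⟩]
      step := by
        intro i
        fin_cases i
        · exact hqp
        · exact hpm }
  rw [ringKrullDim_quotient]
  refine lt_of_lt_of_le ?_ (Order.LTSeries.length_le_krullDim s)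
  exact (WithBot.coe_lt_coe.2 (WithTop.coe_lt_coe.2 one_lt_two) :
    (((1 : ℕ) : WithTop ℕ) : WithBot (WithTop ℕ)) < (((2 : ℕ) : WithTop ℕ) : WithBot (WithTop ℕ)))

lemma exists_isSeqInDimGT_of_le_depthK {R : Type} [CommRing R] {N : Type} [AddCommGroup N]
    [Module R N] {k : ℤ} {I : Ideal R} {l : ℕ} (hl : (l : ℕ∞) ≤ depthK R k I N) :
    ∃ (r : ℕ) (x : Fin r → R), l ≤ r ∧ (∀ i, x i ∈ I) ∧ IsSeqInDimGT R N k x := by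
  by_contra! h
  cases l with
  | zero => exact h 0 Fin.elim0 le_rfl (fun i ↦ i.elim0) (fun i ↦ i.elim0)
  | succ l =>
    refine (Nat.cast_lt (α := ℕ∞).2 l.lt_succ_self).not_ge (hl.trans (sSup_le ?_))
    rintro _ ⟨r, x, hxI, hx, rfl⟩
    by_contra! hr
    exact h r x (Nat.cast_lt.1 hr) hxI hx

namespace localCohomology

theorem exists_mem_associatedPrimes_iff {R : Type} [CommRing R] [IsNoetherianRing R]
    [IsLocalRing R] {I : Ideal R} {N : Type} [AddCommGroup N] [Module R N] [Module.Finite R N]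
    {p : Ideal R} [hp : p.IsPrime] (hpm : p ≠ maximalIdeal R) {l : ℕ}
    (hl : (l : ℕ∞) ≤ depthK R 1 I N) :
    (∃ j ≤ l, p ∈ associatedPrimes R ((localCohomology I j).obj (ModuleCat.of R N))) ↔
      ∃ j ≤ l, p ∈ associatedPrimes R (ModExt R (R ⧸ I ^ 1) N j) := by
  obtain ⟨r, x, hlr, hxI, hx⟩ := exists_isSeqInDimGT_of_le_depthK hl
  by_cases h : ∀ j < l, VanishesAt p (ModExt R (R ⧸ I ^ 1) N j)
  · have h1 {j : ℕ} (hj : j ≤ l)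
        (hmem : p ∈ associatedPrimes R ((localCohomology I j).obj (ModuleCat.of R N))) : j = l :=
      hj.eq_of_not_lt fun hj' ↦ (vanishesAt h hj').notMem_associatedPrimes hmem
    have h2 {j : ℕ} (hj : j ≤ l)
        (hmem : p ∈ associatedPrimes R (ModExt R (R ⧸ I ^ 1) N j)) : j = l :=
      hj.eq_of_not_lt fun hj' ↦ (h j hj').notMem_associatedPrimes hmem
    constructor
    · rintro ⟨j, hj, hmem⟩
      obtain rfl := h1 hj hmem
      exact ⟨j, le_rfl, mem_associatedPrimes_ext_of h hmem⟩
    · rintro ⟨j, hj, hmem⟩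
      obtain rfl := h2 hj hmem
      exact ⟨j, le_rfl, mem_associatedPrimes_of_ext h hmem⟩
  · push Not at h
    classical
    have hmin : ∀ j < Nat.find h, VanishesAt p (ModExt R (R ⧸ I ^ 1) N j) := fun j hj ↦
      by_contra fun hj' ↦ Nat.find_min h hj ⟨hj.trans (Nat.find_spec h).1, hj'⟩
    obtain ⟨hlt, hnot⟩ := Nat.find_spec h
    generalize Nat.find h = t at hmin hlt hnot
    unfold VanishesAt at hnot
    push Not at hnot
    obtain ⟨z, hz⟩ := hnot
    obtain ⟨q, hq, hqp, -⟩ := exists_mem_associatedPrimes_le (p := p) z fun r hr ↦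
      by_contra fun hr' ↦ hz r hr' hr
    have hqprime : q.IsPrime := hq.isPrime
    obtain rfl : q = p := by
      refine hqp.eq_of_not_lt fun hlt' ↦ ?_
      refine (hx.vanishesAt_ext (X := R ⧸ I ^ 1) (q := q) (zdim_one_lt_ringKrullDim hqprime hp
        (maximalIdeal.isMaximal R).isPrime hlt' ((le_maximalIdeal hp.ne_top).lt_of_ne hpm))
        (fun i ↦ pow_smul_quot I 1 (x i) (by simpa using hxI i)) t
        (hlt.trans_le hlr)).notMem_associatedPrimes hq
    exact ⟨fun _ ↦ ⟨t, hlt.le, hq⟩, fun _ ↦ ⟨t, hlt.le, mem_associatedPrimes_of_ext hmin hq⟩⟩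

end localCohomology

namespace ModExt
section
variable {R : Type} [CommRing R] {X Y N : Type} [AddCommGroup X] [Module R X] [AddCommGroup Y]
  [Module R Y] [AddCommGroup N] [Module R N]

/-- `Ext` in degree zero is given by linear maps. -/
noncomputable def zeroEquiv (R X N : Type) [CommRing R] [AddCommGroup X] [Module R X]
    [AddCommGroup N] [Module R N] : ModExt R X N 0 ≃ₗ[R] (X →ₗ[R] N) :=
  Abelian.Ext.linearEquiv₀.trans ModuleCat.homLinearEquiv

lemma zeroEquiv_symm_apply (f : X →ₗ[R] N) :
    (zeroEquiv R X N).symm f = Abelian.Ext.mk₀ (ModuleCat.ofHom f) := rfl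

lemma pre_zeroEquiv_symm (f : X →ₗ[R] Y) (g : Y →ₗ[R] N) :
    pre f N 0 ((zeroEquiv R Y N).symm g) = (zeroEquiv R X N).symm (g ∘ₗ f) := by
  rw [pre_apply, zeroEquiv_symm_apply, zeroEquiv_symm_apply, ModuleCat.ofHom_comp,
    Abelian.Ext.mk₀_comp_mk₀]

lemma eq_zero_of_free (a : ℕ) {n : ℕ} (w : ModExt R (Fin a → R) N (n + 1)) : w = 0 := by
  have : Projective (ModuleCat.of R (Fin a → R)) :=
    (IsProjective.iff_projective (R := R) (P := Fin a → R)).1 inferInstance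
  exact Abelian.Ext.eq_zero_of_projective w

lemma preConnecting_surjective {a : ℕ} {f : (Fin a → R) →ₗ[R] X} (hf : Function.Surjective f)
    (n : ℕ) : Function.Surjective (preConnecting hf N n) :=
  fun w ↦ exists_preConnecting_eq hf w (eq_zero_of_free a _)

lemma preConnecting_injective {a : ℕ} {f : (Fin a → R) →ₗ[R] X} (hf : Function.Surjective f)
    (n : ℕ) : Function.Injective (preConnecting hf N (n + 1)) := by
  refine (injective_iff_map_eq_zero _).2 fun w hw ↦ ?_
  obtain ⟨v, rfl⟩ := (preConnecting_eq_zero_iff hf w).1 hw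
  rw [eq_zero_of_free a v, map_zero]

lemma ker_preConnecting {f : X →ₗ[R] Y} (hf : Function.Surjective f) :
    (LinearMap.ker (preConnecting hf N 0)).map (zeroEquiv R (LinearMap.ker f) N).toLinearMap =
      LinearMap.range (LinearMap.lcomp R N (LinearMap.ker f).subtype) := by
  ext g
  simp only [Submodule.mem_map, LinearMap.mem_ker, LinearMap.mem_range]
  constructor
  · rintro ⟨w, hw, rfl⟩
    obtain ⟨v, rfl⟩ := (preConnecting_eq_zero_iff hf w).1 hw
    obtain ⟨v, rfl⟩ := (zeroEquiv R X N).symm.surjective v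
    exact ⟨v, by rw [pre_zeroEquiv_symm]; exact (LinearEquiv.apply_symm_apply _ _).symm⟩
  · rintro ⟨v, rfl⟩
    refine ⟨(zeroEquiv R _ N).symm (v ∘ₗ (LinearMap.ker f).subtype), ?_,
      LinearEquiv.apply_symm_apply _ _⟩
    exact (preConnecting_eq_zero_iff hf _).2 ⟨_, pre_zeroEquiv_symm _ v⟩

/-- `Ext(X, -)` is naturally the cokernel of a map `Hom(B, -) → Hom(A, -)`. -/
theorem exists_equiv_coker [IsNoetherianRing R] (j : ℕ) (X : Type) [AddCommGroup X] [Module R X]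
    [Module.Finite R X] :
    ∃ (A B : Type) (_ : AddCommGroup A) (_ : Module R A) (_ : AddCommGroup B) (_ : Module R B)
      (_ : Module.Finite R A) (φ : A →ₗ[R] B),
      ∀ (N : Type) [AddCommGroup N] [Module R N], Nonempty
        (ModExt R X N j ≃ₗ[R] ((A →ₗ[R] N) ⧸ LinearMap.range (LinearMap.lcomp R N φ))) := by
  induction j generalizing X with
  | zero =>
    refine ⟨X, PUnit, _, _, _, _, ‹_›, 0, fun N _ _ ↦ ⟨(zeroEquiv R X N).trans
      (Submodule.quotEquivOfEqBot _ ?_).symm⟩⟩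
    rw [LinearMap.range_eq_bot]
    ext g x
    exact map_zero g
  | succ j ih =>
    obtain ⟨a, f, hf⟩ := Module.Finite.exists_fin' R X
    cases j with
    | zero =>
      exact ⟨LinearMap.ker f, Fin a → R, _, _, _, _, inferInstance, (LinearMap.ker f).subtype,
        fun N _ _ ↦ ⟨(LinearMap.quotKerEquivOfSurjective _
          (preConnecting_surjective hf 0)).symm.trans
          (Submodule.Quotient.equiv _ _ (zeroEquiv R _ N) (ker_preConnecting hf))⟩⟩
    | succ j =>
      obtain ⟨A, B, _, _, _, _, hA, φ, h⟩ := ih (LinearMap.ker f)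
      exact ⟨A, B, _, _, _, _, hA, φ, fun N _ _ ↦ (h N).map fun e ↦
        (LinearEquiv.ofBijective _ ⟨preConnecting_injective hf j,
          preConnecting_surjective hf (j + 1)⟩).symm.trans e⟩

end
end ModExt

section
variable {R : Type} [CommRing R] {S : Type} [CommRing S] [Algebra R S]
  {E : Type} [AddCommGroup E] [Module R E] [Module S E] [IsScalarTower R S E]

lemma finite_associatedPrimes_of_isScalarTower [IsNoetherianRing R] [IsNoetherianRing S]
    [Module.Finite S E] : (associatedPrimes R E).Finite := by
  refine ((associatedPrimes.finite S E).image (Ideal.comap (algebraMap R S))).subset fun p hp ↦ ?_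
  obtain ⟨hp, z, hz⟩ := mem_associatedPrimes_iff.1 hp
  have hcomap : ((⊥ : Submodule S E).colon {z}).comap (algebraMap R S) = p := by
    ext r
    rw [Ideal.mem_comap, Submodule.mem_colon_singleton, algebraMap_smul, Submodule.mem_bot, hz]
  obtain ⟨P, hP, hPp⟩ := Ideal.exists_minimalPrimes_comap_eq (algebraMap R S)
    (I := (⊥ : Submodule S E).colon {z}) p (by
      rw [hcomap, Ideal.minimalPrimes_eq_subsingleton_self]
      rfl)
  refine ⟨P, ?_, hPp⟩
  rw [AssociatedPrimes.mem_iff, isAssociatedPrime_iff]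
  exact ⟨hP.1.1, Submodule.exists_eq_colon_of_mem_minimalPrimes hP⟩

lemma exists_forall_smul_eq_smul {V : Submodule R S} (hV : Algebra.adjoin R (V : Set S) = ⊤)
    (s : S) : ∃ r : R, ∀ z : E, (∀ v ∈ V, v • z = 0) → s • z = r • z := by
  have hs : s ∈ Algebra.adjoin R (V : Set S) := hV ▸ Algebra.mem_top
  induction hs using Algebra.adjoin_induction with
  | mem x hx => exact ⟨0, fun z hz ↦ by rw [hz x hx, zero_smul]⟩
  | algebraMap r => exact ⟨r, fun z _ ↦ algebraMap_smul S r z⟩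
  | add x y _ _ hx hy =>
    obtain ⟨a, ha⟩ := hx
    obtain ⟨b, hb⟩ := hy
    exact ⟨a + b, fun z hz ↦ by rw [add_smul, add_smul, ha z hz, hb z hz]⟩
  | mul x y _ _ hx hy =>
    obtain ⟨a, ha⟩ := hx
    obtain ⟨b, hb⟩ := hy
    refine ⟨b * a, fun z hz ↦ ?_⟩
    rw [mul_smul, hb z hz, smul_comm x b z, ha z hz, mul_smul]

variable {F : ℕ → Type} [∀ n, AddCommGroup (F n)] [∀ n, Module R (F n)]

lemma exists_forall_ge_eq_zero [IsNoetherianRing S] [Module.Finite S E] {V : Submodule R S}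
    (hV : Algebra.adjoin R (V : Set S) = ⊤) (ι : ∀ n, F n →ₗ[R] E) (π : ∀ n, E →ₗ[R] F n)
    (hπι : ∀ n z, π n (ι n z) = z) (hπ : ∀ e, ∃ n₀, ∀ n ≥ n₀, π n e = 0) :
    ∃ n₀, ∀ n ≥ n₀, ∀ z, (∀ v ∈ V, v • ι n z = 0) → z = 0 := by
  let K : Submodule S E :=
    { carrier := {z | ∀ v ∈ V, v • z = 0}
      add_mem' := fun ha hb v hv ↦ by rw [smul_add, ha v hv, hb v hv, add_zero]
      zero_mem' := fun v _ ↦ smul_zero v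
      smul_mem' := fun s z hz v hv ↦ by rw [smul_comm, hz v hv, smul_zero] }
  obtain ⟨G, hG⟩ := IsNoetherian.noetherian K
  choose N hN using hπ
  refine ⟨G.sup N, fun n hn z hz ↦ ?_⟩
  have key (x : E) (hx : x ∈ Submodule.span S (G : Set E)) : π n x = 0 := by
    induction hx using Submodule.span_induction with
    | mem x hx => exact hN x n ((Finset.le_sup hx).trans hn)
    | zero => exact map_zero _
    | add x y _ _ hx hy => rw [map_add, hx, hy, add_zero]
    | smul s x hx hx' =>
      obtain ⟨r, hr⟩ := exists_forall_smul_eq_smul (E := E) hV s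
      rw [hG] at hx
      rw [hr x hx, map_smul, hx', smul_zero]
  rw [← hπι n z]
  exact key _ (hG ▸ hz)

variable [IsNoetherianRing R]

lemma mem_associatedPrimes_succ {V : Submodule R S} [Module.Finite R V] {n : ℕ}
    {ι : ∀ n, F n →ₗ[R] E} (hι : ∀ n, Function.Injective (ι n))
    (hιV : ∀ s ∈ V, ∀ n z, ∃ w, s • ι n z = ι (n + 1) w)
    (hn : ∀ z, (∀ v ∈ V, v • ι n z = 0) → z = 0) {p : Ideal R}
    (hp : p ∈ associatedPrimes R (F n)) : p ∈ associatedPrimes R (F (n + 1)) := by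
  obtain ⟨hprime, z, hz⟩ := mem_associatedPrimes_iff.1 hp
  obtain ⟨s, hs, hs'⟩ : ∃ s ∈ V, ∀ r ∉ p, r • s • ι n z ≠ 0 := by
    by_contra! h
    let f : V →ₗ[R] E := (LinearMap.toSpanSingleton S E (ι n z)).restrictScalars R ∘ₗ V.subtype
    have hvan : VanishesAt p (LinearMap.range f) := by
      rintro ⟨_, s, rfl⟩
      obtain ⟨r, hr, hr'⟩ := h s.1 s.2
      exact ⟨r, hr, Subtype.ext hr'⟩
    obtain ⟨r, hr, hr'⟩ := hvan.exists_smul_eq_zero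
    refine hr ((hz r).2 (hn _ fun v hv ↦ ?_))
    rw [map_smul, smul_comm]
    exact congrArg Subtype.val (hr' ⟨_, ⟨v, hv⟩, rfl⟩)
  obtain ⟨w, hw⟩ := hιV s hs n z
  refine mem_associatedPrimes_iff.2 ⟨hprime, w, fun r ↦ ⟨fun hr ↦ hι _ ?_, fun hr ↦ ?_⟩⟩
  · rw [map_smul, ← hw, smul_comm, ← map_smul, (hz r).1 hr, map_zero, map_zero, smul_zero]
  · by_contra hr'
    exact hs' r hr' (by rw [hw, ← map_smul, hr, map_zero])

theorem exists_associatedPrimes_eq_of_graded [IsNoetherianRing S] [Module.Finite S E]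
    {V : Submodule R S} [Module.Finite R V] (hV : Algebra.adjoin R (V : Set S) = ⊤)
    (ι : ∀ n, F n →ₗ[R] E) (π : ∀ n, E →ₗ[R] F n)
    (hπι : ∀ n z, π n (ι n z) = z) (hπ : ∀ e, ∃ n₀, ∀ n ≥ n₀, π n e = 0)
    (hιV : ∀ s ∈ V, ∀ n z, ∃ w, s • ι n z = ι (n + 1) w) :
    ∃ (n₀ : ℕ) (T : Set (Ideal R)), T.Finite ∧ ∀ n ≥ n₀, associatedPrimes R (F n) = T := by
  have hι (n : ℕ) : Function.Injective (ι n) := Function.LeftInverse.injective (hπι n)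
  obtain ⟨n₁, hn₁⟩ := exists_forall_ge_eq_zero hV ι π hπι hπ
  have hmono {p : Ideal R} {m n : ℕ} (hm : n₁ ≤ m) (hmn : m ≤ n)
      (hp : p ∈ associatedPrimes R (F m)) : p ∈ associatedPrimes R (F n) := by
    induction n, hmn using Nat.le_induction with
    | base => exact hp
    | succ n hmn ih => exact mem_associatedPrimes_succ hι hιV (hn₁ n (hm.trans hmn)) ih
  have hfin : (associatedPrimes R E).Finite := finite_associatedPrimes_of_isScalarTower (S := S)
  have hsub (n : ℕ) : associatedPrimes R (F n) ⊆ associatedPrimes R E :=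
    associatedPrimes.subset_of_injective (hι n)
  let T : Set (Ideal R) := {p | ∃ m ≥ n₁, p ∈ associatedPrimes R (F m)}
  have hT : T ⊆ associatedPrimes R E := fun p ⟨m, _, hm⟩ ↦ hsub m hm
  have hev : ∀ p ∈ associatedPrimes R E, ∀ᶠ n in Filter.atTop,
      (p ∈ associatedPrimes R (F n) ↔ p ∈ T) := by
    intro p _
    by_cases hp : p ∈ T
    · obtain ⟨m, hm, hpm⟩ := hp
      filter_upwards [Filter.eventually_ge_atTop m] with n hn
      exact ⟨fun h ↦ ⟨n, hm.trans hn, h⟩, fun _ ↦ hmono hm hn hpm⟩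
    · filter_upwards [Filter.eventually_ge_atTop n₁] with n hn
      exact ⟨fun h ↦ ⟨n, hn, h⟩, fun h ↦ (hp h).elim⟩
  obtain ⟨n₀, hn₀⟩ := Filter.eventually_atTop.1 ((Filter.eventually_all_finite hfin).2 hev)
  exact ⟨n₀, T, hfin.subset hT, fun n hn ↦ Set.ext fun p ↦
    ⟨fun h ↦ (hn₀ n hn p (hsub n h)).1 h, fun h ↦ (hn₀ n hn p (hT h)).2 h⟩⟩

end

section
variable {R : Type} [CommRing R] {S : Type} [CommRing S] [Algebra R S] {𝒜 : ℕ → Submodule R S}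
  [GradedAlgebra 𝒜] {M : Type} [AddCommGroup M] [Module R M] [Module S M] [IsScalarTower R S M]
  {ℳ : ℕ → Submodule R M} [SetLike.GradedSMul 𝒜 ℳ] [DirectSum.Decomposition ℳ]

lemma mem_of_mem_span_of_graded (h0 : 𝒜 0 = Subalgebra.toSubmodule (⊥ : Subalgebra R S)) {n : ℕ}
    {P : Submodule R M} (hP : P ≤ ℳ n) {x : M} (hx : x ∈ Submodule.span S (P : Set M)) :
    (DirectSum.decompose ℳ x n : M) ∈ P := by
  induction hx using Submodule.closure_induction with
  | zero => simp
  | add x y _ _ hx hy =>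
    rw [DirectSum.decompose_add, DirectSum.add_apply]
    exact add_mem hx hy
  | smul_mem s x hx =>
    induction s using DirectSum.Decomposition.inductionOn 𝒜 with
    | zero => simp
    | add a b ha hb =>
      rw [add_smul, DirectSum.decompose_add, DirectSum.add_apply]
      exact add_mem ha hb
    | @homogeneous i a =>
      have hax : (a : S) • x ∈ ℳ (i + n) := SetLike.GradedSMul.smul_mem a.2 (hP hx)
      by_cases hi : i = 0
      · subst hi
        obtain ⟨r, hr⟩ := Algebra.mem_bot.1 (h0.le a.2 : (a : S) ∈ (⊥ : Subalgebra R S))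
        rw [← hr, algebraMap_smul, DirectSum.decompose_of_mem_same ℳ ((ℳ n).smul_mem r (hP hx))]
        exact P.smul_mem r hx
      · rw [DirectSum.decompose_of_mem_ne ℳ hax (by omega)]
        exact zero_mem P

lemma isNoetherian_of_graded (h0 : 𝒜 0 = Subalgebra.toSubmodule (⊥ : Subalgebra R S))
    [IsNoetherian S M] (n : ℕ) : IsNoetherian R (ℳ n) := by
  rw [isNoetherian_iff]
  let f (P : Submodule R (ℳ n)) : Submodule S M :=
    Submodule.span S (P.map (ℳ n).subtype : Set M)
  have hf : StrictMono f := by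
    refine Monotone.strictMono_of_injective
      (fun P Q h ↦ Submodule.span_mono (Submodule.map_mono h)) fun P Q h ↦ ?_
    have key {P Q : Submodule R (ℳ n)} (h : f P ≤ f Q) : P ≤ Q := by
      intro x hx
      have := mem_of_mem_span_of_graded h0 (Submodule.map_subtype_le (ℳ n) Q)
        (h (Submodule.subset_span ⟨x, hx, rfl⟩))
      rw [Submodule.coe_subtype, DirectSum.decompose_of_mem_same ℳ x.2] at this
      obtain ⟨y, hy, hyx⟩ := this
      rwa [← Subtype.ext hyx]
    exact le_antisymm (key h.le) (key h.ge)
  exact hf.wellFoundedGT.wf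
end

lemma finite_linearMap {R : Type} [CommRing R] {S : Type} [CommRing S] [Algebra R S]
    [IsNoetherianRing S] (A M : Type) [AddCommGroup A] [Module R A] [Module.Finite R A]
    [AddCommGroup M] [Module R M] [Module S M] [IsScalarTower R S M] [Module.Finite S M] :
    Module.Finite S (A →ₗ[R] M) := by
  obtain ⟨a, s, hs⟩ := Module.Finite.exists_fin (R := R) (M := A)
  let ev : (A →ₗ[R] M) →ₗ[S] (Fin a → M) :=
    { toFun := fun f i ↦ f (s i)
      map_add' := fun _ _ ↦ rfl
      map_smul' := fun _ _ ↦ rfl }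
  refine Module.Finite.of_injective ev fun f g h ↦ LinearMap.ext_on_range hs fun i ↦ ?_
  exact congrFun h i

section
variable {R : Type} [CommRing R] [IsNoetherianRing R] {S : Type} [CommRing S] [Algebra R S]
  [Algebra.FiniteType R S] {𝒜 : ℕ → Submodule R S} [GradedAlgebra 𝒜]
  {M : Type} [AddCommGroup M] [Module R M] [Module S M] [IsScalarTower R S M]
  {ℳ : ℕ → Submodule R M} [SetLike.GradedSMul 𝒜 ℳ] [DirectSum.Decomposition ℳ] [Module.Finite S M]

theorem exists_associatedPrimes_coker_eq (hstd : Algebra.adjoin R (𝒜 1 : Set S) = ⊤)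
    (h0 : 𝒜 0 = Subalgebra.toSubmodule (⊥ : Subalgebra R S))
    {A B : Type} [AddCommGroup A] [Module R A] [AddCommGroup B] [Module R B] [Module.Finite R A]
    (φ : A →ₗ[R] B) :
    ∃ (n₀ : ℕ) (T : Set (Ideal R)), T.Finite ∧ ∀ n ≥ n₀, associatedPrimes R
      ((A →ₗ[R] ℳ n) ⧸ LinearMap.range (LinearMap.lcomp R (ℳ n) φ)) = T := by
  have : IsNoetherianRing S := Algebra.FiniteType.isNoetherianRing R S
  have : IsNoetherian R (𝒜 1) := isNoetherian_of_graded h0 1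
  have := finite_linearMap (R := R) (S := S) A M
  let Q : Submodule S (A →ₗ[R] M) := LinearMap.range (LinearMap.lcomp S M φ)
  let e := Submodule.Quotient.restrictScalarsEquiv R Q
  let pr (n : ℕ) : M →ₗ[R] ℳ n :=
    DirectSum.component R ℕ (fun i ↦ ℳ i) n ∘ₗ (DirectSum.decomposeLinearEquiv ℳ).toLinearMap
  have hpr (n : ℕ) (x : ℳ n) : pr n x = x := by
    change DirectSum.decompose ℳ (x : M) n = x
    rw [DirectSum.decompose_coe, DirectSum.of_eq_same]
  have hpr' (x : M) : ∃ n₀, ∀ n ≥ n₀, pr n x = 0 := by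
    classical
    refine ⟨(DirectSum.decompose ℳ x).support.sup id + 1, fun n hn ↦ ?_⟩
    by_contra h
    have : n ≤ (DirectSum.decompose ℳ x).support.sup id :=
      Finset.le_sup (f := id) (DFinsupp.mem_support_iff.2 h)
    omega
  let ι (n : ℕ) : ((A →ₗ[R] ℳ n) ⧸ LinearMap.range (LinearMap.lcomp R (ℳ n) φ)) →ₗ[R]
      ((A →ₗ[R] M) ⧸ Q) :=
    e.toLinearMap ∘ₗ Submodule.mapQ _ (Q.restrictScalars R) (LinearMap.compRight R (ℳ n).subtype)
      (by
        rintro _ ⟨g, rfl⟩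
        exact ⟨(ℳ n).subtype ∘ₗ g, rfl⟩)
  let π (n : ℕ) : ((A →ₗ[R] M) ⧸ Q) →ₗ[R]
      ((A →ₗ[R] ℳ n) ⧸ LinearMap.range (LinearMap.lcomp R (ℳ n) φ)) :=
    Submodule.mapQ (Q.restrictScalars R) _ (LinearMap.compRight R (pr n))
      (by
        rintro _ ⟨g, rfl⟩
        exact ⟨pr n ∘ₗ g, rfl⟩) ∘ₗ e.symm.toLinearMap
  refine exists_associatedPrimes_eq_of_graded (E := (A →ₗ[R] M) ⧸ Q)
    (F := fun n ↦ (A →ₗ[R] ℳ n) ⧸ LinearMap.range (LinearMap.lcomp R (ℳ n) φ)) hstd ι π ?_ ?_ ?_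
  · intro n z
    obtain ⟨g, rfl⟩ := Submodule.Quotient.mk_surjective _ z
    have : pr n ∘ₗ (ℳ n).subtype ∘ₗ g = g := by
      ext a
      exact congrArg Subtype.val (hpr n (g a))
    exact congrArg Submodule.Quotient.mk this
  · intro z
    obtain ⟨g, rfl⟩ := Submodule.Quotient.mk_surjective _ z
    obtain ⟨a, s, hs⟩ := Module.Finite.exists_fin (R := R) (M := A)
    choose N hN using fun i ↦ hpr' (g (s i))
    refine ⟨Finset.univ.sup N, fun n hn ↦ ?_⟩
    have : pr n ∘ₗ g = 0 := LinearMap.ext_on_range hs fun i ↦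
      hN i n ((Finset.le_sup (Finset.mem_univ i)).trans hn)
    exact congrArg Submodule.Quotient.mk this
  · intro s hs n z
    obtain ⟨g, rfl⟩ := Submodule.Quotient.mk_surjective _ z
    have hmem (x : ℳ n) : s • (x : M) ∈ ℳ (n + 1) :=
      add_comm 1 n ▸ (SetLike.GradedSMul.smul_mem hs x.2 : s • (x : M) ∈ ℳ (1 + n))
    let m : ℳ n →ₗ[R] ℳ (n + 1) :=
      { toFun := fun x ↦ ⟨s • (x : M), hmem x⟩
        map_add' := fun x y ↦ Subtype.ext (smul_add s _ _)
        map_smul' := fun r x ↦ Subtype.ext (smul_comm s r _) }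
    exact ⟨Submodule.Quotient.mk (m ∘ₗ g), rfl⟩

theorem exists_associatedPrimes_modExt_eq (hstd : Algebra.adjoin R (𝒜 1 : Set S) = ⊤)
    (h0 : 𝒜 0 = Subalgebra.toSubmodule (⊥ : Subalgebra R S)) (X : Type) [AddCommGroup X]
    [Module R X] [Module.Finite R X] (j : ℕ) :
    ∃ (n₀ : ℕ) (T : Set (Ideal R)), T.Finite ∧
      ∀ n ≥ n₀, associatedPrimes R (ModExt R X (ℳ n) j) = T := by
  obtain ⟨A, B, _, _, _, _, _, φ, h⟩ := ModExt.exists_equiv_coker (R := R) j X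
  obtain ⟨n₀, T, hT, hn₀⟩ := exists_associatedPrimes_coker_eq (ℳ := ℳ) hstd h0 φ
  refine ⟨n₀, T, hT, fun n hn ↦ ?_⟩
  obtain ⟨e⟩ := h (ℳ n)
  rw [LinearEquiv.AssociatedPrimes.eq e, hn₀ n hn]

end

/-- Corollary: with `r₁` the eventual value of the generalized depth `depth₁(I, N_n)`, for each
`l ≤ r₁` the set `⋃_{j≤l} Ass_R(H^j_I(N_n)) ∪ {m}` is finite and stable for large `n`. -/
theorem ass_localCohomology_graded_stable_gdepth (R : Type) [CommRing R] [IsNoetherianRing R]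
    [IsLocalRing R] (I : Ideal R)
    (S : Type) [CommRing S] [Algebra R S] [Algebra.FiniteType R S]
    (𝒜 : ℕ → Submodule R S) [GradedAlgebra 𝒜]
    (hstd : Algebra.adjoin R (𝒜 1 : Set S) = ⊤)
    (h0 : 𝒜 0 = Subalgebra.toSubmodule (⊥ : Subalgebra R S))
    (M : Type) [AddCommGroup M] [Module R M] [Module S M] [IsScalarTower R S M]
    (ℳ : ℕ → Submodule R M) [SetLike.GradedSMul 𝒜 ℳ] [DirectSum.Decomposition ℳ]
    [Module.Finite S M]
    (r₁ : ℕ∞) (hev : ∃ n₀ : ℕ, ∀ n ≥ n₀, depthK R 1 I (ℳ n) = r₁)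
    (l : ℕ) (hl : (l : ℕ∞) ≤ r₁) :
    ∃ (n₁ : ℕ) (T : Set (Ideal R)), T.Finite ∧ ∀ n ≥ n₁,
      ((⋃ j ≤ l, associatedPrimes R
          ((localCohomology I j).obj (ModuleCat.of R (ℳ n)))) ∪ {maximalIdeal R}) = T := by
  have : IsNoetherianRing S := Algebra.FiniteType.isNoetherianRing R S
  obtain ⟨n₀, hn₀⟩ := hev
  choose N T hT hN using
    exists_associatedPrimes_modExt_eq (R := R) (ℳ := ℳ) hstd h0 (R ⧸ I ^ 1)
  refine ⟨max n₀ ((Finset.range (l + 1)).sup N), (⋃ j ≤ l, T j) ∪ {maximalIdeal R},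
    ((Set.finite_le_nat l).biUnion fun j _ ↦ hT j).union (Set.finite_singleton _), fun n hn ↦ ?_⟩
  have := isNoetherian_of_graded (M := M) (ℳ := ℳ) h0 n
  have hNn {j : ℕ} (hj : j ≤ l) : associatedPrimes R (ModExt R (R ⧸ I ^ 1) (ℳ n) j) = T j :=
    hN j n ((Finset.le_sup (Finset.mem_range.2 (Nat.lt_succ_of_le hj))).trans
      ((le_max_right _ _).trans hn))
  have hln : (l : ℕ∞) ≤ depthK R 1 I (ℳ n) := hn₀ n ((le_max_left _ _).trans hn) ▸ hl
  ext p
  simp only [Set.mem_union, Set.mem_iUnion, Set.mem_singleton_iff, exists_prop]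
  by_cases hpm : p = maximalIdeal R
  · simp [hpm]
  simp only [hpm, or_false]
  constructor
  · rintro ⟨j, hj, hp⟩
    have := hp.isPrime
    obtain ⟨i, hi, hi'⟩ :=
      (localCohomology.exists_mem_associatedPrimes_iff hpm hln).1 ⟨j, hj, hp⟩
    exact ⟨i, hi, hNn hi ▸ hi'⟩
  · rintro ⟨j, hj, hp⟩
    rw [← hNn hj] at hp
    have := hp.isPrime
    exact (localCohomology.exists_mem_associatedPrimes_iff hpm hln).2 ⟨j, hj, hp⟩
end

section
/- Let R be a Noetherian local ring, M a finitely generated R-module, 𝔑 = ⊕_{n≥0} N_n a finitely generated graded module over a finitely generated standard graded R-algebra with degree-0 part R, k ≥ -1 an integer, and r the eventual value of depth_k(ann(M), N_n). Then for every l ≤ r, the set ⋃_{j≤l} {p ∈ Ass_R(Ext^j_R(M, N_n)) : dim(R/p) ≥ k} is stable (independent of n) for all sufficiently large n. -/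
open CategoryTheory Opposite IsLocalRing

/-- Over a Noetherian algebra `S`, every prime of `R` associated to an `S`-module is the
contraction of an associated prime over `S`. -/
theorem exists_associatedPrimes_comap_eq {R S E : Type*} [CommRing R] [IsNoetherianRing R]
    [CommRing S] [IsNoetherianRing S] [Algebra R S] [AddCommGroup E] [Module R E] [Module S E]
    [IsScalarTower R S E] {p : Ideal R} (hp : p ∈ associatedPrimes R E) :
    ∃ q ∈ associatedPrimes S E, q.comap (algebraMap R S) = p := by
  obtain ⟨hprime, e, he⟩ := isAssociatedPrime_iff.1 hp
  have hcomap : ((⊥ : Submodule S E).colon {e}).comap (algebraMap R S) = p := by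
    rw [he]
    ext a
    simp [Submodule.mem_colon_singleton]
  obtain ⟨q, hq, hqp⟩ := Ideal.exists_minimalPrimes_comap_eq
    (I := (⊥ : Submodule S E).colon {e}) (algebraMap R S) p (by
      rw [hcomap, Ideal.minimalPrimes_eq_subsingleton_self]
      exact Set.mem_singleton p)
  obtain ⟨y, hy⟩ := Submodule.exists_eq_colon_of_mem_minimalPrimes hq
  exact ⟨q, isAssociatedPrime_iff.2 ⟨hq.1.1, y, hy⟩, hqp⟩

/-- A finitely generated module over a Noetherian `R`-algebra has finitely many associated
primes over `R`. -/
theorem associatedPrimes_finite_of_algebra (R S E : Type*) [CommRing R] [IsNoetherianRing R]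
    [CommRing S] [IsNoetherianRing S] [Algebra R S] [AddCommGroup E] [Module R E] [Module S E]
    [IsScalarTower R S E] [Module.Finite S E] : (associatedPrimes R E).Finite :=
  ((associatedPrimes.finite S E).image (Ideal.comap (algebraMap R S))).subset fun _ hp =>
    exists_associatedPrimes_comap_eq hp

/-- If finitely many linear maps out of `E` are jointly injective, each associated prime of `E`
is an associated prime of their common target. -/
theorem associatedPrimes_subset_of_jointly_injective {R E F ι : Type*} [CommRing R]
    [IsNoetherianRing R] [AddCommGroup E] [Module R E] [AddCommGroup F] [Module R F]
    (X : Finset ι) (f : ι → E →ₗ[R] F) (hf : ∀ e, (∀ i ∈ X, f i e = 0) → e = 0) :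
    associatedPrimes R E ⊆ associatedPrimes R F := by
  intro p hp
  obtain ⟨hprime, e, he⟩ := isAssociatedPrime_iff.1 hp
  obtain ⟨i, -, hle⟩ := (hprime.inf_le' (s := X)
    (f := fun i => (⊥ : Submodule R F).colon {f i e})).1 (by
      intro a ha
      rw [he, Submodule.mem_colon_singleton, Submodule.mem_bot]
      refine hf _ fun i hi => ?_
      have := (Submodule.mem_finsetInf.1 ha) i hi
      rwa [Submodule.mem_colon_singleton, Submodule.mem_bot, ← map_smul] at this)
  refine isAssociatedPrime_iff.2 ⟨hprime, f i e, le_antisymm (fun a ha => ?_) hle⟩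
  rw [he, Submodule.mem_colon_singleton, Submodule.mem_bot] at ha
  rw [Submodule.mem_colon_singleton, Submodule.mem_bot, ← map_smul, ha, map_zero]

theorem exists_eq_of_eventually_subset_succ {α : Type*} (A : ℕ → Set α) (B : Set α)
    (hB : B.Finite) (hAB : ∀ n, A n ⊆ B) (n₀ : ℕ) (hmono : ∀ n ≥ n₀, A n ⊆ A (n + 1)) :
    ∃ (n₁ : ℕ) (T : Set α), ∀ n ≥ n₁, A n = T := by
  have hm : Monotone fun n => A (n₀ + n) :=
    monotone_nat_of_le_succ fun n => hmono (n₀ + n) (Nat.le_add_right _ _)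
  have hfin : (⋃ n, A (n₀ + n)).Finite := hB.subset (Set.iUnion_subset fun n => hAB _)
  obtain ⟨n₁, hn₁⟩ : ∃ n₁, (⋃ n, A (n₀ + n)) ⊆ A (n₀ + n₁) := by
    simpa using Directed.exists_mem_subset_of_finset_subset_biUnion
      (f := fun n => A (n₀ + n)) hm.directed_le (s := hfin.toFinset) (by simp)
  refine ⟨n₀ + n₁, A (n₀ + n₁), fun n hn => ?_⟩
  obtain ⟨m, rfl⟩ := Nat.exists_eq_add_of_le hn
  refine Set.Subset.antisymm ?_ ?_
  · rw [add_assoc]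
    exact (Set.subset_iUnion (fun n => A (n₀ + n)) (n₁ + m)).trans hn₁
  · rw [add_assoc]
    exact hm (Nat.le_add_right n₁ m)

/-- Let `E n` be `R`-linear direct summands of a finitely generated `S`-module `E`, such that the
projections to `E n` of each element of `E` are eventually zero, and such that a finite set `X`
generating `S` modulo `R` moves `E n` into `E (n + 1)`. Then `Ass (E n)` is eventually constant. -/
theorem associatedPrimes_eventually_constant {R S E : Type*} [CommRing R] [IsNoetherianRing R]
    [CommRing S] [IsNoetherianRing S] [Algebra R S] [AddCommGroup E] [Module R E] [Module S E]
    [IsScalarTower R S E] [Module.Finite S E]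
    (X : Finset S) (hX : ∀ s : S, ∃ a : R, s - algebraMap R S a ∈ Ideal.span (X : Set S))
    (En : ℕ → Type*) [∀ n, AddCommGroup (En n)] [∀ n, Module R (En n)]
    (ι : ∀ n, En n →ₗ[R] E) (π : ∀ n, E →ₗ[R] En n) (hπι : ∀ n e, π n (ι n e) = e)
    (hπ : ∀ e, ∃ n₀, ∀ n ≥ n₀, π n e = 0)
    (μ : ∀ n, X → En n →ₗ[R] En (n + 1))
    (hμ : ∀ n (x : X) e, ι (n + 1) (μ n x e) = (x : S) • ι n e) :
    ∃ (n₁ : ℕ) (T : Set (Ideal R)), ∀ n ≥ n₁, associatedPrimes R (En n) = T := by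
  let K : Submodule S E := ⨅ x ∈ X, LinearMap.ker (LinearMap.lsmul S E x)
  have hK : ∀ e, e ∈ K ↔ ∀ x ∈ X, x • e = 0 := fun e => by simp [K, Submodule.mem_iInf]
  have hKspan : ∀ e ∈ K, ∀ s ∈ Ideal.span (X : Set S), s • e = 0 := by
    intro e he s hs
    have : Ideal.span (X : Set S) ≤ LinearMap.ker (LinearMap.toSpanSingleton S E e) :=
      Ideal.span_le.2 fun x hx => by simpa using (hK e).1 he x hx
    simpa using this hs
  obtain ⟨G, hG⟩ : K.FG := IsNoetherian.noetherian K
  choose N hN using hπ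
  have hvanish : ∀ n ≥ G.sup N, ∀ e ∈ K, π n e = 0 := by
    intro n hn e he
    suffices e ∈ K ∧ π n e = 0 from this.2
    rw [← hG] at he
    induction he using Submodule.span_induction with
    | mem x hx =>
      exact ⟨hG ▸ Submodule.subset_span hx, hN x n ((Finset.le_sup (f := N) hx).trans hn)⟩
    | zero => exact ⟨K.zero_mem, map_zero _⟩
    | add x y _ _ hx hy =>
      exact ⟨K.add_mem hx.1 hy.1, by rw [map_add, hx.2, hy.2, add_zero]⟩
    | smul s x _ hx =>
      refine ⟨K.smul_mem s hx.1, ?_⟩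
      obtain ⟨a, ha⟩ := hX s
      have h := hKspan x hx.1 _ ha
      rw [sub_smul, sub_eq_zero, algebraMap_smul] at h
      rw [h, map_smul, hx.2, smul_zero]
  refine exists_eq_of_eventually_subset_succ _ (associatedPrimes R E)
    (associatedPrimes_finite_of_algebra R S E) (fun n => ?_) (G.sup N) (fun n hn => ?_)
  · exact associatedPrimes.subset_of_injective
      (Function.LeftInverse.injective (g := π n) (hπι n))
  · refine associatedPrimes_subset_of_jointly_injective X.attach (μ n) fun e he => ?_
    rw [← hπι n e]
    refine hvanish n hn _ ((hK _).2 fun x hx => ?_)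
    rw [← hμ n ⟨x, hx⟩, he _ (Finset.mem_attach _ _), map_zero]

/-- The cohomology at `Hom_R(B, N)` of the complex `Hom_R(C, N) → Hom_R(B, N) → Hom_R(A, N)` induced
by `a : A → B` and `b : B → C`, as a module over an `R`-algebra `T` acting on `N`. -/
abbrev HomCohomology {R A B C : Type*} [CommRing R] [AddCommGroup A] [AddCommGroup B]
    [AddCommGroup C] [Module R A] [Module R B] [Module R C] (a : A →ₗ[R] B) (b : B →ₗ[R] C)
    (T N : Type*) [CommRing T] [Algebra R T] [AddCommGroup N] [Module R N] [Module T N]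
    [IsScalarTower R T N] : Type _ :=
  LinearMap.ker (LinearMap.lcomp T N a) ⧸
    (LinearMap.range (LinearMap.lcomp T N b)).submoduleOf (LinearMap.ker (LinearMap.lcomp T N a))

namespace HomCohomology

variable {R A B C : Type*} [CommRing R] [AddCommGroup A] [AddCommGroup B]
    [AddCommGroup C] [Module R A] [Module R B] [Module R C] (a : A →ₗ[R] B) (b : B →ₗ[R] C)
    {T N T' N' : Type*} [CommRing T] [Algebra R T] [AddCommGroup N] [Module R N] [Module T N]
    [IsScalarTower R T N] [CommRing T'] [Algebra R T'] [AddCommGroup N'] [Module R N']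
    [Module T' N'] [IsScalarTower R T' N']

/-- The class of a cocycle. -/
def mk (φ : B →ₗ[R] N) (hφ : φ ∘ₗ a = 0) : HomCohomology a b T N :=
  Submodule.Quotient.mk ⟨φ, hφ⟩

variable {a b}

theorem exists_eq_mk (e : HomCohomology a b T N) : ∃ φ hφ, e = mk a b φ hφ := by
  obtain ⟨⟨φ, hφ⟩, rfl⟩ := Submodule.Quotient.mk_surjective _ e
  exact ⟨φ, hφ, rfl⟩

variable (a b T T')

/-- Functoriality of `HomCohomology` in the coefficient module. -/
def map (f : N →ₗ[R] N') : HomCohomology a b T N →ₗ[R] HomCohomology a b T' N' where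
  toFun := Quotient.map' (fun φ => ⟨f ∘ₗ φ.1, by
      have h : φ.1 ∘ₗ a = 0 := φ.2
      change (f ∘ₗ φ.1) ∘ₗ a = 0
      rw [LinearMap.comp_assoc, h, LinearMap.comp_zero]⟩) (by
    intro φ ψ h
    rw [Submodule.quotientRel_def] at h ⊢
    obtain ⟨χ, hχ⟩ := h
    refine ⟨f ∘ₗ χ, ?_⟩
    have hχ' : χ ∘ₗ b = φ.1 - ψ.1 := hχ
    change (f ∘ₗ χ) ∘ₗ b = f ∘ₗ φ.1 - f ∘ₗ ψ.1
    rw [LinearMap.comp_assoc, hχ', LinearMap.comp_sub])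
  map_add' := by
    rintro ⟨φ⟩ ⟨ψ⟩
    exact congrArg Submodule.Quotient.mk (Subtype.ext (LinearMap.comp_add _ _ f))
  map_smul' := by
    rintro r ⟨φ⟩
    exact congrArg Submodule.Quotient.mk (Subtype.ext (LinearMap.comp_smul f r φ.1))

variable {a b T T'}

theorem map_mk (f : N →ₗ[R] N') (φ : B →ₗ[R] N) (hφ : φ ∘ₗ a = 0) :
    map a b T T' f (mk a b φ hφ) = mk a b (f ∘ₗ φ) (by
      rw [LinearMap.comp_assoc, hφ, LinearMap.comp_zero]) := rfl

theorem mk_congr {φ ψ : B →ₗ[R] N} (h : φ = ψ) (hφ : φ ∘ₗ a = 0) :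
    (mk a b φ hφ : HomCohomology a b T N) = mk a b ψ (h ▸ hφ) := by
  subst h
  rfl

theorem mk_zero (h : (0 : B →ₗ[R] N) ∘ₗ a = 0) : (mk a b 0 h : HomCohomology a b T N) = 0 := rfl

instance [IsNoetherianRing T] [Module.Finite R B] [Module.Finite T N] :
    Module.Finite T (HomCohomology a b T N) := by
  obtain ⟨G, hG⟩ := Module.Finite.fg_top (R := R) (M := B)
  let ev : (B →ₗ[R] N) →ₗ[T] G → N := LinearMap.pi fun g => LinearMap.applyₗ' T g.1
  have hev : Function.Injective ev := fun φ ψ h =>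
    LinearMap.ext_on hG fun g hg => congrFun h ⟨g, hg⟩
  have : IsNoetherian T (B →ₗ[R] N) := isNoetherian_of_injective ev hev
  infer_instance

end HomCohomology

/-- Eventual constancy of the associated primes of the cohomology of `Hom_R(-, ℳ n)` for the
graded components `ℳ n` of a finitely generated graded module over a standard graded algebra. -/
theorem associatedPrimes_homCohomology_eventually_constant {R A B C : Type*} [CommRing R]
    [IsNoetherianRing R] [AddCommGroup A] [AddCommGroup B] [AddCommGroup C] [Module R A]
    [Module R B] [Module R C] [Module.Finite R B] (a : A →ₗ[R] B) (b : B →ₗ[R] C)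
    {S : Type*} [CommRing S] [Algebra R S] [Algebra.FiniteType R S]
    (𝒜 : ℕ → Submodule R S) (hstd : Algebra.adjoin R (𝒜 1 : Set S) = ⊤)
    {M : Type*} [AddCommGroup M] [Module R M] [Module S M] [IsScalarTower R S M]
    (ℳ : ℕ → Submodule R M) [SetLike.GradedSMul 𝒜 ℳ] [DirectSum.Decomposition ℳ]
    [Module.Finite S M] :
    ∃ (n₁ : ℕ) (T : Set (Ideal R)), ∀ n ≥ n₁,
      associatedPrimes R (HomCohomology a b R (ℳ n)) = T := by
  have : IsNoetherianRing S := Algebra.FiniteType.isNoetherianRing R S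
  obtain ⟨X, hXsub, hXspan⟩ := (Submodule.fg_span_iff_fg_span_finset_subset (R := S)
    (𝒜 1 : Set S)).1 (IsNoetherian.noetherian _)
  have hX : ∀ s : S, ∃ r : R, s - algebraMap R S r ∈ Ideal.span (X : Set S) := by
    intro s
    change ∃ r : R, s - algebraMap R S r ∈ Submodule.span S (X : Set S)
    rw [← hXspan]
    have hs : s ∈ Algebra.adjoin R (𝒜 1 : Set S) := hstd ▸ Algebra.mem_top
    induction hs using Algebra.adjoin_induction with
    | mem x hx => exact ⟨0, by simpa using Submodule.subset_span hx⟩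
    | algebraMap r => exact ⟨r, by simp⟩
    | add x y _ _ hx hy =>
      obtain ⟨r, hr⟩ := hx
      obtain ⟨t, ht⟩ := hy
      refine ⟨r + t, ?_⟩
      rw [map_add, add_sub_add_comm]
      exact add_mem hr ht
    | mul x y _ _ hx hy =>
      obtain ⟨r, hr⟩ := hx
      obtain ⟨t, ht⟩ := hy
      refine ⟨r * t, ?_⟩
      have heq : x * y - algebraMap R S (r * t) =
          x • (y - algebraMap R S t) + algebraMap R S t • (x - algebraMap R S r) := by
        simp only [map_mul, smul_eq_mul]
        ring
      rw [heq]
      exact add_mem (Submodule.smul_mem _ _ ht) (Submodule.smul_mem _ _ hr)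
  let pr : ∀ n, M →ₗ[R] ℳ n := fun n =>
    DirectSum.component R ℕ (fun n => ℳ n) n ∘ₗ (DirectSum.decomposeLinearEquiv ℳ).toLinearMap
  let mul : ∀ n, X → ℳ n →ₗ[R] ℳ (n + 1) := fun n x =>
    { toFun := fun m => ⟨x.1 • m.1, by
        have h := SetLike.GradedSMul.smul_mem (hXsub x.2) m.2
        rwa [vadd_eq_add, add_comm] at h⟩
      map_add' := fun m m' => Subtype.ext (smul_add _ _ _)
      map_smul' := fun r m => Subtype.ext (smul_comm _ _ _) }
  refine associatedPrimes_eventually_constant (E := HomCohomology a b S M) X hX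
    (fun n => HomCohomology a b R (ℳ n)) (fun n => HomCohomology.map a b R S (ℳ n).subtype)
    (fun n => HomCohomology.map a b S R (pr n)) ?_ ?_
    (fun n x => HomCohomology.map a b R R (mul n x)) ?_
  · intro n e
    obtain ⟨φ, hφ, rfl⟩ := HomCohomology.exists_eq_mk e
    rw [HomCohomology.map_mk, HomCohomology.map_mk]
    refine HomCohomology.mk_congr (LinearMap.ext fun y => ?_) _
    change DirectSum.decompose ℳ (φ y : M) n = φ y
    rw [DirectSum.decompose_coe, DirectSum.of_eq_same]
  · intro e
    classical
    obtain ⟨φ, hφ, rfl⟩ := HomCohomology.exists_eq_mk e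
    obtain ⟨G, hG⟩ := Module.Finite.fg_top (R := R) (M := B)
    refine ⟨G.sup fun g => (DFinsupp.support (DirectSum.decompose ℳ (φ g))).sup id + 1,
      fun n hn => ?_⟩
    rw [HomCohomology.map_mk, ← HomCohomology.mk_zero (by simp)]
    refine HomCohomology.mk_congr (LinearMap.ext_on hG fun g hg => ?_) _
    change DirectSum.decompose ℳ (φ g) n = 0
    by_contra hne
    have h₁ : n ≤ (DFinsupp.support (DirectSum.decompose ℳ (φ g))).sup id :=
      Finset.le_sup (f := id) ((DFinsupp.mem_support_toFun _ _).2 hne)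
    have h₂ := (Finset.le_sup (f := fun g =>
      (DFinsupp.support (DirectSum.decompose ℳ (φ g))).sup id + 1) hg).trans hn
    omega
  · intro n x e
    obtain ⟨φ, hφ, rfl⟩ := HomCohomology.exists_eq_mk e
    rfl

namespace ModuleCat

/-- The rank of a finite free module surjecting onto `M`. -/
noncomputable def coverRank (R : Type) [CommRing R] (M : Type) [AddCommGroup M] [Module R M]
    [Module.Finite R M] : ℕ :=
  (Module.Finite.exists_fin' R M).choose

/-- A surjection from a finite free module onto `M`. -/
noncomputable def cover (R : Type) [CommRing R] (M : Type) [AddCommGroup M] [Module R M]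
    [Module.Finite R M] : (Fin (coverRank R M) → R) →ₗ[R] M :=
  (Module.Finite.exists_fin' R M).choose_spec.choose

theorem cover_surjective (R : Type) [CommRing R] (M : Type) [AddCommGroup M] [Module R M]
    [Module.Finite R M] : Function.Surjective (cover R M) :=
  (Module.Finite.exists_fin' R M).choose_spec.choose_spec

theorem range_subtype_comp_cover {R M : Type} [CommRing R] [AddCommGroup M] [Module R M]
    (K : Submodule R M) [Module.Finite R K] : LinearMap.range (K.subtype ∘ₗ cover R K) = K := by
  rw [LinearMap.range_comp, LinearMap.range_eq_top.2 (cover_surjective R K), Submodule.map_top,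
    Submodule.range_subtype]

theorem ker_subtype_comp_cover {R M : Type} [CommRing R] [AddCommGroup M] [Module R M]
    (K : Submodule R M) [Module.Finite R K] :
    LinearMap.ker (K.subtype ∘ₗ cover R K) = LinearMap.ker (cover R K) := by
  rw [LinearMap.ker_comp, Submodule.ker_subtype]
  rfl

variable {R : Type} [CommRing R] [IsNoetherianRing R] (M : Type) [AddCommGroup M] [Module R M]
  [Module.Finite R M]

/-- The terms of a resolution of `M` by finite free modules, together with the kernels of the
differentials. -/
noncomputable def freeSyzygy : ℕ → Σ m : ℕ, Submodule R (Fin m → R)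
  | 0 => ⟨_, LinearMap.ker (cover R M)⟩
  | n + 1 => ⟨_, LinearMap.ker (cover R (freeSyzygy n).2)⟩

/-- The differentials of a resolution of `M` by finite free modules. -/
noncomputable def freeDifferential (n : ℕ) :
    (Fin (freeSyzygy (R := R) M (n + 1)).1 → R) →ₗ[R] (Fin (freeSyzygy (R := R) M n).1 → R) :=
  (freeSyzygy M n).2.subtype ∘ₗ cover R (freeSyzygy M n).2

theorem range_freeDifferential (n : ℕ) :
    LinearMap.range (freeDifferential (R := R) M n) = (freeSyzygy M n).2 :=
  range_subtype_comp_cover _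

theorem ker_freeDifferential (n : ℕ) :
    LinearMap.ker (freeDifferential (R := R) M n) = (freeSyzygy M (n + 1)).2 :=
  ker_subtype_comp_cover _

/-- The augmentation of a resolution of `M` by finite free modules. -/
noncomputable def freeAugmentation : (Fin (freeSyzygy (R := R) M 0).1 → R) →ₗ[R] M :=
  cover R M

theorem range_freeDifferential_zero :
    LinearMap.range (freeDifferential (R := R) M 0) = LinearMap.ker (freeAugmentation M) :=
  range_freeDifferential M 0

/-- A resolution of `M` by finite free modules, as a chain complex. -/
noncomputable def freeComplex : ChainComplex (ModuleCat R) ℕ :=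
  ChainComplex.of (fun n => ModuleCat.of R (Fin (freeSyzygy (R := R) M n).1 → R))
    (fun n => ModuleCat.ofHom (freeDifferential M n)) (fun n => by
      ext1
      exact LinearMap.range_le_ker_iff.1
        ((range_freeDifferential M (n + 1)).trans (ker_freeDifferential M n).symm).le)

theorem freeComplex_d (n : ℕ) :
    (freeComplex (R := R) M).d (n + 1) n = ModuleCat.ofHom (freeDifferential M n) :=
  ChainComplex.of_d (fun n => ModuleCat.of R (Fin (freeSyzygy (R := R) M n).1 → R))
    (fun n => ModuleCat.ofHom (freeDifferential M n)) n

/-- A projective resolution of `M` by finite free modules. -/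
noncomputable def freeResolution : ProjectiveResolution (ModuleCat.of R M) where
  complex := freeComplex M
  projective n := (IsProjective.iff_projective _).1
    (inferInstanceAs (Module.Projective R (Fin (freeSyzygy (R := R) M n).1 → R)))
  π := (ChainComplex.toSingle₀Equiv _ _).symm ⟨ModuleCat.ofHom (freeAugmentation M), by
    rw [freeComplex_d]
    ext1
    refine LinearMap.range_le_ker_iff.1 (range_freeDifferential_zero M).le⟩
  quasiIso := ⟨fun n => by
    cases n
    · rw [ChainComplex.quasiIsoAt₀_iff, ShortComplex.quasiIso_iff_of_zeros']
      · refine (ShortComplex.exact_and_epi_g_iff_of_iso (S₁ := ShortComplex.mk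
          (ModuleCat.ofHom (freeDifferential M 0)) (ModuleCat.ofHom (freeAugmentation M)) (by
            ext1
            exact LinearMap.range_le_ker_iff.1 (range_freeDifferential_zero M).le)) ?_).1
          ⟨?_, (ModuleCat.epi_iff_surjective _).2 (cover_surjective R M)⟩
        · exact ShortComplex.isoMk (Iso.refl _) (Iso.refl _) (Iso.refl _)
            (by
              simp only [HomologicalComplex.shortComplexFunctor'_obj_f, freeComplex_d,
                Iso.refl_hom]
              exact (Category.id_comp _).trans (Category.comp_id _).symm)
            (by
              refine (Category.id_comp _).trans (Eq.trans ?_ (Category.comp_id _).symm)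
              exact ChainComplex.toSingle₀Equiv_symm_apply_f_zero _ _)
        · exact (ShortComplex.moduleCat_exact_iff_range_eq_ker _).2 (range_freeDifferential_zero M)
      all_goals rfl
    · rename_i n
      rw [quasiIsoAt_iff_exactAt']
      · rw [HomologicalComplex.exactAt_iff' _ (n + 1 + 1) (n + 1) n (by simp) (by simp)]
        refine (ShortComplex.moduleCat_exact_iff_range_eq_ker _).2 ?_
        change LinearMap.range ((freeComplex (R := R) M).d (n + 2) (n + 1)).hom =
          LinearMap.ker ((freeComplex (R := R) M).d (n + 1) n).hom
        rw [freeComplex_d, freeComplex_d]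
        exact (range_freeDifferential M (n + 1)).trans (ker_freeDifferential M n).symm
      · apply ChainComplex.exactAt_succ_single_obj⟩

instance (n : ℕ) : Module.Finite R ((freeComplex (R := R) M).X n) :=
  inferInstanceAs (Module.Finite R (Fin (freeSyzygy (R := R) M n).1 → R))

end ModuleCat

/-- `Ext` computed as the cohomology of homomorphisms out of a projective resolution. -/
theorem nonempty_ext_linearEquiv_homCohomology {R : Type} [CommRing R] {X : ModuleCat.{0} R}
    (P : ProjectiveResolution X) (j : ℕ) (N : Type) [AddCommGroup N] [Module R N] :
    Nonempty ((((Ext R (ModuleCat R) j).obj (op X)).obj (ModuleCat.of R N)) ≃ₗ[R]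
      HomCohomology (P.complex.d ((ComplexShape.up ℕ).next j) j).hom
        (P.complex.d j ((ComplexShape.up ℕ).prev j)).hom R N) := by
  let K := P.complex.linearYonedaObj R (ModuleCat.of R N)
  let a := (P.complex.d ((ComplexShape.up ℕ).next j) j).hom
  let b := (P.complex.d j ((ComplexShape.up ℕ).prev j)).hom
  let e : (((Ext R (ModuleCat R) j).obj (op X)).obj (ModuleCat.of R N)) ≃ₗ[R]
      LinearMap.ker (K.sc j).g.hom ⧸ LinearMap.range (K.sc j).moduleCatToCycles :=
    (P.isoExt (R := R) j (ModuleCat.of R N) ≪≫ (K.sc j).moduleCatHomologyIso).toLinearEquiv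
  suffices f : (LinearMap.ker (K.sc j).g.hom ⧸ LinearMap.range (K.sc j).moduleCatToCycles) ≃ₗ[R]
      HomCohomology a b R N from ⟨e.trans f⟩
  let h₁ : (K.sc j).X₁ ≃ₗ[R] (P.complex.X ((ComplexShape.up ℕ).prev j) →ₗ[R] N) :=
    ModuleCat.homLinearEquiv
  let h₂ : (K.sc j).X₂ ≃ₗ[R] (P.complex.X j →ₗ[R] N) := ModuleCat.homLinearEquiv
  have hker : (LinearMap.ker (K.sc j).g.hom).map h₂.toLinearMap =
      LinearMap.ker (LinearMap.lcomp R N a) := by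
    ext φ
    rw [Submodule.mem_map_equiv]
    constructor
    · intro h
      exact congrArg ModuleCat.Hom.hom h
    · intro h
      exact ModuleCat.hom_ext h
  refine Submodule.Quotient.equiv _ _ (h₂.ofSubmodules _ _ hker) ?_
  ext φ
  rw [Submodule.mem_map_equiv]
  constructor
  · rintro ⟨χ, hχ⟩
    refine ⟨h₁ χ, ?_⟩
    exact congrArg (fun ψ => h₂ ψ.1) hχ
  · rintro ⟨χ, hχ⟩
    refine ⟨h₁.symm χ, Subtype.ext ?_⟩
    exact congrArg h₂.symm hχ

/-- Corollary: with `r` the eventual value of `depth_k(ann M₀, N_n)`, for every `l ≤ r` the set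
`⋃_{j≤l} Ass_R(Ext^j_R(M₀, N_n))_{≥k}` is stable for large `n`. -/
theorem ass_ext_graded_stable (R : Type) [CommRing R] [IsNoetherianRing R]
    [IsLocalRing R]
    (M₀ : Type) [AddCommGroup M₀] [Module R M₀] [Module.Finite R M₀]
    (S : Type) [CommRing S] [Algebra R S] [Algebra.FiniteType R S]
    (𝒜 : ℕ → Submodule R S) [GradedAlgebra 𝒜]
    (hstd : Algebra.adjoin R (𝒜 1 : Set S) = ⊤)
    (h0 : 𝒜 0 = Subalgebra.toSubmodule (⊥ : Subalgebra R S))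
    (M : Type) [AddCommGroup M] [Module R M] [Module S M] [IsScalarTower R S M]
    (ℳ : ℕ → Submodule R M) [SetLike.GradedSMul 𝒜 ℳ] [DirectSum.Decomposition ℳ]
    [Module.Finite S M]
    (k : ℤ) (hk : -1 ≤ k) (r : ℕ∞)
    (hev : ∃ n₀ : ℕ, ∀ n ≥ n₀, depthK R k (Module.annihilator R M₀) (ℳ n) = r)
    (l : ℕ) (hl : (l : ℕ∞) ≤ r) :
    ∃ (n₁ : ℕ) (T : Set (Ideal R)), ∀ n ≥ n₁,
      (⋃ j ≤ l, associatedPrimes R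
          (((Ext R (ModuleCat R) j).obj (op (ModuleCat.of R M₀))).obj (ModuleCat.of R (ℳ n)))
          ∩ dimGE R k) = T := by
  let P := ModuleCat.freeResolution (R := R) M₀
  have hfin : ∀ j, Module.Finite R (P.complex.X j) := fun j =>
    inferInstanceAs (Module.Finite R ((ModuleCat.freeComplex (R := R) M₀).X j))
  choose N T hT using fun j => associatedPrimes_homCohomology_eventually_constant
    (P.complex.d ((ComplexShape.up ℕ).next j) j).hom
    (P.complex.d j ((ComplexShape.up ℕ).prev j)).hom 𝒜 hstd ℳ
  refine ⟨(Finset.range (l + 1)).sup N, ⋃ j ≤ l, T j ∩ dimGE R k, fun n hn =>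
    Set.iUnion₂_congr fun j hj => ?_⟩
  obtain ⟨e⟩ := nonempty_ext_linearEquiv_homCohomology P j (ℳ n)
  rw [LinearEquiv.AssociatedPrimes.eq e, hT j n ((Finset.le_sup (f := N) (by simp; omega)).trans hn)]
end

section
/- Let R be a Noetherian local ring, I an ideal generated by a_1,...,a_s, 𝔑 = ⊕_{n≥0} N_n a finitely generated graded module over a finitely generated standard graded R-algebra with degree-0 part R, k ≥ -1, and r the eventual value of depth_k(I, N_n). Then for every l ≤ r and all fixed positive integers t, t_1,...,t_s, the sets ⋃_{j≤l} Ass_R(Ext^j_R(R/I^t, N_n))_{≥k} and ⋃_{j≤l} Ass_R(Ext^j_R(R/(a_1^{t_1},...,a_s^{t_s}), N_n))_{≥k} are stable for large n; moreover, if r < ∞ these two sets are equal for large n. -/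
open CategoryTheory Opposite IsLocalRing

/-- Every element of `S = R[A]` is congruent to a scalar modulo the ideal generated by `A`. -/
theorem exists_algebraMap_add_mem_span {R S : Type*} [CommRing R] [CommRing S] [Algebra R S]
    {A : Set S} (hA : Algebra.adjoin R A = ⊤) (s : S) :
    ∃ r : R, ∃ u ∈ Ideal.span A, s = algebraMap R S r + u := by
  have hs : s ∈ Algebra.adjoin R A := hA ▸ Algebra.mem_top
  induction hs using Algebra.adjoin_induction with
  | mem x hx => exact ⟨0, x, Ideal.subset_span hx, by simp⟩
  | algebraMap r => exact ⟨r, 0, zero_mem _, by simp⟩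
  | add x y _ _ hx hy =>
    obtain ⟨a, u, hu, rfl⟩ := hx
    obtain ⟨b, v, hv, rfl⟩ := hy
    exact ⟨a + b, u + v, add_mem hu hv, by rw [map_add]; ring⟩
  | mul x y _ _ hx hy =>
    obtain ⟨a, u, hu, rfl⟩ := hx
    obtain ⟨b, v, hv, rfl⟩ := hy
    refine ⟨a * b, algebraMap R S a * v + u * (algebraMap R S b + v), ?_, by rw [map_mul]; ring⟩
    exact add_mem (Ideal.mul_mem_left _ _ hv) (Ideal.mul_mem_right _ _ hu)

/-- The primes of `R` that are annihilators of elements of a finite `S`-module are contractions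
of associated primes. -/
theorem exists_isAssociatedPrime_comap_eq {R S E : Type*} [CommRing R] [CommRing S] [Algebra R S]
    [IsNoetherianRing S] [AddCommGroup E] [Module R E] [Module S E] [IsScalarTower R S E]
    {p : Ideal R} (hp : p.IsPrime) (e : E) (he : ∀ r, r ∈ p ↔ r • e = 0) :
    ∃ P ∈ associatedPrimes S E, Ideal.comap (algebraMap R S) P = p := by
  obtain ⟨P, ⟨y, hy, hP⟩, hmax⟩ := set_has_maximal_iff_noetherian.mpr ‹IsNoetherianRing S›
    {P : Ideal S | ∃ y : E, (∀ r, r ∈ p ↔ r • y = 0) ∧ ∀ u, u ∈ P ↔ u • y = 0}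
    ⟨LinearMap.ker (LinearMap.toSpanSingleton S E e), e, he, fun u => by simp⟩
  have key : ∀ z : E, (∀ r, r ∈ p ↔ r • z = 0) → (∀ u ∈ P, u • z = 0) →
      ∀ u, u • z = 0 → u ∈ P := by
    intro z hz hPz u hu
    by_contra hcon
    refine hmax (LinearMap.ker (LinearMap.toSpanSingleton S E z)) ⟨z, hz, fun u => by simp⟩ ?_
    refine lt_of_le_of_ne (fun v hv => by simpa using hPz v hv) ?_
    rintro rfl
    exact hcon (by simpa using hu)
  have hcomap : Ideal.comap (algebraMap R S) P = p := by
    ext r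
    rw [Ideal.mem_comap, hP, algebraMap_smul, hy]
  refine ⟨P, ?_, hcomap⟩
  rw [AssociatedPrimes.mem_iff, isAssociatedPrime_iff]
  refine ⟨⟨?_, ?_⟩, y, ?_⟩
  · rintro rfl
    exact hp.ne_top (by rw [← hcomap, Ideal.comap_top])
  · intro a b hab
    by_contra! hcon
    obtain ⟨ha, hb⟩ := hcon
    by_cases hby : ∀ r, r ∈ p ↔ r • (b • y) = 0
    · refine ha (key (b • y) hby (fun u hu => ?_) a ?_)
      · rw [smul_comm, (hP u).1 hu, smul_zero]
      · rw [← mul_smul]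
        exact (hP _).1 hab
    · push Not at hby
      obtain ⟨r, ⟨hr, hr'⟩ | ⟨hr, hr'⟩⟩ := hby
      · exact hr' (by rw [smul_comm, (hy r).1 hr, smul_zero])
      · refine hb (key (r • y) (fun c => ?_) (fun u hu => ?_) b ?_)
        · rw [← mul_smul, ← hy]
          exact ⟨fun h => Ideal.mul_mem_right _ _ h, fun h => (hp.mem_or_mem h).resolve_right hr⟩
        · rw [smul_comm, (hP u).1 hu, smul_zero]
        · rw [smul_comm, hr']
  · ext u
    rw [hP, Submodule.mem_colon_singleton, Submodule.mem_bot]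

/-- Eventual constancy of the prime annihilators of elements of the components of a finite
module over a standard graded algebra. The components are an arbitrary family of `R`-submodules
`G n` with `A • G n ⊆ G (n + 1)`, and the boundedness of degrees is encoded by
the exhaustive filtration `W`. -/
theorem exists_forall_prime_annihilators_eq {R S E : Type*} [CommRing R] [CommRing S]
    [Algebra R S] [IsNoetherianRing S] [AddCommGroup E] [Module R E] [Module S E]
    [IsScalarTower R S E] [Module.Finite S E] {A : Set S} (hA : Algebra.adjoin R A = ⊤)
    (G : ℕ → Submodule R E) (hG : ∀ n, ∀ a ∈ A, ∀ e ∈ G n, a • e ∈ G (n + 1))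
    (W : ℕ → Submodule R E) (hWmono : Monotone W) (hW : ∀ e, ∃ D, e ∈ W D)
    (hWG : ∀ D n, D < n → ∀ e ∈ G n, e ∈ W D → e = 0) :
    ∃ (n₀ : ℕ) (T : Set (Ideal R)), ∀ n ≥ n₀,
      {p : Ideal R | p.IsPrime ∧ ∃ e ∈ G n, ∀ r, r ∈ p ↔ r • e = 0} = T := by
  classical
  set Φ : ℕ → Set (Ideal R) := fun n =>
    {p : Ideal R | p.IsPrime ∧ ∃ e ∈ G n, ∀ r, r ∈ p ↔ r • e = 0} with hΦ
  obtain ⟨B, hBA, hBfin⟩ :=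
    (Submodule.fg_span_iff_fg_span_finset_subset A).1 (IsNoetherian.noetherian (Ideal.span A))
  -- elements killed by `A` have bounded degree
  obtain ⟨D, hD⟩ : ∃ D, ∀ e : E, (∀ a ∈ A, a • e = 0) → e ∈ W D := by
    let L : Submodule S E :=
      { carrier := {e | ∀ a ∈ A, a • e = 0}
        add_mem' := fun hx hy a ha => by rw [smul_add, hx a ha, hy a ha, add_zero]
        zero_mem' := fun a _ => smul_zero a
        smul_mem' := fun c x hx a ha => by rw [smul_comm, hx a ha, smul_zero] }
    have hL : ∀ e ∈ L, ∀ u ∈ Ideal.span A, u • e = 0 := by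
      intro e he u hu
      induction hu using Submodule.span_induction with
      | mem x hx => exact he x hx
      | zero => exact zero_smul _ _
      | add x y _ _ hx hy => rw [add_smul, hx, hy, add_zero]
      | smul c x _ hx => rw [smul_assoc, hx, smul_zero]
    obtain ⟨g, hg⟩ : L.FG := IsNoetherian.noetherian L
    choose d hd using hW
    refine ⟨g.sup d, fun e he => ?_⟩
    have he' : e ∈ L := he
    rw [← hg] at he'
    have hgL : ∀ x ∈ Submodule.span S (g : Set E), x ∈ L := fun x hx => hg ▸ hx
    induction he' using Submodule.span_induction with
    | mem x hx => exact hWmono (Finset.le_sup (f := d) hx) (hd x)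
    | zero => exact zero_mem _
    | add x y hx hy hx' hy' => exact add_mem (hx' (hgL x hx)) (hy' (hgL y hy))
    | smul c x hx hx' =>
      obtain ⟨r, u, hu, rfl⟩ := exists_algebraMap_add_mem_span hA c
      rw [add_smul, algebraMap_smul, hL x (hgL x hx) u hu, add_zero]
      exact Submodule.smul_mem _ _ (hx' (hgL x hx))
  have hstep : ∀ n, D < n → Φ n ⊆ Φ (n + 1) := by
    rintro n hn p ⟨hp, e, he, hpe⟩
    refine ⟨hp, ?_⟩
    by_contra! hcon
    have hb : ∀ b ∈ B, ∃ r, r ∉ p ∧ r • (b • e) = 0 := by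
      intro b hb
      obtain ⟨r, ⟨hr, hr'⟩ | ⟨hr, hr'⟩⟩ := hcon (b • e) (hG n b (hBA hb) e he)
      · exact absurd (by rw [smul_comm, (hpe r).1 hr, smul_zero]) hr'
      · exact ⟨r, hr, hr'⟩
    choose! f hf hf' using hb
    have hprod : (∏ b ∈ B, f b) ∉ p := by
      rw [hp.prod_mem_iff]
      push Not
      exact hf
    refine hprod ((hpe _).2 ?_)
    refine hWG D n hn _ (Submodule.smul_mem _ _ he) (hD _ fun a ha => ?_)
    have : a ∈ Ideal.span (B : Set S) := by
      have h : a ∈ Ideal.span A := Ideal.subset_span ha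
      rwa [← Ideal.submodule_span_eq, hBfin] at h
    clear ha
    induction this using Submodule.span_induction with
    | mem b hb =>
      rw [smul_comm, ← Finset.prod_erase_mul _ _ hb, mul_smul, hf' b hb, smul_zero]
    | zero => exact zero_smul _ _
    | add x y _ _ hx hy => rw [add_smul, hx, hy, add_zero]
    | smul c x _ hx => rw [smul_assoc, hx, smul_zero]
  have hfin : (⋃ n, Φ n).Finite := by
    refine ((associatedPrimes.finite S E).image (Ideal.comap (algebraMap R S))).subset ?_
    rintro p hp
    obtain ⟨n, hp, e, -, hpe⟩ := Set.mem_iUnion.1 hp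
    exact exists_isAssociatedPrime_comap_eq hp e hpe
  have hmono : Monotone fun m => Φ (D + 1 + m) :=
    monotone_nat_of_le_succ fun m => hstep (D + 1 + m) (by omega)
  have hfin' : (Set.range fun m => Φ (D + 1 + m)).Finite :=
    hfin.finite_subsets.subset (by rintro _ ⟨m, rfl⟩; exact Set.subset_iUnion Φ _)
  obtain ⟨_, ⟨m, rfl⟩, hm⟩ := hfin'.exists_maximal (Set.range_nonempty _)
  refine ⟨D + 1 + m, Φ (D + 1 + m), fun n hn => ?_⟩
  obtain ⟨c, rfl⟩ := Nat.exists_eq_add_of_le hn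
  have hle := hmono (Nat.le_add_right m c)
  exact le_antisymm (by simpa [add_assoc] using hm ⟨m + c, rfl⟩ hle) (by simpa [add_assoc] using hle)

section TorsionAt

variable {R : Type*} [CommRing R]

/-- Every element of `T` is killed by some element outside `p`; for prime `p`
this means `T_p = 0`. -/
def IsTorsionAt (p : Ideal R) (T : Type*) [AddCommGroup T] [Module R T] : Prop :=
  ∀ t : T, ∃ s ∉ p, s • t = 0

/-- The ideal `p` is the annihilator of `t`. -/
def IsAnnihilatorOf {T : Type*} [AddCommGroup T] [Module R T] (p : Ideal R) (t : T) : Prop :=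
  ∀ r : R, r ∈ p ↔ r • t = 0

variable {p : Ideal R} {T T' : Type*} [AddCommGroup T] [Module R T] [AddCommGroup T']
  [Module R T']

theorem mem_associatedPrimes_iff_isAnnihilatorOf [IsNoetherianRing R] :
    p ∈ associatedPrimes R T ↔ p.IsPrime ∧ ∃ t : T, IsAnnihilatorOf p t := by
  rw [AssociatedPrimes.mem_iff, isAssociatedPrime_iff]
  simp [IsAnnihilatorOf, SetLike.ext_iff, Submodule.mem_colon_singleton]

theorem IsAnnihilatorOf.smul (hp : p.IsPrime) {t : T} (h : IsAnnihilatorOf p t) {s : R}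
    (hs : s ∉ p) : IsAnnihilatorOf p (s • t) := fun r => by
  rw [← mul_smul, ← h]
  exact ⟨fun hr => Ideal.mul_mem_right _ _ hr, fun hr => (hp.mem_or_mem hr).resolve_right hs⟩

theorem IsAnnihilatorOf.map (hp : p.IsPrime) {t : T} (h : IsAnnihilatorOf p t) (f : T →ₗ[R] T')
    (hf : ∀ u, f u = 0 → ∃ s ∉ p, s • u = 0) : IsAnnihilatorOf p (f t) := fun r => by
  refine ⟨fun hr => by rw [← map_smul, (h r).1 hr, map_zero], fun hr => ?_⟩
  obtain ⟨s, hs, hst⟩ := hf (r • t) (by rw [map_smul, hr])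
  rw [← mul_smul, ← h] at hst
  exact (hp.mem_or_mem hst).resolve_left hs

theorem IsAnnihilatorOf.exists_of_map [IsNoetherianRing R] (hp : p.IsPrime) {t : T}
    (f : T →ₗ[R] T') (h : IsAnnihilatorOf p (f t))
    (hf : ∀ u, f u = 0 → ∃ s ∉ p, s • u = 0) : ∃ u : T, IsAnnihilatorOf p u := by
  classical
  obtain ⟨g, hg⟩ := IsNoetherian.noetherian p
  have hk : ∀ r ∈ p, ∃ s ∉ p, s • r • t = 0 := fun r hr =>
    hf _ (by rw [map_smul, (h r).1 hr])
  choose! c hc hc' using hk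
  have hgp : ∀ b ∈ g, b ∈ p := fun b hb => hg ▸ Submodule.subset_span hb
  have hprod : (∏ b ∈ g, c b) ∉ p := by
    rw [hp.prod_mem_iff]
    push Not
    exact fun b hb => hc b (hgp b hb)
  refine ⟨(∏ b ∈ g, c b) • t, fun r => ⟨fun hr => ?_, fun hr => ?_⟩⟩
  · rw [← hg] at hr
    induction hr using Submodule.span_induction with
    | mem b hb =>
      rw [smul_comm, ← Finset.prod_erase_mul _ _ hb, mul_smul, hc' b (hgp b hb), smul_zero]
    | zero => exact zero_smul _ _
    | add x y _ _ hx hy => rw [add_smul, hx, hy, add_zero]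
    | smul a x _ hx => rw [smul_assoc, hx, smul_zero]
  · have : (r * ∏ b ∈ g, c b) • f t = 0 := by rw [mul_smul, ← map_smul, ← map_smul, hr, map_zero]
    exact (hp.mem_or_mem ((h _).2 this)).resolve_right hprod

end TorsionAt

section ExtStep

open CategoryTheory.Abelian

variable {R : Type} [CommRing R] {X N N' : ModuleCat R} {p : Ideal R}

/-- Postcomposition with a fixed class, as a linear map of `Ext` modules. -/
noncomputable def extPostcomp (X : ModuleCat R) {Y Z : ModuleCat R} {b : ℕ}
    (β : Abelian.Ext Y Z b) (a c : ℕ) (h : a + b = c) :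
    Abelian.Ext X Y a →ₗ[R] Abelian.Ext X Z c :=
  (Abelian.Ext.bilinearCompOfLinear R X Y Z a b c h).flip β

theorem extPostcomp_apply {Y Z : ModuleCat R} {b : ℕ}
    (β : Abelian.Ext Y Z b) (a c : ℕ) (h : a + b = c) (α : Abelian.Ext X Y a) :
    extPostcomp X β a c h α = α.comp β h := rfl

theorem ext_smul_eq_zero {x : R} (hx : ∀ z : X, x • z = 0) {j : ℕ} (α : Abelian.Ext X N j) :
    x • α = 0 := by
  have h : x • 𝟙 X = 0 := by
    ext z
    exact hx z
  rw [← Abelian.Ext.mk₀_id_comp α, ← Abelian.Ext.smul_comp, ← Abelian.Ext.mk₀_smul, h,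
    Abelian.Ext.mk₀_zero, Abelian.Ext.zero_comp]

theorem isTorsionAt_ext_of_isTorsionAt_smul_ker (hp : p.IsPrime) {x : R} {c : ℕ}
    (hx : ∀ z : X, x ^ c • z = 0) {j : ℕ}
    (h : ∀ α : Abelian.Ext X N j, x • α = 0 → ∃ s ∉ p, s • α = 0) :
    IsTorsionAt p (Abelian.Ext X N j) := by
  have key : ∀ (d : ℕ) (α : Abelian.Ext X N j), x ^ d • α = 0 → ∃ s ∉ p, s • α = 0 := by
    intro d
    induction d with
    | zero => exact fun α hα => ⟨1, p.one_notMem, by simpa using hα⟩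
    | succ d ih =>
      intro α hα
      obtain ⟨s, hs, hsα⟩ := h (x ^ d • α) (by rw [← mul_smul, ← pow_succ', hα])
      obtain ⟨s', hs', hsα'⟩ := ih (s • α) (by rw [smul_comm, hsα])
      exact ⟨s' * s, hp.mul_notMem hs' hs, by rw [mul_smul, hsα']⟩
  exact fun α => key c α (ext_smul_eq_zero hx α)

/-- The short exact sequence `0 → (0 :_N x) → N → xN → 0`. -/
noncomputable abbrev smulKerSequence (N : ModuleCat R) (x : R) : ShortComplex (ModuleCat R) :=
  ShortComplex.mk
    (ModuleCat.ofHom (LinearMap.ker (LinearMap.lsmul R N x)).subtype)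
    (ModuleCat.ofHom (LinearMap.lsmul R N x).rangeRestrict)
    (by ext z; exact z.2)

theorem smulKerSequence_shortExact (N : ModuleCat R) (x : R) :
    (smulKerSequence N x).ShortExact :=
  ShortComplex.ShortExact.mk'
    ((ShortComplex.moduleCat_exact_iff _).2 fun z hz => ⟨⟨z, congrArg Subtype.val hz⟩, rfl⟩)
    ((ModuleCat.mono_iff_injective _).2 Subtype.val_injective)
    ((ModuleCat.epi_iff_surjective _).2 (LinearMap.surjective_rangeRestrict _))

/-- The short exact sequence `0 → xN → N → N' → 0`, where `N'` is a quotient of `N` by `xN`. -/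
noncomputable abbrev smulRangeSequence (q : N ⟶ N') (x : R)
    (hq : ∀ z, q z = 0 ↔ ∃ w, x • w = z) : ShortComplex (ModuleCat R) :=
  ShortComplex.mk (ModuleCat.ofHom (LinearMap.range (LinearMap.lsmul R N x)).subtype) q
    (by ext z; exact (hq _).2 z.2)

theorem smulRangeSequence_shortExact (q : N ⟶ N') (x : R) (hq : ∀ z, q z = 0 ↔ ∃ w, x • w = z)
    (hs : Function.Surjective q) : (smulRangeSequence q x hq).ShortExact :=
  ShortComplex.ShortExact.mk'
    ((ShortComplex.moduleCat_exact_iff _).2 fun z hz => ⟨⟨z, (hq z).1 hz⟩, rfl⟩)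
    ((ModuleCat.mono_iff_injective _).2 Subtype.val_injective)
    ((ModuleCat.epi_iff_surjective _).2 hs)

theorem comp_smulKerSequence_g_comp_smulRangeSequence_f (q : N ⟶ N') (x : R)
    (hq : ∀ z, q z = 0 ↔ ∃ w, x • w = z) {j : ℕ} (α : Abelian.Ext X N j) :
    (α.comp (Abelian.Ext.mk₀ (smulKerSequence N x).g) (add_zero j)).comp
      (Abelian.Ext.mk₀ (smulRangeSequence q x hq).f) (add_zero j) = x • α := by
  rw [Abelian.Ext.comp_assoc_of_third_deg_zero, Abelian.Ext.mk₀_comp_mk₀,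
    Abelian.Ext.smul_eq_comp_mk₀]
  congr 2

/-- The kernel of `Ext^j(X, N) → Ext^j(X, xN)` is torsion at `p` when `(0 :_N x)_p = 0`. -/
theorem torsion_of_comp_smulKerSequence_g_eq_zero {x : R}
    (hX : ∀ K : ModuleCat R, IsTorsionAt p K → ∀ j, IsTorsionAt p (Abelian.Ext X K j))
    (hreg : ∀ z : N, x • z = 0 → ∃ s ∉ p, s • z = 0) {j : ℕ} (α : Abelian.Ext X N j)
    (h : α.comp (Abelian.Ext.mk₀ (smulKerSequence N x).g) (add_zero j) = 0) :
    ∃ s ∉ p, s • α = 0 := by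
  obtain ⟨κ, rfl⟩ := Abelian.Ext.covariant_sequence_exact₂ X (smulKerSequence_shortExact N x) α h
  obtain ⟨s, hs, hsκ⟩ := hX (smulKerSequence N x).X₁ (fun z => by
    obtain ⟨s, hs, hsz⟩ := hreg z.1 z.2
    exact ⟨s, hs, Subtype.ext hsz⟩) j κ
  exact ⟨s, hs, by rw [← Abelian.Ext.smul_comp, hsκ, Abelian.Ext.zero_comp]⟩

theorem isTorsionAt_ext_succ (hp : p.IsPrime) {x : R} {c : ℕ}
    (hc : ∀ z : X, x ^ c • z = 0)
    (hX : ∀ K : ModuleCat R, IsTorsionAt p K → ∀ j, IsTorsionAt p (Abelian.Ext X K j))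
    (hreg : ∀ z : N, x • z = 0 → ∃ s ∉ p, s • z = 0)
    (q : N ⟶ N') (hq : ∀ z, q z = 0 ↔ ∃ w, x • w = z) (hs : Function.Surjective q) {e : ℕ}
    (h : ∀ j < e, IsTorsionAt p (Abelian.Ext X N' j)) :
    ∀ j < e + 1, IsTorsionAt p (Abelian.Ext X N j) := by
  intro j hj
  refine isTorsionAt_ext_of_isTorsionAt_smul_ker hp hc fun α hα => ?_
  rw [← comp_smulKerSequence_g_comp_smulRangeSequence_f q x hq] at hα
  obtain ⟨s, hsp, hs0⟩ : ∃ s ∉ p,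
      s • α.comp (Abelian.Ext.mk₀ (smulKerSequence N x).g) (add_zero j) = 0 := by
    cases j with
    | zero =>
      have : Mono (smulRangeSequence q x hq).f := (smulRangeSequence_shortExact q x hq hs).mono_f
      refine ⟨1, p.ne_top_iff_one.1 hp.ne_top, ?_⟩
      rw [one_smul]
      exact Abelian.Ext.postcomp_mk₀_injective_of_mono X (smulRangeSequence q x hq).f
        (hα.trans (map_zero _).symm)
    | succ j =>
      obtain ⟨γ, hγ⟩ := Abelian.Ext.covariant_sequence_exact₁ X
        (smulRangeSequence_shortExact q x hq hs) _ hα rfl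
      obtain ⟨s, hs', hsγ⟩ := h j (by omega) γ
      exact ⟨s, hs', by rw [← hγ, ← Abelian.Ext.smul_comp, hsγ, Abelian.Ext.zero_comp]⟩
  rw [← Abelian.Ext.smul_comp] at hs0
  obtain ⟨s', hsp', hs0'⟩ := torsion_of_comp_smulKerSequence_g_eq_zero hX hreg _ hs0
  exact ⟨s' * s, hp.mul_notMem hsp' hsp, by rw [mul_smul, hs0']⟩

theorem exists_isAnnihilatorOf_ext_succ_iff [IsNoetherianRing R] (hp : p.IsPrime) {x : R}
    (hxp : x ∈ p)
    (hX : ∀ K : ModuleCat R, IsTorsionAt p K → ∀ j, IsTorsionAt p (Abelian.Ext X K j))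
    (hreg : ∀ z : N, x • z = 0 → ∃ s ∉ p, s • z = 0)
    (q : N ⟶ N') (hq : ∀ z, q z = 0 ↔ ∃ w, x • w = z) (hs : Function.Surjective q) {e : ℕ}
    (h : IsTorsionAt p (Abelian.Ext X N e)) :
    (∃ α : Abelian.Ext X N (e + 1), IsAnnihilatorOf p α) ↔
      ∃ γ : Abelian.Ext X N' e, IsAnnihilatorOf p γ := by
  have hS₁ := smulKerSequence_shortExact N x
  have hS₂ := smulRangeSequence_shortExact q x hq hs
  have hδ : ∀ γ : Abelian.Ext X N' e, extPostcomp X hS₂.extClass e (e + 1) rfl γ = 0 →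
      ∃ s ∉ p, s • γ = 0 := by
    intro γ hγ
    obtain ⟨α, hα⟩ := Abelian.Ext.covariant_sequence_exact₃ X hS₂ γ rfl hγ
    obtain ⟨s, hs', hsα⟩ := h α
    exact ⟨s, hs', by rw [← hα, ← Abelian.Ext.smul_comp, hsα, Abelian.Ext.zero_comp]⟩
  have hg : ∀ α : Abelian.Ext X N (e + 1),
      extPostcomp X (Abelian.Ext.mk₀ (smulKerSequence N x).g) (e + 1) (e + 1) rfl α = 0 →
      ∃ s ∉ p, s • α = 0 :=
    fun α hα => torsion_of_comp_smulKerSequence_g_eq_zero hX hreg α hα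
  constructor
  · rintro ⟨α, hα⟩
    have hβ := hα.map hp _ hg
    have hβ0 := comp_smulKerSequence_g_comp_smulRangeSequence_f q x hq α
    rw [(hα x).1 hxp] at hβ0
    obtain ⟨γ, hγ⟩ := Abelian.Ext.covariant_sequence_exact₁ X hS₂ _ hβ0 rfl
    rw [extPostcomp_apply, ← hγ] at hβ
    exact IsAnnihilatorOf.exists_of_map hp (extPostcomp X hS₂.extClass e (e + 1) rfl) hβ hδ
  · rintro ⟨γ, hγ⟩
    have hβ := hγ.map hp _ hδ
    obtain ⟨s, hsp, hs0⟩ := hX (smulKerSequence N x).X₁ (fun z => by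
      obtain ⟨s, hs, hsz⟩ := hreg z.1 z.2
      exact ⟨s, hs, Subtype.ext hsz⟩) (e + 2)
      ((extPostcomp X hS₂.extClass e (e + 1) rfl γ).comp hS₁.extClass rfl)
    rw [← Abelian.Ext.smul_comp] at hs0
    obtain ⟨α, hα⟩ := Abelian.Ext.covariant_sequence_exact₃ X hS₁ _ rfl hs0
    have hsβ := hβ.smul hp hsp
    rw [← hα] at hsβ
    exact IsAnnihilatorOf.exists_of_map hp
      (extPostcomp X (Abelian.Ext.mk₀ (smulKerSequence N x).g) (e + 1) (e + 1) rfl) hsβ hg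

/-- Rees-type computation of the first non-vanishing `Ext` along a chain of quotients
`N 0 → N 1 → ⋯` with `N (i + 1) = N i / y i • N i`, locally at a prime `p`. -/
theorem ext_along_quotients [IsNoetherianRing R] (hp : p.IsPrime)
    (hX : ∀ K : ModuleCat R, IsTorsionAt p K → ∀ j, IsTorsionAt p (Abelian.Ext X K j))
    (N : ℕ → ModuleCat R) (y : ℕ → R) (q : ∀ i, N i ⟶ N (i + 1))
    (hq : ∀ i z, q i z = 0 ↔ ∃ w, y i • w = z) (hs : ∀ i, Function.Surjective (q i))
    (hyp : ∀ i, y i ∈ p) (hc : ∀ i, ∃ c, ∀ z : X, y i ^ c • z = 0) (e i : ℕ)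
    (hreg : ∀ i' < i + e, i ≤ i' → ∀ z : N i', y i' • z = 0 → ∃ s ∉ p, s • z = 0) :
    (∀ j < e, IsTorsionAt p (Abelian.Ext X (N i) j)) ∧
      ((∃ α : Abelian.Ext X (N i) e, IsAnnihilatorOf p α) ↔
        ∃ α : Abelian.Ext X (N (i + e)) 0, IsAnnihilatorOf p α) := by
  induction e generalizing i with
  | zero => exact ⟨by simp, Iff.rfl⟩
  | succ e ih =>
    obtain ⟨ih₁, ih₂⟩ := ih (i + 1) fun i' h h' => hreg i' (by omega) (by omega)
    have hi := hreg i (by omega) le_rfl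
    obtain ⟨c, hc⟩ := hc i
    have htors := isTorsionAt_ext_succ hp hc hX hi (q i) (hq i) (hs i) ih₁
    refine ⟨htors, ?_⟩
    rw [exists_isAnnihilatorOf_ext_succ_iff hp (hyp i) hX hi (q i) (hq i) (hs i)
      (htors e (by omega)), ih₂, show i + 1 + e = i + (e + 1) by omega]

end ExtStep

section FiniteResolution

variable {R : Type} [CommRing R] [IsNoetherianRing R]

theorem exists_projective_exact_of_hom {A B : ModuleCat.{0} R} (f : A ⟶ B) :
    ∃ (P : ModuleCat.{0} R) (d : P ⟶ A) (w : d ≫ f = 0), Projective P ∧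
      (ShortComplex.mk d f w).Exact ∧ (Module.Finite R A → Module.Finite R P) := by
  by_cases hA : Module.Finite R A
  · obtain ⟨n, g, hg⟩ := Module.Finite.exists_fin' R (LinearMap.ker f.hom)
    refine ⟨ModuleCat.of R (Fin n → R),
      ModuleCat.ofHom ((LinearMap.ker f.hom).subtype ∘ₗ g), ?_, ?_, ?_, fun _ => ?_⟩
    · ext z
      exact (g _).2
    · exact ModuleCat.projective_of_free (Pi.basisFun R (Fin n))
    · refine (ShortComplex.moduleCat_exact_iff _).2 fun z hz => ?_
      obtain ⟨w, hw⟩ := hg ⟨z, hz⟩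
      exact ⟨w, congrArg Subtype.val hw⟩
    · exact inferInstanceAs (Module.Finite R (Fin n → R))
  · have hw : Projective.d f ≫ f = 0 := by
      exact (Category.assoc _ _ _).trans ((congrArg _ (Limits.kernel.condition f)).trans
        Limits.comp_zero)
    exact ⟨_, Projective.d f, hw, inferInstance, exact_d_f f, fun h => absurd h hA⟩

/-- A projective cover of the kernel of `f`, finite if the source of `f` is. -/
noncomputable def finiteSyzygies {A B : ModuleCat.{0} R} (f : A ⟶ B) : ModuleCat.{0} R :=
  (exists_projective_exact_of_hom f).choose

/-- The map from `finiteSyzygies f` to the source of `f`. -/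
noncomputable def finiteSyzygiesHom {A B : ModuleCat.{0} R} (f : A ⟶ B) : finiteSyzygies f ⟶ A :=
  (exists_projective_exact_of_hom f).choose_spec.choose

theorem finiteSyzygiesHom_comp {A B : ModuleCat.{0} R} (f : A ⟶ B) :
    finiteSyzygiesHom f ≫ f = 0 :=
  (exists_projective_exact_of_hom f).choose_spec.choose_spec.choose

theorem projective_finiteSyzygies {A B : ModuleCat.{0} R} (f : A ⟶ B) :
    Projective (finiteSyzygies f) :=
  (exists_projective_exact_of_hom f).choose_spec.choose_spec.choose_spec.1

theorem exact_finiteSyzygiesHom {A B : ModuleCat.{0} R} (f : A ⟶ B) :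
    (ShortComplex.mk (finiteSyzygiesHom f) f (finiteSyzygiesHom_comp f)).Exact :=
  (exists_projective_exact_of_hom f).choose_spec.choose_spec.choose_spec.2.1

theorem finite_finiteSyzygies {A B : ModuleCat.{0} R} (f : A ⟶ B) (hA : Module.Finite R A) :
    Module.Finite R (finiteSyzygies f) :=
  (exists_projective_exact_of_hom f).choose_spec.choose_spec.choose_spec.2.2 hA

/-- The chain complex of iterated `finiteSyzygies` of a map `f : A ⟶ B`. -/
noncomputable def syzygyComplex {A B : ModuleCat.{0} R} (f : A ⟶ B) :
    ChainComplex (ModuleCat.{0} R) ℕ :=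
  ChainComplex.mk' A (finiteSyzygies f) (finiteSyzygiesHom f)
    fun g => ⟨_, finiteSyzygiesHom g, finiteSyzygiesHom_comp g⟩

theorem syzygyComplex_d_one_zero {A B : ModuleCat.{0} R} (f : A ⟶ B) :
    (syzygyComplex f).d 1 0 = finiteSyzygiesHom f :=
  ChainComplex.mk'_d_1_0 _ _ _ _

/-- The terms of `syzygyComplex f` are the `finiteSyzygies` of the preceding differentials. -/
noncomputable def syzygyComplexXIso {A B : ModuleCat.{0} R} (f : A ⟶ B) (n : ℕ) :
    (syzygyComplex f).X (n + 2) ≅ finiteSyzygies ((syzygyComplex f).d (n + 1) n) :=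
  ChainComplex.mk'XIso _ _ _ _ n

theorem syzygyComplex_d {A B : ModuleCat.{0} R} (f : A ⟶ B) (n : ℕ) :
    (syzygyComplex f).d (n + 2) (n + 1) = (syzygyComplexXIso f n).hom ≫
      finiteSyzygiesHom ((syzygyComplex f).d (n + 1) n) :=
  ChainComplex.mk'_d _ _ _ _ n

theorem syzygyComplex_exactAt_succ {A B : ModuleCat.{0} R} (f : A ⟶ B) (n : ℕ) :
    (syzygyComplex f).ExactAt (n + 1) := by
  rw [HomologicalComplex.exactAt_iff' _ (n + 1 + 1) (n + 1) n (by simp) (by simp)]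
  refine (ShortComplex.moduleCat_exact_iff _).2 fun z hz => ?_
  obtain ⟨w, hw⟩ := (ShortComplex.moduleCat_exact_iff _).1
    (exact_finiteSyzygiesHom ((syzygyComplex f).d (n + 1) n)) z hz
  refine ⟨(syzygyComplexXIso f n).inv w, ?_⟩
  change (syzygyComplex f).d (n + 2) (n + 1) _ = z
  rw [syzygyComplex_d, ← hw, ← ModuleCat.comp_apply, Iso.inv_hom_id_assoc]

theorem projective_syzygyComplex_X {A B : ModuleCat.{0} R} (f : A ⟶ B) [Projective A] :
    ∀ n, Projective ((syzygyComplex f).X n)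
  | 0 => inferInstanceAs (Projective A)
  | 1 => projective_finiteSyzygies f
  | _ + 2 => (projective_finiteSyzygies _).of_iso (syzygyComplexXIso f _).symm

theorem finite_syzygyComplex_X {A B : ModuleCat.{0} R} (f : A ⟶ B) (hA : Module.Finite R A)
    (n : ℕ) : Module.Finite R ((syzygyComplex f).X n) := by
  induction n with
  | zero => exact hA
  | succ n ih =>
    cases n with
    | zero => exact finite_finiteSyzygies f hA
    | succ n =>
      have := finite_finiteSyzygies ((syzygyComplex f).d (n + 1) n) ih
      exact Module.Finite.equiv (syzygyComplexXIso f n).symm.toLinearEquiv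

/-- Finite modules over a Noetherian ring have projective resolutions by finite modules. -/
theorem exists_projectiveResolution_finite (X : ModuleCat.{0} R) [Module.Finite R X] :
    ∃ P : ProjectiveResolution X, ∀ n, Module.Finite R (P.complex.X n) := by
  have := projective_finiteSyzygies (0 : X ⟶ X)
  have hepi : Epi (finiteSyzygiesHom (0 : X ⟶ X)) :=
    (ShortComplex.exact_iff_epi _ rfl).1 (exact_finiteSyzygiesHom (0 : X ⟶ X))
  set f := finiteSyzygiesHom (0 : X ⟶ X) with hf
  have hP := projective_syzygyComplex_X f
  have hw : (syzygyComplex f).d 1 0 ≫ f = 0 :=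
    (congrArg (· ≫ f) (syzygyComplex_d_one_zero f)).trans (finiteSyzygiesHom_comp f)
  refine ⟨{ complex := syzygyComplex f
            π := (ChainComplex.toSingle₀Equiv _ _).symm ⟨f, hw⟩
            quasiIso := ⟨fun n => ?_⟩ },
    finite_syzygyComplex_X f (finite_finiteSyzygies _ inferInstance)⟩
  cases n with
  | zero =>
    rw [ChainComplex.quasiIsoAt₀_iff, ShortComplex.quasiIso_iff_of_zeros']
    · refine (ShortComplex.exact_and_epi_g_iff_of_iso (S₂ := ShortComplex.mk
        (finiteSyzygiesHom f) f (finiteSyzygiesHom_comp f)) ?_).2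
        ⟨exact_finiteSyzygiesHom f, hepi⟩
      refine ShortComplex.isoMk (Iso.refl _) (Iso.refl _) (Iso.refl _) ?_ ?_
      · exact (Category.id_comp _).trans ((syzygyComplex_d_one_zero f).symm.trans
          (Category.comp_id _).symm)
      · refine (Category.id_comp _).trans (Eq.trans ?_ (Category.comp_id _).symm)
        exact (ChainComplex.toSingle₀Equiv_symm_apply_f_zero
          (C := syzygyComplex f) f hw).symm
    all_goals rfl
  | succ n =>
    rw [quasiIsoAt_iff_exactAt' _ _ (ChainComplex.exactAt_succ_single_obj _ _)]
    exact syzygyComplex_exactAt_succ f n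

end FiniteResolution

section ExtCocycle

variable {R : Type} [CommRing R]

theorem exists_isAnnihilatorOf_congr {p : Ideal R} {T T' : Type*} [AddCommGroup T] [Module R T]
    [AddCommGroup T'] [Module R T'] (e : T ≃ₗ[R] T') :
    (∃ t : T, IsAnnihilatorOf p t) ↔ ∃ t : T', IsAnnihilatorOf p t := by
  constructor
  · rintro ⟨t, ht⟩
    exact ⟨e t, fun r => by rw [ht r, ← map_smul, e.map_eq_zero_iff]⟩
  · rintro ⟨t, ht⟩
    exact ⟨e.symm t, fun r => by rw [ht r, ← map_smul, e.symm.map_eq_zero_iff]⟩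

theorem exists_isAnnihilatorOf_homology_iff (L : CochainComplex (ModuleCat.{0} R) ℕ) (j : ℕ)
    (p : Ideal R) :
    (∃ t : L.homology j, IsAnnihilatorOf p t) ↔
      ∃ z : L.X j, L.d j (j + 1) z = 0 ∧
        ∀ r : R, r ∈ p ↔ ∃ w, L.d ((ComplexShape.up ℕ).prev j) j w = r • z := by
  let S := L.sc' ((ComplexShape.up ℕ).prev j) j (j + 1)
  have e : L.homology j ≅
      ModuleCat.of R (LinearMap.ker S.g.hom ⧸ LinearMap.range S.moduleCatToCycles) :=
    ShortComplex.homologyMapIso (L.isoSc' _ j (j + 1) rfl (by simp)) ≪≫ S.moduleCatHomologyIso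
  rw [exists_isAnnihilatorOf_congr e.toLinearEquiv]
  have key : ∀ (z : LinearMap.ker S.g.hom) (r : R),
      r • (Submodule.Quotient.mk z :
        LinearMap.ker S.g.hom ⧸ LinearMap.range S.moduleCatToCycles) = 0 ↔ ∃ w, S.f w = r • z.1 := by
    intro z r
    rw [← Submodule.Quotient.mk_smul, Submodule.Quotient.mk_eq_zero]
    exact ⟨fun ⟨w, hw⟩ => ⟨w, congrArg Subtype.val hw⟩, fun ⟨w, hw⟩ => ⟨w, Subtype.ext hw⟩⟩
  constructor
  · rintro ⟨t, ht⟩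
    obtain ⟨z, rfl⟩ := Submodule.Quotient.mk_surjective _ t
    exact ⟨z.1, z.2, fun r => (ht r).trans (key z r)⟩
  · rintro ⟨z, hz, h⟩
    exact ⟨Submodule.Quotient.mk ⟨z, hz⟩, fun r => (h r).trans (key ⟨z, hz⟩ r).symm⟩

variable {X : ModuleCat.{0} R} (P : ProjectiveResolution X)

theorem exists_isAnnihilatorOf_extFunctor_iff (Y : ModuleCat.{0} R) (j : ℕ) (p : Ideal R) :
    (∃ t : ((Ext R (ModuleCat.{0} R) j).obj (op X)).obj Y, IsAnnihilatorOf p t) ↔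
      ∃ φ : P.complex.X j ⟶ Y, P.complex.d (j + 1) j ≫ φ = 0 ∧ ∀ r : R, r ∈ p ↔
        ∃ ψ, P.complex.d j ((ComplexShape.up ℕ).prev j) ≫ ψ = r • φ := by
  rw [exists_isAnnihilatorOf_congr (P.isoExt j Y).toLinearEquiv,
    exists_isAnnihilatorOf_homology_iff]
  rfl

end ExtCocycle

section ExtTorsion

variable {R : Type} [CommRing R] {X Y : ModuleCat.{0} R} (P : ProjectiveResolution X)

theorem CategoryTheory.ProjectiveResolution.smul_extMk {j : ℕ} (φ : P.complex.X j ⟶ Y)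
    (hφ : P.complex.d (j + 1) j ≫ φ = 0) (r : R) (hrφ : P.complex.d (j + 1) j ≫ (r • φ) = 0) :
    r • P.extMk φ (j + 1) rfl hφ = P.extMk (r • φ) (j + 1) rfl hrφ := by
  rw [Abelian.Ext.smul_eq_comp_mk₀, P.extMk_comp_mk₀]
  simp only [Linear.comp_smul, Category.comp_id]

theorem CategoryTheory.ProjectiveResolution.extMk_zero_eq_zero_iff_s16 (φ : P.complex.X 0 ⟶ Y)
    (hφ : P.complex.d 1 0 ≫ φ = 0) : P.extMk φ 1 rfl hφ = 0 ↔ φ = 0 := by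
  refine ⟨fun h => ?_, by rintro rfl; simp⟩
  simp only [← P.extEquivCohomologyClass.apply_eq_iff_eq,
    ProjectiveResolution.extEquivCohomologyClass_extMk,
    ProjectiveResolution.extEquivCohomologyClass_zero,
    CochainComplex.HomComplex.CohomologyClass.mk_eq_zero_iff] at h
  rw [CochainComplex.HomComplex.Cocycle.toSingleMk_mem_coboundaries_iff _ _ _ _ _ 1
    (by simp)] at h
  obtain ⟨g, hg⟩ := h
  have hg0 : g = 0 :=
    (CochainComplex.isZero_of_isStrictlyLE P.cochainComplex 0 1).eq_of_src _ _
  rw [hg0, Limits.comp_zero] at hg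
  rw [← cancel_epi (P.cochainComplexXIso (-(0 : ℕ)) 0 rfl).hom, ← hg, Limits.comp_zero]

theorem CategoryTheory.ProjectiveResolution.extMk_eq_zero_iff_prev {j : ℕ}
    (φ : P.complex.X j ⟶ Y) (hφ : P.complex.d (j + 1) j ≫ φ = 0) :
    P.extMk φ (j + 1) rfl hφ = 0 ↔
      ∃ ψ, P.complex.d j ((ComplexShape.up ℕ).prev j) ≫ ψ = φ := by
  cases j with
  | zero =>
    rw [P.extMk_zero_eq_zero_iff_s16, CochainComplex.prev_nat_zero, P.complex.shape 0 0 (by simp)]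
    simp [eq_comm]
  | succ j =>
    rw [CochainComplex.prev_nat_succ]
    exact P.extMk_eq_zero_iff φ _ rfl hφ j rfl

theorem exists_isAnnihilatorOf_ext_iff (Y : ModuleCat.{0} R) (j : ℕ) (p : Ideal R) :
    (∃ t : Abelian.Ext X Y j, IsAnnihilatorOf p t) ↔
      ∃ φ : P.complex.X j ⟶ Y, P.complex.d (j + 1) j ≫ φ = 0 ∧ ∀ r : R, r ∈ p ↔
        ∃ ψ, P.complex.d j ((ComplexShape.up ℕ).prev j) ≫ ψ = r • φ := by
  have key : ∀ (φ : P.complex.X j ⟶ Y) (hφ : P.complex.d (j + 1) j ≫ φ = 0) (r : R),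
      r • P.extMk φ (j + 1) rfl hφ = 0 ↔
        ∃ ψ, P.complex.d j ((ComplexShape.up ℕ).prev j) ≫ ψ = r • φ := fun φ hφ r => by
    rw [P.smul_extMk φ hφ r (by rw [Linear.comp_smul, hφ, smul_zero]),
      P.extMk_eq_zero_iff_prev]
  constructor
  · rintro ⟨t, ht⟩
    obtain ⟨φ, hφ, rfl⟩ := P.extMk_surjective t (j + 1) rfl
    exact ⟨φ, hφ, fun r => (ht r).trans (key φ hφ r)⟩
  · rintro ⟨φ, hφ, h⟩
    exact ⟨_, fun r => (h r).trans (key φ hφ r).symm⟩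

/-- `Ext^j(X, -)` computed by derived functors and in the derived category have the same
associated primes. -/
theorem mem_associatedPrimes_extFunctor_iff [IsNoetherianRing R] (X Y : ModuleCat.{0} R)
    (j : ℕ) (p : Ideal R) :
    p ∈ associatedPrimes R (((Ext R (ModuleCat.{0} R) j).obj (op X)).obj Y) ↔
      p.IsPrime ∧ ∃ t : Abelian.Ext X Y j, IsAnnihilatorOf p t := by
  rw [mem_associatedPrimes_iff_isAnnihilatorOf,
    exists_isAnnihilatorOf_extFunctor_iff (ProjectiveResolution.of X),
    exists_isAnnihilatorOf_ext_iff (ProjectiveResolution.of X)]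

theorem IsTorsionAt.exists_smul_hom_eq_zero {p : Ideal R} (hp : p.IsPrime)
    {F K : Type*} [AddCommGroup F] [Module R F] [Module.Finite R F] [AddCommGroup K] [Module R K]
    (hK : IsTorsionAt p K) (φ : F →ₗ[R] K) : ∃ s ∉ p, s • φ = 0 := by
  classical
  obtain ⟨g, hg⟩ := Module.Finite.fg_top (R := R) (M := F)
  choose c hc hc' using fun z => hK (φ z)
  refine ⟨∏ b ∈ g, c b, ?_, LinearMap.ext_on (s := (g : Set F)) hg fun b hb => ?_⟩
  · rw [hp.prod_mem_iff]
    push Not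
    exact fun b _ => hc b
  · rw [LinearMap.smul_apply, ← Finset.prod_erase_mul _ _ hb, mul_smul, hc', smul_zero,
      LinearMap.zero_apply]

theorem IsTorsionAt.ext [IsNoetherianRing R] {p : Ideal R} (hp : p.IsPrime) [Module.Finite R X]
    {K : ModuleCat.{0} R} (hK : IsTorsionAt p K) (j : ℕ) :
    IsTorsionAt p (Abelian.Ext X K j) := fun t => by
  obtain ⟨P, hP⟩ := exists_projectiveResolution_finite X
  have := hP j
  obtain ⟨φ, hφ, rfl⟩ := P.extMk_surjective t (j + 1) rfl
  obtain ⟨s, hs, hsφ⟩ := hK.exists_smul_hom_eq_zero hp φ.hom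
  have hsφ₁ : s • φ = 0 := ModuleCat.hom_ext hsφ
  refine ⟨s, hs, ?_⟩
  rw [P.smul_extMk φ hφ s (by rw [hsφ₁, Limits.comp_zero])]
  simp [hsφ₁]

theorem exists_isAnnihilatorOf_ext_zero_iff (X Y : ModuleCat.{0} R) (p : Ideal R) :
    (∃ t : Abelian.Ext X Y 0, IsAnnihilatorOf p t) ↔ ∃ φ : X →ₗ[R] Y, IsAnnihilatorOf p φ :=
  (exists_isAnnihilatorOf_congr (Abelian.Ext.linearEquiv₀ (R := R))).trans
    (exists_isAnnihilatorOf_congr ModuleCat.homLinearEquiv)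

end ExtTorsion

section GradedCocycles

variable {R S M : Type*} [CommRing R] [CommRing S] [Algebra R S] [AddCommGroup M] [Module R M]
  [Module S M] [IsScalarTower R S M]

theorem Module.Finite.linearMap_of_isNoetherianRing [IsNoetherianRing S] [Module.Finite S M]
    (F : Type*) [AddCommGroup F] [Module R F] [Module.Finite R F] :
    Module.Finite S (F →ₗ[R] M) := by
  obtain ⟨g, hg⟩ := Module.Finite.fg_top (R := R) (M := F)
  let ev : (F →ₗ[R] M) →ₗ[S] (g → M) :=
    { toFun := fun h i => h i
      map_add' := fun _ _ => rfl
      map_smul' := fun _ _ => rfl }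
  exact Module.Finite.of_injective ev fun h h' hh =>
    LinearMap.ext_on (s := (g : Set F)) hg fun b hb => congrFun hh ⟨b, hb⟩

variable (ℳ : ℕ → Submodule R M) [DirectSum.Decomposition ℳ]

/-- The projection onto a graded piece. -/
noncomputable def gradedPieceProj (n : ℕ) : M →ₗ[R] ℳ n :=
  DirectSum.component R ℕ (fun i => ℳ i) n ∘ₗ (DirectSum.decomposeLinearEquiv ℳ).toLinearMap

theorem gradedPieceProj_apply (n : ℕ) (m : M) :
    gradedPieceProj ℳ n m = DirectSum.decompose ℳ m n := rfl

theorem gradedPieceProj_comp_subtype (n : ℕ) :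
    gradedPieceProj ℳ n ∘ₗ (ℳ n).subtype = LinearMap.id :=
  LinearMap.ext fun m => by simp [gradedPieceProj_apply]

theorem exists_forall_lt_gradedPieceProj_comp_eq_zero {F : Type*} [AddCommGroup F] [Module R F]
    [Module.Finite R F] (h : F →ₗ[R] M) : ∃ D, ∀ n > D, gradedPieceProj ℳ n ∘ₗ h = 0 := by
  classical
  obtain ⟨g, hg⟩ := Module.Finite.fg_top (R := R) (M := F)
  refine ⟨g.sup fun b => (DirectSum.decompose ℳ (h b)).support.sup id, fun n hn =>
    LinearMap.ext_on (s := (g : Set F)) hg fun b hb => ?_⟩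
  by_contra hne
  have hmem : n ∈ (DirectSum.decompose ℳ (h b)).support := DFinsupp.mem_support_iff.2 hne
  have h1 : n ≤ (DirectSum.decompose ℳ (h b)).support.sup id := Finset.le_sup (f := id) hmem
  have h2 := Finset.le_sup (f := fun b => (DirectSum.decompose ℳ (h b)).support.sup id) hb
  exact absurd (h1.trans h2) (not_le.2 hn)

/-- The prime annihilators of cohomology classes of `Hom(-, ℳ n)` of a complex
`F₁ → F → F₀` with `F` finite do not depend on large `n`. -/
theorem exists_forall_prime_annihilators_cohomology_eq [IsNoetherianRing S] [Module.Finite S M]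
    (𝒜 : ℕ → Submodule R S) [SetLike.GradedSMul 𝒜 ℳ]
    (hstd : Algebra.adjoin R (𝒜 1 : Set S) = ⊤)
    {F₁ F F₀ : Type*} [AddCommGroup F₁] [Module R F₁] [AddCommGroup F] [Module R F]
    [AddCommGroup F₀] [Module R F₀] [Module.Finite R F] (c : F₁ →ₗ[R] F) (b : F →ₗ[R] F₀) :
    ∃ (n₀ : ℕ) (T : Set (Ideal R)), ∀ n ≥ n₀,
      {p : Ideal R | p.IsPrime ∧ ∃ φ : F →ₗ[R] ℳ n, φ ∘ₗ c = 0 ∧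
        ∀ r, r ∈ p ↔ ∃ ψ : F₀ →ₗ[R] ℳ n, ψ ∘ₗ b = r • φ} = T := by
  have := Module.Finite.linearMap_of_isNoetherianRing (S := S) (M := M) (R := R) F
  let B : Submodule S (F →ₗ[R] M) :=
    { carrier := {h | ∃ ψ : F₀ →ₗ[R] M, ψ ∘ₗ b = h}
      add_mem' := by
        rintro _ _ ⟨ψ, rfl⟩ ⟨ψ', rfl⟩
        exact ⟨ψ + ψ', LinearMap.add_comp _ _ _⟩
      zero_mem' := ⟨0, LinearMap.zero_comp _⟩
      smul_mem' := by
        rintro a _ ⟨ψ, rfl⟩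
        exact ⟨a • ψ, LinearMap.smul_comp _ _ _⟩ }
  let Z : ℕ → Submodule R (F →ₗ[R] M) := fun n =>
    { carrier := {h | (∀ z, h z ∈ ℳ n) ∧ h ∘ₗ c = 0}
      add_mem' := fun {h h'} hh hh' => ⟨fun z => (ℳ n).add_mem (hh.1 z) (hh'.1 z), by
        rw [LinearMap.add_comp, hh.2, hh'.2, add_zero]⟩
      zero_mem' := ⟨fun z => (ℳ n).zero_mem, LinearMap.zero_comp _⟩
      smul_mem' := fun a h hh => ⟨fun z => (ℳ n).smul_mem a (hh.1 z), by
        rw [LinearMap.smul_comp, hh.2, smul_zero]⟩ }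
  let V : ℕ → Submodule R (F →ₗ[R] M) := fun D =>
    { carrier := {h | ∀ n > D, gradedPieceProj ℳ n ∘ₗ h = 0}
      add_mem' := fun {h h'} hh hh' n hn => by
        rw [LinearMap.comp_add, hh n hn, hh' n hn, add_zero]
      zero_mem' := fun n _ => LinearMap.comp_zero _
      smul_mem' := fun a h hh n hn => by rw [LinearMap.comp_smul, hh n hn, smul_zero] }
  have hlift : ∀ n, ∀ h ∈ Z n, ∃ φ : F →ₗ[R] ℳ n, φ ∘ₗ c = 0 ∧ (ℳ n).subtype ∘ₗ φ = h :=
    fun n h hh => ⟨h.codRestrict (ℳ n) hh.1,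
      LinearMap.ext fun z => Subtype.ext (LinearMap.congr_fun hh.2 z), rfl⟩
  have hB : ∀ (n : ℕ) (φ : F →ₗ[R] ℳ n), (ℳ n).subtype ∘ₗ φ ∈ B ↔
      ∃ ψ : F₀ →ₗ[R] ℳ n, ψ ∘ₗ b = φ := by
    refine fun n φ => ⟨?_, ?_⟩
    · rintro ⟨ψ, hψ⟩
      refine ⟨gradedPieceProj ℳ n ∘ₗ ψ, ?_⟩
      rw [LinearMap.comp_assoc, hψ, ← LinearMap.comp_assoc, gradedPieceProj_comp_subtype,
        LinearMap.id_comp]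
    · rintro ⟨ψ, rfl⟩
      exact ⟨(ℳ n).subtype ∘ₗ ψ, rfl⟩
  let π : (F →ₗ[R] M) →ₗ[R] (F →ₗ[R] M) ⧸ B := B.mkQ.restrictScalars R
  have hπ : ∀ h, π h = 0 ↔ h ∈ B := fun h => Submodule.Quotient.mk_eq_zero B
  obtain ⟨n₀, T, hT⟩ := exists_forall_prime_annihilators_eq (E := (F →ₗ[R] M) ⧸ B) hstd
    (fun n => (Z n).map π)
    (by
      rintro n a ha _ ⟨h, hh, rfl⟩
      refine ⟨a • h, ⟨fun z => ?_, ?_⟩, rfl⟩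
      · have := SetLike.GradedSMul.smul_mem (A := 𝒜) (B := ℳ) ha (hh.1 z)
        rwa [vadd_eq_add, add_comm] at this
      · rw [LinearMap.smul_comp, hh.2, smul_zero])
    (fun D => (V D).map π)
    (fun D D' hD => Submodule.map_mono fun h hh n hn => hh n (hD.trans_lt hn))
    (fun e => by
      obtain ⟨h, rfl⟩ := Submodule.Quotient.mk_surjective _ e
      obtain ⟨D, hD⟩ := exists_forall_lt_gradedPieceProj_comp_eq_zero ℳ h
      exact ⟨D, h, hD, rfl⟩)
    (by
      rintro D n hDn _ ⟨h, hh, rfl⟩ ⟨h', hh', he⟩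
      obtain ⟨φ, -, rfl⟩ := hlift n h hh
      rw [hπ, hB]
      obtain ⟨ψ, hψ⟩ : (ℳ n).subtype ∘ₗ φ - h' ∈ B := by rw [← hπ, map_sub, he, sub_self]
      refine ⟨gradedPieceProj ℳ n ∘ₗ ψ, ?_⟩
      rw [LinearMap.comp_assoc, hψ, LinearMap.comp_sub, hh' n hDn, sub_zero,
        ← LinearMap.comp_assoc, gradedPieceProj_comp_subtype, LinearMap.id_comp])
  have key : ∀ (n : ℕ) (φ : F →ₗ[R] ℳ n) (r : R), r • π ((ℳ n).subtype ∘ₗ φ) = 0 ↔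
      ∃ ψ : F₀ →ₗ[R] ℳ n, ψ ∘ₗ b = r • φ := fun n φ r => by
    rw [← map_smul, hπ, ← LinearMap.comp_smul, hB]
  refine ⟨n₀, T, fun n hn => ?_⟩
  rw [← hT n hn]
  ext p
  refine and_congr_right fun _ => ⟨?_, ?_⟩
  · rintro ⟨φ, hφ, h⟩
    refine ⟨π ((ℳ n).subtype ∘ₗ φ), ⟨_, ⟨fun z => (φ z).2, ?_⟩, rfl⟩,
      fun r => (h r).trans (key n φ r).symm⟩
    rw [LinearMap.comp_assoc, hφ, LinearMap.comp_zero]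
  · rintro ⟨_, ⟨h, hh, rfl⟩, he⟩
    obtain ⟨φ, hφ, rfl⟩ := hlift n h hh
    exact ⟨φ, hφ, fun r => (he r).trans (key n φ r)⟩

end GradedCocycles

section AssExtStable

/-- Asymptotic stability of `Ass Ext^j(X, ℳ n)` for a finitely generated module `X`. -/
theorem associatedPrimes_extFunctor_stable {R : Type} [CommRing R] [IsNoetherianRing R]
    {S : Type*} [CommRing S] [Algebra R S] [IsNoetherianRing S] (𝒜 : ℕ → Submodule R S)
    (hstd : Algebra.adjoin R (𝒜 1 : Set S) = ⊤)
    {M : Type} [AddCommGroup M] [Module R M] [Module S M] [IsScalarTower R S M]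
    (ℳ : ℕ → Submodule R M) [SetLike.GradedSMul 𝒜 ℳ] [DirectSum.Decomposition ℳ]
    [Module.Finite S M] (X : ModuleCat.{0} R) [Module.Finite R X] (j : ℕ) :
    ∃ (n₀ : ℕ) (T : Set (Ideal R)), ∀ n ≥ n₀, associatedPrimes R
      (((Ext R (ModuleCat.{0} R) j).obj (op X)).obj (ModuleCat.of R (ℳ n))) = T := by
  obtain ⟨P, hP⟩ := exists_projectiveResolution_finite X
  have := hP j
  obtain ⟨n₀, T, hT⟩ := exists_forall_prime_annihilators_cohomology_eq ℳ 𝒜 hstd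
    (P.complex.d (j + 1) j).hom (P.complex.d j ((ComplexShape.up ℕ).prev j)).hom
  refine ⟨n₀, T, fun n hn => ?_⟩
  rw [← hT n hn]
  ext p
  rw [mem_associatedPrimes_iff_isAnnihilatorOf, exists_isAnnihilatorOf_extFunctor_iff P]
  refine and_congr_right fun _ => ⟨?_, ?_⟩
  · rintro ⟨φ, hφ, h⟩
    refine ⟨φ.hom, congrArg ModuleCat.Hom.hom hφ, fun r => (h r).trans ⟨?_, ?_⟩⟩
    · rintro ⟨ψ, hψ⟩
      exact ⟨ψ.hom, congrArg ModuleCat.Hom.hom hψ⟩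
    · rintro ⟨ψ, hψ⟩
      exact ⟨ModuleCat.ofHom ψ, ModuleCat.hom_ext hψ⟩
  · rintro ⟨φ, hφ, h⟩
    refine ⟨ModuleCat.ofHom φ, ModuleCat.hom_ext hφ, fun r => (h r).trans ⟨?_, ?_⟩⟩
    · rintro ⟨ψ, hψ⟩
      exact ⟨ModuleCat.ofHom ψ, ModuleCat.hom_ext hψ⟩
    · rintro ⟨ψ, hψ⟩
      exact ⟨ψ.hom, congrArg ModuleCat.Hom.hom hψ⟩

/-- Finitely many eventually constant families are simultaneously eventually constant. -/
theorem exists_forall_biUnion_le_eq {α : Type*} (F : ℕ → ℕ → Set α)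
    (h : ∀ j, ∃ (n₀ : ℕ) (T : Set α), ∀ n ≥ n₀, F j n = T) (D : Set α) (l : ℕ) :
    ∃ (n₀ : ℕ) (T : Set α), ∀ n ≥ n₀, ⋃ j ≤ l, F j n ∩ D = T := by
  choose m T hT using h
  refine ⟨(Finset.range (l + 1)).sup m, ⋃ j ≤ l, T j ∩ D, fun n hn => ?_⟩
  refine Set.iUnion₂_congr fun j hj => ?_
  rw [hT j n ((Finset.le_sup (Finset.mem_range.2 (by omega))).trans hn)]

end AssExtStable

section PrefixQuotients

theorem exists_notMem_smul_eq_zero_of_notMem_associatedPrimes {R : Type*} [CommRing R]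
    [IsNoetherianRing R] {N : Type*} [AddCommGroup N] [Module R N] {p : Ideal R} (hp : p.IsPrime)
    (hpN : p ∉ associatedPrimes R N) {y : R} (hy : ∀ q ∈ associatedPrimes R N, q < p → y ∉ q)
    (z : N) (hz : y • z = 0) : ∃ s ∉ p, s • z = 0 := by
  by_contra! hne
  have hle : (Submodule.span R {z}).annihilator ≤ p := fun s hs => by
    by_contra hsp
    exact hne s hsp ((Submodule.mem_annihilator_span_singleton z s).1 hs)
  obtain ⟨q, hq, hqp⟩ := Ideal.exists_minimalPrimes_le hle
  have hqN : q ∈ associatedPrimes R N :=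
    associatedPrimes.subset_of_injective (Submodule.subtype_injective (Submodule.span R {z}))
      (Module.associatedPrimes.minimalPrimes_annihilator_subset_associatedPrimes R _ hq)
  have hyq : y ∈ q := hq.1.2 ((Submodule.mem_annihilator_span_singleton z y).2 hz)
  obtain rfl | hlt := hqp.eq_or_lt
  · exact hpN hqN
  · exact hy q hqN hlt hyq

theorem ringKrullDim_quotient_add_one_le_of_lt {R : Type*} [CommRing R] {q p : Ideal R}
    [q.IsPrime] (h : q < p) : ringKrullDim (R ⧸ p) + 1 ≤ ringKrullDim (R ⧸ q) := by
  obtain ⟨x, hxp, hxq⟩ := SetLike.exists_of_lt h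
  refine ringKrullDim_succ_le_of_surjective (Ideal.Quotient.factor h.le)
    (Ideal.Quotient.factor_surjective h.le) (r := Ideal.Quotient.mk q x) ?_ ?_
  · exact mem_nonZeroDivisors_of_ne_zero (mt Ideal.Quotient.eq_zero_iff_mem.1 hxq)
  · rw [Ideal.Quotient.factor_mk, Ideal.Quotient.eq_zero_iff_mem.2 hxp]

theorem zdim_lt_ringKrullDim_quotient_of_lt {R : Type} [CommRing R] [IsNoetherianRing R]
    [IsLocalRing R] {q p : Ideal R} [q.IsPrime] [p.IsPrime] (h : q < p) {k : ℤ}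
    (hk : zdim k ≤ ringKrullDim (R ⧸ p)) : zdim k < ringKrullDim (R ⧸ q) := by
  refine (hk.trans_lt ?_).trans_le (ringKrullDim_quotient_add_one_le_of_lt h)
  have h1 : ringKrullDim (R ⧸ p) < ⊤ := (ringKrullDim_quotient_le p).trans_lt ringKrullDim_lt_top
  have h2 : 0 ≤ ringKrullDim (R ⧸ p) := ringKrullDim_nonneg_of_nontrivial
  obtain ⟨d, hd⟩ : ∃ d : ℕ, ringKrullDim (R ⧸ p) = d := by
    revert h1 h2
    generalize ringKrullDim (R ⧸ p) = e
    intro h1 h2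
    induction e with
    | bot => simp at h2
    | coe e =>
      induction e with
      | top => exact absurd h1 (lt_irrefl _)
      | coe e => exact ⟨e, rfl⟩
  rw [hd]
  have h3 : (d : ℕ∞) < ((d + 1 : ℕ) : ℕ∞) := Nat.cast_lt.2 d.lt_succ_self
  exact WithBot.coe_lt_coe.2 h3

theorem exists_isAnnihilatorOf_quotient_hom_iff {R : Type*} [CommRing R] {J p : Ideal R}
    (hJ : J ≤ p) {N : Type*} [AddCommGroup N] [Module R N] :
    (∃ φ : R ⧸ J →ₗ[R] N, IsAnnihilatorOf p φ) ↔ ∃ z : N, IsAnnihilatorOf p z := by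
  constructor
  · rintro ⟨φ, hφ⟩
    refine ⟨φ 1, fun r => (hφ r).trans ⟨fun h => LinearMap.congr_fun h 1, fun h => ?_⟩⟩
    ext
    exact h
  · rintro ⟨z, hz⟩
    refine ⟨Submodule.liftQ J (LinearMap.toSpanSingleton R N z) fun r hr => (hz r).1 (hJ hr),
      fun r => (hz r).trans ⟨fun h => ?_, fun h => ?_⟩⟩
    · ext
      change r • ((1 : R) • z) = 0
      rw [one_smul, h]
    · have h1 : r • ((1 : R) • z) = 0 := LinearMap.congr_fun h (Submodule.Quotient.mk 1)
      rwa [one_smul] at h1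

theorem le_of_isAnnihilatorOf_ext_quotient {R : Type} [CommRing R] {J p : Ideal R}
    {Y : ModuleCat.{0} R} {j : ℕ} {t : Abelian.Ext (ModuleCat.of R (R ⧸ J)) Y j} (h : IsAnnihilatorOf p t) : J ≤ p :=
  fun r hr => (h r).2 <| ext_smul_eq_zero (fun z => by
    obtain ⟨z, rfl⟩ := Submodule.Quotient.mk_surjective J z
    exact (Submodule.Quotient.mk_eq_zero J).2 (J.mul_mem_right z hr)) t

theorem radical_span_range_pow {R ι : Type*} [CommSemiring R] (a : ι → R) (e : ι → ℕ)
    (he : ∀ i, 0 < e i) : (Ideal.span (Set.range fun i => a i ^ e i)).radical =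
      (Ideal.span (Set.range a)).radical := by
  apply le_antisymm
  · refine Ideal.radical_mono (Ideal.span_le.2 ?_)
    rintro _ ⟨i, rfl⟩
    exact Ideal.pow_mem_of_mem _ (Ideal.subset_span (Set.mem_range_self i)) _ (he i)
  · refine Ideal.radical_le_radical_iff.2 (Ideal.span_le.2 ?_)
    rintro _ ⟨i, rfl⟩
    exact Ideal.mem_radical_iff.2 ⟨e i, Ideal.subset_span (Set.mem_range_self i)⟩

theorem exists_isAnnihilatorOf_ext_of_iso {R : Type} [CommRing R] {X Y Y' : ModuleCat.{0} R}
    (e : Y ≅ Y') {j : ℕ} {p : Ideal R} (h : ∃ t : Abelian.Ext X Y j, IsAnnihilatorOf p t) :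
    ∃ t : Abelian.Ext X Y' j, IsAnnihilatorOf p t := by
  obtain ⟨t, ht⟩ := h
  refine ⟨t.comp (Abelian.Ext.mk₀ e.hom) (add_zero j), fun r => ?_⟩
  rw [ht r, ← Abelian.Ext.smul_comp]
  refine ⟨fun h => by rw [h, Abelian.Ext.zero_comp], fun h => ?_⟩
  have h' := congrArg (fun u => Abelian.Ext.comp u (Abelian.Ext.mk₀ e.inv) (add_zero j)) h
  simpa using h'

variable {R : Type} [CommRing R] {m : ℕ} (x : Fin m → R)

theorem prefIdeal_mono {i j : ℕ} (h : i ≤ j) : prefIdeal x i ≤ prefIdeal x j :=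
  Ideal.span_mono (Set.image_mono fun _ hi => lt_of_lt_of_le hi h)

theorem prefIdeal_zero : prefIdeal x 0 = ⊥ := by
  simp [prefIdeal]

theorem prefIdeal_succ_s16 (i : ℕ) : prefIdeal x (i + 1) =
    prefIdeal x i ⊔ Ideal.span {if h : i < m then x ⟨i, h⟩ else 0} := by
  apply le_antisymm
  · refine Ideal.span_le.2 ?_
    rintro _ ⟨a, ha, rfl⟩
    obtain h | h := Nat.lt_succ_iff_lt_or_eq.1 ha
    · exact Ideal.mem_sup_left (Ideal.subset_span ⟨a, h, rfl⟩)
    · subst h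
      exact Ideal.mem_sup_right (Ideal.subset_span (by simp))
  · refine sup_le (prefIdeal_mono x i.le_succ) ?_
    rw [Ideal.span_singleton_le_iff_mem]
    split_ifs with h
    · exact Ideal.subset_span ⟨⟨i, h⟩, Nat.lt_succ_self i, rfl⟩
    · exact Ideal.zero_mem _

theorem factor_prefIdeal_eq_zero_iff (N : Type) [AddCommGroup N] [Module R N] (i : ℕ)
    (z : N ⧸ (prefIdeal x i • ⊤ : Submodule R N)) :
    Submodule.factor (Submodule.smul_mono_left (N := (⊤ : Submodule R N))
      (prefIdeal_mono x i.le_succ)) z = 0 ↔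
      ∃ w, (if h : i < m then x ⟨i, h⟩ else 0) • w = z := by
  obtain ⟨z, rfl⟩ := Submodule.Quotient.mk_surjective _ z
  change Submodule.Quotient.mk z = 0 ↔ _
  rw [Submodule.Quotient.mk_eq_zero, prefIdeal_succ_s16, Submodule.sup_smul, Submodule.mem_sup]
  constructor
  · rintro ⟨u, hu, v, hv, rfl⟩
    rw [Submodule.ideal_span_singleton_smul, Submodule.mem_smul_pointwise_iff_exists] at hv
    obtain ⟨w, -, rfl⟩ := hv
    refine ⟨Submodule.Quotient.mk w, ?_⟩
    rw [← Submodule.Quotient.mk_smul, Submodule.Quotient.mk_add,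
      (Submodule.Quotient.mk_eq_zero _).2 hu, zero_add]
  · rintro ⟨w, hw⟩
    obtain ⟨w, rfl⟩ := Submodule.Quotient.mk_surjective _ w
    rw [← Submodule.Quotient.mk_smul, eq_comm, Submodule.Quotient.eq] at hw
    refine ⟨_, hw, _, ?_, sub_add_cancel _ _⟩
    rw [Submodule.ideal_span_singleton_smul, Submodule.mem_smul_pointwise_iff_exists]
    exact ⟨w, trivial, rfl⟩

end PrefixQuotients

section AssExtSeq

variable {R : Type} [CommRing R] [IsNoetherianRing R] [IsLocalRing R]

/-- For an `N`-sequence `x` in dimension `> k` whose entries are nilpotent modulo `J`, the primes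
of dimension `≥ k` associated to some `Ext^j(R/J, N)` with `j ≤ l` are the ones containing `J` and
associated to some `N/(x₁,…,x_d)N` with `d ≤ l`. -/
theorem exists_isAnnihilatorOf_ext_iff_exists_prefIdeal {N : Type} [AddCommGroup N] [Module R N]
    {k : ℤ} {m : ℕ} {x : Fin m → R} (hx : IsSeqInDimGT R N k x) {l : ℕ} (hl : l ≤ m)
    {J p : Ideal R} (hp : p.IsPrime) (hJ : J ≤ p) (hk : zdim k ≤ ringKrullDim (R ⧸ p))
    (hxJ : ∀ i, x i ∈ J.radical) :
    (∃ j ≤ l, ∃ t : Abelian.Ext (ModuleCat.of R (R ⧸ J)) (ModuleCat.of R N) j,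
        IsAnnihilatorOf p t) ↔
      ∃ d ≤ l, ∃ z : N ⧸ (prefIdeal x d • ⊤ : Submodule R N), IsAnnihilatorOf p z := by
  set X := ModuleCat.of R (R ⧸ J)
  let Q : ℕ → ModuleCat.{0} R := fun i =>
    ModuleCat.of R (N ⧸ (prefIdeal x i • ⊤ : Submodule R N))
  let y : ℕ → R := fun i => if h : i < m then x ⟨i, h⟩ else 0
  have hyJ : ∀ i, y i ∈ J.radical := fun i => by
    change (if h : i < m then x ⟨i, h⟩ else 0) ∈ J.radical
    split_ifs
    exacts [hxJ _, Ideal.zero_mem _]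
  have e₀ : Q 0 ≅ ModuleCat.of R N := (Submodule.quotEquivOfEqBot _ (by
    rw [prefIdeal_zero, Submodule.bot_smul])).toModuleIso
  have hreg : ∀ i < l, (¬ ∃ z : Q i, IsAnnihilatorOf p z) →
      ∀ z : Q i, y i • z = 0 → ∃ s ∉ p, s • z = 0 := fun i hi hni z hz => by
    refine exists_notMem_smul_eq_zero_of_notMem_associatedPrimes hp
      (fun h => hni (mem_associatedPrimes_iff_isAnnihilatorOf.1 h).2) (fun q hq hlt => ?_) z hz
    have := hq.isPrime
    have hy : y i = x ⟨i, by omega⟩ := dif_pos (by omega)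
    rw [hy]
    exact hx ⟨i, by omega⟩ q hq (zdim_lt_ringKrullDim_quotient_of_lt hlt hk)
  have main : ∀ d ≤ l, (∀ i < d, ¬ ∃ z : Q i, IsAnnihilatorOf p z) →
      ((∃ t : Abelian.Ext X (ModuleCat.of R N) d, IsAnnihilatorOf p t) ↔
        ∃ z : Q d, IsAnnihilatorOf p z) := fun d hd hmin => by
    have h := (ext_along_quotients (X := X) hp (fun K hK j => hK.ext hp j) Q y
      (fun i => ModuleCat.ofHom (Submodule.factor (Submodule.smul_mono_left
        (N := (⊤ : Submodule R N)) (prefIdeal_mono x i.le_succ))))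
      (fun i z => factor_prefIdeal_eq_zero_iff x N i z)
      (fun i => Submodule.factor_surjective (Submodule.smul_mono_left
        (N := (⊤ : Submodule R N)) (prefIdeal_mono x i.le_succ)))
      (fun i => (hp.radical_le_iff.2 hJ) (hyJ i))
      (fun i => by
        obtain ⟨c, hc⟩ := hyJ i
        refine ⟨c, fun z => ?_⟩
        obtain ⟨z, rfl⟩ := Submodule.Quotient.mk_surjective J z
        exact (Submodule.Quotient.mk_eq_zero J).2 (J.mul_mem_right z hc))
      d 0 fun i hi _ => hreg i (by omega) (hmin i (by omega))).2
    rw [zero_add, exists_isAnnihilatorOf_ext_zero_iff] at h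
    have h' := h.trans (exists_isAnnihilatorOf_quotient_hom_iff hJ)
    exact Iff.trans ⟨exists_isAnnihilatorOf_ext_of_iso e₀.symm,
      exists_isAnnihilatorOf_ext_of_iso e₀⟩ h'
  classical
  by_cases hex : ∃ d, d ≤ l ∧ ∃ z : Q d, IsAnnihilatorOf p z
  · obtain ⟨hd, hz⟩ := Nat.find_spec hex
    refine iff_of_true ⟨_, hd, (main _ hd fun i hi hzi => ?_).2 hz⟩ hex
    exact Nat.find_min hex hi ⟨hi.le.trans hd, hzi⟩
  · refine iff_of_false ?_ hex
    rintro ⟨j, hj, ht⟩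
    refine hex ⟨j, hj, (main j hj fun i hi hzi => ?_).1 ht⟩
    exact hex ⟨i, hi.le.trans hj, hzi⟩

/-- Up to `depth_k(I, N)`, the primes of dimension `≥ k` associated to the modules
`Ext^j(R/J, N)` only depend on the radical of `J`. -/
theorem iUnion_associatedPrimes_extFunctor_eq {N : Type} [AddCommGroup N] [Module R N]
    {k : ℤ} {I : Ideal R} {l : ℕ} (hl : (l : ℕ∞) ≤ depthK R k I N) {J J' : Ideal R}
    (hJ : J.radical = I.radical) (hJ' : J'.radical = I.radical) :
    ⋃ j ≤ l, associatedPrimes R (((Ext R (ModuleCat.{0} R) j).obj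
        (op (ModuleCat.of R (R ⧸ J)))).obj (ModuleCat.of R N)) ∩ dimGE R k =
      ⋃ j ≤ l, associatedPrimes R (((Ext R (ModuleCat.{0} R) j).obj
        (op (ModuleCat.of R (R ⧸ J')))).obj (ModuleCat.of R N)) ∩ dimGE R k := by
  obtain ⟨m, x, hxI, hx, hlm⟩ : ∃ (m : ℕ) (x : Fin m → R), (∀ i, x i ∈ I) ∧
      IsSeqInDimGT R N k x ∧ l ≤ m := by
    cases l with
    | zero => exact ⟨0, Fin.elim0, fun i => i.elim0, fun i => i.elim0, le_rfl⟩
    | succ l =>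
      have hlt : (l : ℕ∞) < depthK R k I N := lt_of_lt_of_le (by exact_mod_cast l.lt_succ_self) hl
      obtain ⟨_, ⟨m, x, hxI, hx, rfl⟩, hm⟩ := lt_sSup_iff.1 hlt
      exact ⟨m, x, hxI, hx, by exact_mod_cast hm⟩
  have key : ∀ {J : Ideal R}, J.radical = I.radical → ∀ p : Ideal R,
      (p ∈ ⋃ j ≤ l, associatedPrimes R (((Ext R (ModuleCat.{0} R) j).obj
        (op (ModuleCat.of R (R ⧸ J)))).obj (ModuleCat.of R N)) ∩ dimGE R k) ↔
      p.IsPrime ∧ p ∈ dimGE R k ∧ I ≤ p ∧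
        ∃ d ≤ l, ∃ z : N ⧸ (prefIdeal x d • ⊤ : Submodule R N), IsAnnihilatorOf p z := by
    intro J hJ p
    simp only [Set.mem_iUnion, Set.mem_inter_iff, mem_associatedPrimes_extFunctor_iff, exists_prop]
    have hxJ : ∀ i, x i ∈ J.radical := fun i => hJ ▸ Ideal.le_radical (hxI i)
    constructor
    · rintro ⟨j, hj, ⟨hp, t, ht⟩, hk⟩
      have hJp := le_of_isAnnihilatorOf_ext_quotient ht
      refine ⟨hp, hk, ?_, (exists_isAnnihilatorOf_ext_iff_exists_prefIdeal hx hlm hp hJp hk hxJ).1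
        ⟨j, hj, t, ht⟩⟩
      rwa [← hp.radical_le_iff, ← hJ, hp.radical_le_iff]
    · rintro ⟨hp, hk, hIp, h⟩
      have hJp : J ≤ p := by rwa [← hp.radical_le_iff, hJ, hp.radical_le_iff]
      obtain ⟨j, hj, ht⟩ :=
        (exists_isAnnihilatorOf_ext_iff_exists_prefIdeal hx hlm hp hJp hk hxJ).2 h
      exact ⟨j, hj, ⟨hp, ht⟩, hk⟩
  ext p
  rw [key hJ, key hJ']

end AssExtSeq

/-- Corollary: with `I = (a₁,…,a_s)` and `r` the eventual value of `depth_k(I, N_n)`, for every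
`l ≤ r` and fixed positive `t, t₁,…,t_s`, the sets
`⋃_{j≤l} Ass_R(Ext^j_R(R/I^t, N_n))_{≥k}` and
`⋃_{j≤l} Ass_R(Ext^j_R(R/(a₁^{t₁},…,a_s^{t_s}), N_n))_{≥k}` are stable for large `n`;
moreover, if `r < ∞` they are equal for large `n`. -/
theorem ass_ext_powers_graded_stable (R : Type) [CommRing R] [IsNoetherianRing R]
    [IsLocalRing R] (I : Ideal R)
    (s : ℕ) (a : Fin s → R) (ha : Ideal.span (Set.range a) = I)
    (S : Type) [CommRing S] [Algebra R S] [Algebra.FiniteType R S]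
    (𝒜 : ℕ → Submodule R S) [GradedAlgebra 𝒜]
    (hstd : Algebra.adjoin R (𝒜 1 : Set S) = ⊤)
    (h0 : 𝒜 0 = Subalgebra.toSubmodule (⊥ : Subalgebra R S))
    (M : Type) [AddCommGroup M] [Module R M] [Module S M] [IsScalarTower R S M]
    (ℳ : ℕ → Submodule R M) [SetLike.GradedSMul 𝒜 ℳ] [DirectSum.Decomposition ℳ]
    [Module.Finite S M]
    (k : ℤ) (hk : -1 ≤ k) (r : ℕ∞)
    (hev : ∃ n₀ : ℕ, ∀ n ≥ n₀, depthK R k I (ℳ n) = r)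
    (l : ℕ) (hl : (l : ℕ∞) ≤ r)
    (t : ℕ) (ht : 0 < t) (ts : Fin s → ℕ) (hts : ∀ i, 0 < ts i) :
    (∃ (n₁ : ℕ) (T₁ T₂ : Set (Ideal R)), ∀ n ≥ n₁,
      (⋃ j ≤ l, associatedPrimes R
          (((Ext R (ModuleCat R) j).obj (op (ModuleCat.of R (R ⧸ I ^ t)))).obj
            (ModuleCat.of R (ℳ n))) ∩ dimGE R k) = T₁
      ∧ (⋃ j ≤ l, associatedPrimes R
          (((Ext R (ModuleCat R) j).obj
            (op (ModuleCat.of R (R ⧸ Ideal.span (Set.range fun i => a i ^ ts i))))).obj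
            (ModuleCat.of R (ℳ n))) ∩ dimGE R k) = T₂)
    ∧ (r ≠ ⊤ → ∃ n₂ : ℕ, ∀ n ≥ n₂,
      (⋃ j ≤ l, associatedPrimes R
          (((Ext R (ModuleCat R) j).obj (op (ModuleCat.of R (R ⧸ I ^ t)))).obj
            (ModuleCat.of R (ℳ n))) ∩ dimGE R k)
        = (⋃ j ≤ l, associatedPrimes R
          (((Ext R (ModuleCat R) j).obj
            (op (ModuleCat.of R (R ⧸ Ideal.span (Set.range fun i => a i ^ ts i))))).obj
            (ModuleCat.of R (ℳ n))) ∩ dimGE R k)) := by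
  have := Algebra.FiniteType.isNoetherianRing R S
  constructor
  · obtain ⟨m₁, T₁, hT₁⟩ := exists_forall_biUnion_le_eq _ (fun j =>
      associatedPrimes_extFunctor_stable 𝒜 hstd ℳ (ModuleCat.of R (R ⧸ I ^ t)) j) (dimGE R k) l
    obtain ⟨m₂, T₂, hT₂⟩ := exists_forall_biUnion_le_eq _ (fun j =>
      associatedPrimes_extFunctor_stable 𝒜 hstd ℳ
        (ModuleCat.of R (R ⧸ Ideal.span (Set.range fun i => a i ^ ts i))) j) (dimGE R k) l
    exact ⟨max m₁ m₂, T₁, T₂, fun n hn =>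
      ⟨hT₁ n (le_of_max_le_left hn), hT₂ n (le_of_max_le_right hn)⟩⟩
  · obtain ⟨n₀, hn₀⟩ := hev
    refine fun _ => ⟨n₀, fun n hn => ?_⟩
    refine iUnion_associatedPrimes_extFunctor_eq (hl.trans_eq (hn₀ n hn).symm)
      (Ideal.radical_pow I ht.ne') ?_
    rw [radical_span_range_pow a ts hts, ha]
end
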